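/- Let e ∈ ℰ with vertex list V(e) = (v₁, …, v_k), and suppose there exists i ∈ {1, k} such that gcd(2v_i+1, 2v_j+1) = 1 for every j with v_j ≠ v_i. For each λ > 0 let I(λ) ⊆ ℐ^e be an interval such that every z ∈ X with 𝒫(z) ∈ I(λ) is regular and such that |I(λ)|/|ℐ^e| → 1 as λ → 0⁺, and set X^e(λ) = {z ∈ X : 𝒫(z) ∈ I(λ)}. Define δ(e,λ) = #{z ∈ X^e(λ) : Φ(z) = z and G(O(z)) = O(z)} / #X^e(λ), where O(z) = {F_λᵏ(z) : k ∈ ℤ} and G(x,y) = (y,x). Then lim_{λ→0⁺} δ(e,λ) = 1/((2⌊√e⌋+1)(2⌊√(e/2)⌋+1)); in particular, for all sufficiently small λ, the symmetric fixed points of the return map Φ in X^e(λ) have positive density, equal to this value. -/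

import Mathlib

open Filter Topology

/-- The discretised rotation `F(x,y) = (⌊λx⌋ − y, x)` as a permutation of `ℤ²`. -/
noncomputable def Fe (lam : ℝ) : Equiv.Perm (ℤ × ℤ) where
  toFun p := (⌊lam * p.1⌋ - p.2, p.1)
  invFun p := (p.2, ⌊lam * p.2⌋ - p.1)
  left_inv p := by simp
  right_inv p := by simp

/-- The point of `(λℤ)² ⊂ ℝ²` with lattice index `p ∈ ℤ²`. -/
noncomputable def pt (lam : ℝ) (p : ℤ × ℤ) : ℝ × ℝ := (lam * p.1, lam * p.2)

/-- The piecewise-affine function `P(x) = ⌊x⌋² + (2⌊x⌋+1)(x − ⌊x⌋)`. -/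
noncomputable def Pfun (x : ℝ) : ℝ := (⌊x⌋ : ℝ)^2 + (2*(⌊x⌋ : ℝ)+1)*(x - ⌊x⌋)

/-- The piecewise-affine Hamiltonian `𝒫(x,y) = P(x) + P(y)`. -/
noncomputable def ham (z : ℝ × ℝ) : ℝ := Pfun z.1 + Pfun z.2

/-- Euclidean distance from `z ∈ ℝ²` to the symmetry line `{(t,t)}`. -/
noncomputable def dline (z : ℝ × ℝ) : ℝ := |z.1 - z.2| / Real.sqrt 2

/-- The return domain `X`, described by lattice indices. -/
noncomputable def Xset (lam : ℝ) : Set (ℤ × ℤ) :=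
  {p | 0 ≤ p.1 ∧ 0 ≤ p.2 ∧
    dline (pt lam p) ≤ dline (pt lam ((Fe lam ^ 4) p)) ∧
    dline (pt lam p) < dline (pt lam ((Fe lam ^ (-4 : ℤ)) p))}

/-- The forward transit time `τ(z) = min{k ≥ 1 : F_λᵏ(z) ∈ X}`. -/
noncomputable def tauPlus (lam : ℝ) (p : ℤ × ℤ) : ℕ :=
  sInf {k : ℕ | 1 ≤ k ∧ (Fe lam ^ (k : ℤ)) p ∈ Xset lam}

/-- The first-return map `Φ(z) = F_λ^{τ(z)}(z)` (on lattice indices). -/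
noncomputable def Phi (lam : ℝ) (p : ℤ × ℤ) : ℤ × ℤ := (Fe lam ^ (tauPlus lam p : ℤ)) p

/-- The round-off map `R(x,y) = (⌊x⌋, ⌊y⌋)`. -/
noncomputable def Rmap (q : ℝ × ℝ) : ℤ × ℤ := (⌊q.1⌋, ⌊q.2⌋)

/-- `z = λ·p` is a transition point: `R(F_λ⁴(z)) ≠ R(z)`; these form the set `Λ`. -/
def IsTransition (lam : ℝ) (p : ℤ × ℤ) : Prop :=
  Rmap (pt lam ((Fe lam ^ 4) p)) ≠ Rmap (pt lam p)

/-- The set `Σ` of transition points within distance `λ(‖𝐰_{m,n}‖∞ + 2)` of some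
lattice point `(m,n) ∈ ℤ²` (sup norm). -/
def SigSet (lam : ℝ) : Set (ℤ × ℤ) :=
  {p | IsTransition lam p ∧ ∃ m n : ℤ,
    max |lam * p.1 - m| |lam * p.2 - n|
      ≤ lam * (((max |2*n+1| |2*m+1| : ℤ) : ℝ) + 2)}

/-- `e` is a sum of two integer squares. -/
def sumTwoSq (e : ℕ) : Prop := ∃ a b : ℤ, (e : ℤ) = a^2 + b^2

/-- The successor of `e` in the sequence `ℰ` of sums of two squares. -/
noncomputable def nextE (e : ℕ) : ℕ := sInf {f : ℕ | e < f ∧ sumTwoSq f}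

/-- The critical interval `ℐ^e = (e, e⁺)`. -/
noncomputable def Ie (e : ℕ) : Set ℝ := Set.Ioo (e : ℝ) (nextE e : ℝ)

/-- A point `z = λ·p ∈ X` with `𝒫(z) ∈ ℐ^e` is regular: neither `z` nor `Φ(z)`
is a transition point, the return orbit `𝒪_τ(z)` stays in the polygon class
(`𝒫 ∈ ℐ^e`), and `𝒪_τ(z)` avoids `Σ`. -/
noncomputable def RegularPt (lam : ℝ) (e : ℕ) (p : ℤ × ℤ) : Prop :=
  p ∈ Xset lam ∧ ham (pt lam p) ∈ Ie e ∧
  ¬ IsTransition lam p ∧ ¬ IsTransition lam (Phi lam p) ∧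
  (∀ k : ℕ, k ≤ tauPlus lam p → ham (pt lam ((Fe lam ^ (k : ℤ)) p)) ∈ Ie e) ∧
  (∀ k : ℕ, k ≤ tauPlus lam p → (Fe lam ^ (k : ℤ)) p ∉ SigSet lam)

/-- Position of the vertex with integer coordinate `c` in the first-octant
vertex ordering of the polygon class `e` (order of increasing `x`-coordinate). -/
def vidx (e c : ℕ) : ℕ :=
  if c ≤ Nat.sqrt (e / 2) then Nat.sqrt (e - c^2) - c else c - 1 - Nat.sqrt (e - c^2)

/-- The vertex list `V(e) = (v₁, …, v_k)`: the types `⌊√(e−c²)⌋` of the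
first-octant vertices, listed in order of increasing `x`-coordinate. -/
def vertexList (e : ℕ) : List ℕ :=
  (((List.range (Nat.sqrt e + 1)).mergeSort (fun c c' => vidx e c ≤ vidx e c')).map
    (fun c => Nat.sqrt (e - c^2)))

/-- The distinct vertex types `v_{ι(1)}, …, v_{ι(l)}` in order of occurrence. -/
def distinctTypes (e : ℕ) : List ℕ := (vertexList e).destutter (· ≠ ·)

/-- `q(e) = lcm((2v_{ι(1)}+1)², (2v_{ι(1)}+1)(2v_{ι(2)}+1), …,
(2v_{ι(l−1)}+1)(2v_{ι(l)}+1))`. -/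
def qe (e : ℕ) : ℕ :=
  ((((distinctTypes e).zip (distinctTypes e).tail).map
      (fun p => (2*p.1+1) * (2*p.2+1))).foldr Nat.lcm
    ((2 * (distinctTypes e).headD 0 + 1)^2))

/-- The generator `L = (q(e)/(2v₁+1))·(1,1)` of the lattice `𝕃^e`. -/
def Lvec (e : ℕ) : ℤ × ℤ :=
  ((qe e : ℤ) / (2 * (Nat.sqrt (e / 2) : ℤ) + 1),
   (qe e : ℤ) / (2 * (Nat.sqrt (e / 2) : ℤ) + 1))

/-- The vector `𝐰₁ = (2v₁+1, −(2v₁+1))`. -/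
def w1vec (e : ℕ) : ℤ × ℤ :=
  (2 * (Nat.sqrt (e / 2) : ℤ) + 1, -(2 * (Nat.sqrt (e / 2) : ℤ) + 1))

/-- The second generator `(L − 𝐰₁)/2` of the lattice `𝕃^e`. -/
def Mvec (e : ℕ) : ℤ × ℤ :=
  (((Lvec e).1 - (w1vec e).1) / 2, ((Lvec e).2 - (w1vec e).2) / 2)

/-- The lattice `𝕃^e ⊆ ℤ²` generated by `L` and `(L − 𝐰₁)/2`. -/
def latticeE (e : ℕ) : AddSubgroup (ℤ × ℤ) := AddSubgroup.closure {Lvec e, Mvec e}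
/-- The (two-sided) orbit `O(z) = {F_λᵏ(z) : k ∈ ℤ}` (lattice indices). -/
noncomputable def orbitSet (lam : ℝ) (p : ℤ × ℤ) : Set (ℤ × ℤ) :=
  {q | ∃ k : ℤ, q = (Fe lam ^ k) p}

/-- The reflection `G(x,y) = (y,x)`. -/
def Gmap (p : ℤ × ℤ) : ℤ × ℤ := (p.2, p.1)

/-- The domain `X^e(λ) = {z ∈ X : 𝒫(z) ∈ I}` (lattice indices). -/
noncomputable def XeSet (lam : ℝ) (I : Set ℝ) : Set (ℤ × ℤ) :=
  {p | p ∈ Xset lam ∧ ham (pt lam p) ∈ I}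

/-- The density `δ(e,λ)` of symmetric fixed points of the return map `Φ` in
`X^e(λ)`. -/
noncomputable def symFixDensity (lam : ℝ) (I : Set ℝ) : ℝ :=
  ({p | p ∈ XeSet lam I ∧ Phi lam p = p ∧
      Gmap '' orbitSet lam p = orbitSet lam p} : Set (ℤ × ℤ)).ncard /
    (XeSet lam I).ncard


theorem sumTwoSq_unb (e : ℕ) : ∃ f : ℕ, e < f ∧ sumTwoSq f :=
  ⟨(e+1)^2, by nlinarith, (e+1 : ℤ), 0, by push_cast; ring⟩

theorem nextE_spec (e : ℕ) : e < nextE e ∧ sumTwoSq (nextE e) :=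
  Nat.sInf_mem (s := {f : ℕ | e < f ∧ sumTwoSq f}) (sumTwoSq_unb e)

theorem nextE_gap (e : ℕ) (a b : ℤ) : a^2+b^2 ≤ (e:ℤ) ∨ (nextE e : ℤ) ≤ a^2+b^2 := by
  by_contra h
  push Not at h
  obtain ⟨h1, h2⟩ := h
  have h0 : 0 ≤ a^2+b^2 := by positivity
  have : nextE e ≤ (a^2+b^2).toNat :=
    Nat.sInf_le (s := {f : ℕ | e < f ∧ sumTwoSq f}) ⟨by omega, a, b, by omega⟩
  omega

/-- fourth iterate -/
theorem Fe4_apply (lam : ℝ) (X Y m a1 a2 a3 : ℤ) (h0 : ⌊lam * X⌋ = m)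
    (h1 : ⌊lam * ((m - Y : ℤ) : ℝ)⌋ = a1) (h2 : ⌊lam * ((a1 - X : ℤ):ℝ)⌋ = a2)
    (h3 : ⌊lam * ((Y + a2 - m : ℤ):ℝ)⌋ = a3) :
    (Fe lam ^ 4) (X, Y) = (X + a3 - a1, Y + a2 - m) := by
  have e1 : Fe lam (X, Y) = (m - Y, X) := by simp [Fe, h0]
  have e2 : Fe lam (m - Y, X) = (a1 - X, m - Y) := by
    simp only [Fe, Equiv.coe_fn_mk, h1]
  have e3 : Fe lam (a1 - X, m - Y) = (Y + a2 - m, a1 - X) := by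
    simp only [Fe, Equiv.coe_fn_mk, h2]; ext <;> simp; ring
  have e4 : Fe lam (Y + a2 - m, a1 - X) = (X + a3 - a1, Y + a2 - m) := by
    simp only [Fe, Equiv.coe_fn_mk, h3]; ext <;> simp; ring
  have : (Fe lam ^ 4) (X, Y) = Fe lam (Fe lam (Fe lam (Fe lam (X, Y)))) := rfl
  rw [this, e1, e2, e3, e4]

theorem ham_box (lam : ℝ) (X Y m n : ℤ) (hm : ⌊lam * X⌋ = m) (hn : ⌊lam * Y⌋ = n) :
    ham (pt lam (X, Y)) =
      (2*m+1)*(lam*X) + (2*n+1)*(lam*Y) - m^2 - m - n^2 - n := by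
  simp only [ham, pt, Pfun, hm, hn]; ring

/-- The numerical set-up. -/
structure Setup (e f v K : ℤ) : Prop where
  v0 : 0 ≤ v
  hK : K = 2*v+1
  hv : v^2 ≤ e
  hf : f ≤ (v+1)^2
  gap : ∀ a b : ℤ, a^2+b^2 ≤ e ∨ f ≤ a^2+b^2
  hef : e < f

/-- box facts -/
theorem box_le {e f v K : ℤ} (S : Setup e f v K) {m n : ℤ} (hm : 0 ≤ m) (hn : 0 ≤ n)
    (h : m^2+n^2 ≤ e) : m ≤ v ∧ n ≤ v := by
  have h1 := S.hf
  have h2 := S.hef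
  have h3 := S.v0
  constructor <;> by_contra hc <;> push Not at hc <;> nlinarith

structure InBox (e f : ℤ) (lam eta : ℝ) (X Y m n : ℤ) : Prop where
  m0 : 0 ≤ m
  n0 : 0 ≤ n
  hm : ⌊lam * X⌋ = m
  hn : ⌊lam * Y⌋ = n
  lo : e + eta ≤ (2*m+1)*(lam*X) + (2*n+1)*(lam*Y) - m^2 - m - n^2 - n
  hi : (2*m+1)*(lam*X) + (2*n+1)*(lam*Y) - m^2 - m - n^2 - n ≤ f - eta

theorem InBox.corner {e f v K : ℤ} (S : Setup e f v K) {lam eta : ℝ} {X Y m n : ℤ}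
    (he : 0 < eta) (B : InBox e f lam eta X Y m n) : m^2+n^2 ≤ e := by
  rcases S.gap m n with h | h
  · exact h
  · exfalso
    have h1 := Int.floor_le (lam*X); rw [B.hm] at h1
    have h2 := Int.floor_le (lam*Y); rw [B.hn] at h2
    have h3 := B.hi
    have m0 : (0:ℝ) ≤ m := by exact_mod_cast B.m0
    have n0 : (0:ℝ) ≤ n := by exact_mod_cast B.n0
    have h' : (f:ℝ) ≤ (m:ℝ)^2+(n:ℝ)^2 := by exact_mod_cast h
    nlinarith

theorem InBox.corner2 {e f v K : ℤ} (S : Setup e f v K) {lam eta : ℝ} {X Y m n : ℤ}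
    (he : 0 < eta) (B : InBox e f lam eta X Y m n) : f ≤ (m+1)^2+(n+1)^2 := by
  rcases S.gap (m+1) (n+1) with h | h
  · exfalso
    have h1 := Int.lt_floor_add_one (lam*X); rw [B.hm] at h1
    have h2 := Int.lt_floor_add_one (lam*Y); rw [B.hn] at h2
    have h3 := B.lo
    have m0 : (0:ℝ) ≤ m := by exact_mod_cast B.m0
    have n0 : (0:ℝ) ≤ n := by exact_mod_cast B.n0
    have h' : ((m:ℝ)+1)^2+((n:ℝ)+1)^2 ≤ e := by exact_mod_cast h
    nlinarith
  · exact h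

/-- step in a box with horizontal exit -/
theorem stepH {e f v K : ℤ} (S : Setup e f v K) {lam eta : ℝ} {X Y m n : ℤ}
    (hl : 0 < lam) (he : 0 < eta) (he1 : eta ≤ 1) (hs : 8 * lam * K^2 ≤ eta)
    (B : InBox e f lam eta X Y m n) (hc : f ≤ (m+1)^2+n^2) :
    (Fe lam ^ 4) (X, Y) =
      (X + (⌊lam * ((Y - (2*m+1) : ℤ):ℝ)⌋ - ⌊lam * ((m - Y : ℤ):ℝ)⌋), Y - (2*m+1)) ∧
    lam * X + lam * (2*n+1) < m + 1 ∧
    (lam * Y - lam * (2*m+1) < n → m < lam * X) ∧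
    (⌊lam * ((m - Y : ℤ):ℝ)⌋ = -n-1 ∨ (⌊lam * ((m - Y : ℤ):ℝ)⌋ = -n)) ∧
    (n ≤ lam * Y - lam * (2*m+1) → ⌊lam * ((Y - (2*m+1) : ℤ):ℝ)⌋ = n ∧ ⌊lam * ((m - Y : ℤ):ℝ)⌋ = -n-1) ∧
    (lam * Y - lam * (2*m+1) < n → ⌊lam * ((Y - (2*m+1) : ℤ):ℝ)⌋ = n - 1) := by
  obtain ⟨hmv, hnv⟩ := box_le S B.m0 B.n0 (B.corner S he)
  have hcor := B.corner S he
  have x1 := Int.floor_le (lam*X); rw [B.hm] at x1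
  have x2 := Int.lt_floor_add_one (lam*X); rw [B.hm] at x2
  have y1 := Int.floor_le (lam*Y); rw [B.hn] at y1
  have y2 := Int.lt_floor_add_one (lam*Y); rw [B.hn] at y2
  have m0 : (0:ℝ) ≤ m := by exact_mod_cast B.m0
  have n0 : (0:ℝ) ≤ n := by exact_mod_cast B.n0
  have hmv' : (m:ℝ) ≤ v := by exact_mod_cast hmv
  have hnv' : (n:ℝ) ≤ v := by exact_mod_cast hnv
  have hK : (K:ℝ) = 2*v+1 := by exact_mod_cast S.hK
  have hc' : (f:ℝ) ≤ ((m:ℝ)+1)^2+(n:ℝ)^2 := by exact_mod_cast hc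
  have hcor' : (m:ℝ)^2+(n:ℝ)^2 ≤ e := by exact_mod_cast hcor
  have lo := B.lo
  have hi := B.hi
  set x := lam * (X:ℝ) with hx
  set y := lam * (Y:ℝ) with hy
  have hK1 : (1:ℝ) ≤ K := by rw [hK]; linarith
  have hlK : lam * K ≤ lam * K^2 :=
    mul_le_mul_of_nonneg_left (by nlinarith) hl.le
  have lm : lam * (2*m+1) ≤ lam * K :=
    mul_le_mul_of_nonneg_left (by rw [hK]; linarith) hl.le
  have ln : lam * (2*n+1) ≤ lam * K :=
    mul_le_mul_of_nonneg_left (by rw [hK]; linarith) hl.le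
  have lm0 : 0 ≤ lam * m := by positivity
  have ln0 : 0 ≤ lam * n := by positivity
  have hlK2 : 8 * (lam * K^2) ≤ eta := by linarith
  have mK : (2*m+1:ℝ) ≤ K := by rw [hK]; linarith
  have A1 : x + lam * (2*n+1) < m + 1 := by
    by_contra hcon
    push Not at hcon
    have : (2*m+1) * (m+1-x) ≤ (2*m+1) * (lam * K) := by
      apply mul_le_mul_of_nonneg_left _ (by linarith); linarith
    have h2 : (2*m+1) * (lam * K) ≤ K * (lam * K) :=
      mul_le_mul_of_nonneg_right mK (by positivity)
    nlinarith
  have A2 : y - lam * (2*m+1) < n → m < x := by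
    intro h
    have h1 : (2*n+1) * (y-n) ≤ (2*n+1) * (lam * K) := by
      apply mul_le_mul_of_nonneg_left _ (by linarith); linarith
    have h2 : (2*n+1) * (lam * K) ≤ K * (lam * K) :=
      mul_le_mul_of_nonneg_right (by linarith) (by positivity)
    have h3 : 0 < (2*m+1) * (x - m) := by nlinarith
    by_contra h4
    push Not at h4
    nlinarith
  have c1 : lam * ((m - Y : ℤ):ℝ) = lam * m - y := by push_cast; ring
  have A3 : (⌊lam * ((m - Y : ℤ):ℝ)⌋ = -n-1 ∨ (⌊lam * ((m - Y : ℤ):ℝ)⌋ = -n)) := by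
    rw [c1]
    by_cases h : lam * m - y < -n
    · left; rw [Int.floor_eq_iff]; push_cast; constructor <;> linarith
    · right; rw [Int.floor_eq_iff]; push_cast; constructor <;> linarith
  have c3 : lam * ((Y - (2*m+1) : ℤ):ℝ) = y - lam * (2*m+1) := by push_cast; ring
  have A5 : (n ≤ y - lam * (2*m+1) → ⌊lam * ((Y - (2*m+1) : ℤ):ℝ)⌋ = n ∧ ⌊lam * ((m - Y : ℤ):ℝ)⌋ = -n-1) := by
    intro h
    rw [c1, c3, Int.floor_eq_iff, Int.floor_eq_iff]; push_cast
    refine ⟨⟨?_, ?_⟩, ?_, ?_⟩ <;> linarith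
  have A6 : (y - lam * (2*m+1) < n → ⌊lam * ((Y - (2*m+1) : ℤ):ℝ)⌋ = n - 1) := by
    intro h
    rw [c3, Int.floor_eq_iff]; push_cast
    constructor <;> linarith
  refine ⟨?_, A1, A2, A3, A5, A6⟩
  set a1 := ⌊lam * ((m - Y : ℤ):ℝ)⌋ with ha1
  have ha2 : ⌊lam * ((a1 - X : ℤ):ℝ)⌋ = -m-1 := by
    have c2 : lam * ((a1 - X : ℤ):ℝ) = lam * a1 - x := by push_cast; ring
    rw [c2, Int.floor_eq_iff]; push_cast
    rcases A3 with h | h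
    · rw [h]; push_cast
      constructor <;> linarith
    · rw [h]; push_cast
      refine ⟨by linarith, ?_⟩
      by_cases hy' : y - lam * (2*m+1) < n
      · have := A2 hy'; linarith
      · have := (A5 (by linarith)).2
        omega
  rw [Fe4_apply lam X Y m a1 (-m-1) _ B.hm rfl ha2 rfl]
  have : Y + (-m-1) - m = Y - (2*m+1) := by ring
  rw [this, add_sub_assoc]

/-- step in a box with vertical exit -/
theorem stepV {e f v K : ℤ} (S : Setup e f v K) {lam eta : ℝ} {X Y m n : ℤ}
    (hl : 0 < lam) (he : 0 < eta) (he1 : eta ≤ 1) (hs : 8 * lam * K^2 ≤ eta)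
    (B : InBox e f lam eta X Y m n) (hc : (m+1)^2+n^2 ≤ e) :
    (Fe lam ^ 4) (X, Y) = (X + (2*n+1), Y + ⌊lam * ((-n-1-X : ℤ):ℝ)⌋ - m) ∧
    n ≤ lam * Y - lam * (2*m+2) ∧
    (⌊lam * ((-n-1-X : ℤ):ℝ)⌋ = -m-1 ∨ (⌊lam * ((-n-1-X : ℤ):ℝ)⌋ = -m-2)) ∧
    (lam * X + lam * (2*n+1) < m+1 → ⌊lam * ((-n-1-X : ℤ):ℝ)⌋ = -m-1) := by
  obtain ⟨hmv, hnv⟩ := box_le S B.m0 B.n0 (B.corner S he)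
  have x1 := Int.floor_le (lam*X); rw [B.hm] at x1
  have x2 := Int.lt_floor_add_one (lam*X); rw [B.hm] at x2
  have y1 := Int.floor_le (lam*Y); rw [B.hn] at y1
  have y2 := Int.lt_floor_add_one (lam*Y); rw [B.hn] at y2
  have m0 : (0:ℝ) ≤ m := by exact_mod_cast B.m0
  have n0 : (0:ℝ) ≤ n := by exact_mod_cast B.n0
  have hmv' : (m:ℝ) ≤ v := by exact_mod_cast hmv
  have hnv' : (n:ℝ) ≤ v := by exact_mod_cast hnv
  have hK : (K:ℝ) = 2*v+1 := by exact_mod_cast S.hK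
  have hc' : ((m:ℝ)+1)^2+(n:ℝ)^2 ≤ e := by exact_mod_cast hc
  have lo := B.lo
  have hi := B.hi
  set x := lam * (X:ℝ) with hx
  set y := lam * (Y:ℝ) with hy
  have hK1 : (1:ℝ) ≤ K := by rw [hK]; linarith
  have hlK : lam * K ≤ lam * K^2 :=
    mul_le_mul_of_nonneg_left (by nlinarith) hl.le
  have lm : lam * (2*m+1) ≤ lam * K :=
    mul_le_mul_of_nonneg_left (by rw [hK]; linarith) hl.le
  have ln : lam * (2*n+1) ≤ lam * K :=
    mul_le_mul_of_nonneg_left (by rw [hK]; linarith) hl.le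
  have lm0 : 0 ≤ lam * m := by positivity
  have ln0 : 0 ≤ lam * n := by positivity
  have hlK2 : 8 * (lam * K^2) ≤ eta := by linarith
  have hlK1 : lam ≤ lam * K := by nlinarith
  have nK : (2*n+1:ℝ) ≤ K := by rw [hK]; linarith
  have A1 : n ≤ y - lam * (2*m+2) := by
    by_contra hcon
    push Not at hcon
    have : (2*n+1) * (y-n) ≤ (2*n+1) * (2*(lam * K)) := by
      apply mul_le_mul_of_nonneg_left _ (by linarith); linarith
    have h2 : (2*n+1) * (2*(lam * K)) ≤ K * (2*(lam * K)) :=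
      mul_le_mul_of_nonneg_right nK (by positivity)
    nlinarith
  have c1 : lam * ((m - Y : ℤ):ℝ) = lam * m - y := by push_cast; ring
  have ha1 : ⌊lam * ((m - Y : ℤ):ℝ)⌋ = -n-1 := by
    rw [c1, Int.floor_eq_iff]; push_cast; constructor <;> linarith
  have c2 : lam * ((-n-1-X : ℤ):ℝ) = -x - lam*(n+1) := by push_cast; ring
  have A3 : (⌊lam * ((-n-1-X : ℤ):ℝ)⌋ = -m-1 ∨ (⌊lam * ((-n-1-X : ℤ):ℝ)⌋ = -m-2)) := by
    rw [c2]
    by_cases h : x + lam*(n+1) ≤ m+1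
    · left; rw [Int.floor_eq_iff]; push_cast; constructor <;> linarith
    · right; rw [Int.floor_eq_iff]; push_cast; constructor <;> linarith
  refine ⟨?_, A1, A3, ?_⟩
  · set a2 := ⌊lam * ((-n-1-X : ℤ):ℝ)⌋ with ha2
    have ha3 : ⌊lam * ((Y + a2 - m : ℤ):ℝ)⌋ = n := by
      have c3 : lam * ((Y + a2 - m : ℤ):ℝ) = y + lam * a2 - lam * m := by push_cast; ring
      rw [c3, Int.floor_eq_iff]
      rcases A3 with h | h <;> rw [h] <;> push_cast <;> constructor <;> linarith
    rw [Fe4_apply lam X Y m (-n-1) a2 n B.hm ha1 rfl ha3]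
    ext <;> simp; ring
  · intro h
    rw [c2, Int.floor_eq_iff]; push_cast; constructor <;> linarith

/-- Points following the polygon class, with room for drift. -/
structure Good (e f v K : ℤ) (lam eps : ℝ) (X Y m n : ℤ) : Prop where
  X0 : 0 ≤ X
  Y0 : 0 ≤ Y
  hm : ⌊lam * X⌋ = m
  hn : ⌊lam * Y⌋ = n
  mv : m ≤ v
  nv : n ≤ v
  lo : e + eps - 2*(lam*K)*(m-n+v) ≤
    (2*m+1)*(lam*X) + (2*n+1)*(lam*Y) - m^2 - m - n^2 - n
  hi : (2*m+1)*(lam*X) + (2*n+1)*(lam*Y) - m^2 - m - n^2 - n ≤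
    f - eps + 2*(lam*K)*(m-n+v)

/-- Smallness of the parameters. -/
structure SmallP (K : ℤ) (lam eps : ℝ) : Prop where
  hl : 0 < lam
  he : 0 < eps
  he1 : eps ≤ 1
  hs : 16 * lam * K^2 ≤ eps

theorem Good.m0 {e f v K : ℤ} {lam eps : ℝ} {X Y m n : ℤ} (hl : 0 < lam)
    (G : Good e f v K lam eps X Y m n) : 0 ≤ m := by
  rw [← G.hm]; apply Int.floor_nonneg.2
  have : (0:ℝ) ≤ X := by exact_mod_cast G.X0
  positivity

theorem Good.n0 {e f v K : ℤ} {lam eps : ℝ} {X Y m n : ℤ} (hl : 0 < lam)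
    (G : Good e f v K lam eps X Y m n) : 0 ≤ n := by
  rw [← G.hn]; apply Int.floor_nonneg.2
  have : (0:ℝ) ≤ Y := by exact_mod_cast G.Y0
  positivity

theorem Good.inBox {e f v K : ℤ} (S : Setup e f v K) {lam eps : ℝ} {X Y m n : ℤ}
    (s : SmallP K lam eps)
    (G : Good e f v K lam eps X Y m n) : InBox e f lam (eps/2) X Y m n := by
  have m0 : (0:ℝ) ≤ m := by exact_mod_cast G.m0 s.hl
  have n0 : (0:ℝ) ≤ n := by exact_mod_cast G.n0 s.hl
  have mv : (m:ℝ) ≤ v := by exact_mod_cast G.mv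
  have nv : (n:ℝ) ≤ v := by exact_mod_cast G.nv
  have hK : (K:ℝ) = 2*v+1 := by exact_mod_cast S.hK
  have hK0 : 0 ≤ lam * K := mul_nonneg s.hl.le (by rw [hK]; linarith)
  have h1 : 2*(lam*K)*(m-n+v) ≤ 2*(lam*K)*K :=
    mul_le_mul_of_nonneg_left (by rw [hK]; linarith) (by linarith)
  have h2 := s.hs
  have h3 := s.he
  refine ⟨G.m0 s.hl, G.n0 s.hl, G.hm, G.hn, ?_, ?_⟩
  · have := G.lo; nlinarith
  · have := G.hi; nlinarith

theorem goodH {e f v K : ℤ} (S : Setup e f v K) {lam eps : ℝ} {X Y m n : ℤ}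
    (s : SmallP K lam eps) (G : Good e f v K lam eps X Y m n) (hc : f ≤ (m+1)^2+n^2) :
    ∃ k : ℤ, k = ⌊lam * ((Y - (2*m+1) : ℤ):ℝ)⌋ - ⌊lam * ((m - Y : ℤ):ℝ)⌋ ∧
      (Fe lam ^ 4) (X, Y) = (X + k, Y - (2*m+1)) ∧
      ((n ≤ lam * Y - lam * (2*m+1) ∧ k = 2*n+1 ∧
        Good e f v K lam eps (X+k) (Y-(2*m+1)) m n) ∨
       (lam * Y - lam * (2*m+1) < n ∧ (k = 2*n-1 ∨ k = 2*n) ∧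
        (1 ≤ n → Good e f v K lam eps (X+k) (Y-(2*m+1)) m (n-1)))) := by
  have B := G.inBox S s
  have hl := s.hl
  obtain ⟨h1, h2, h3, h4, h5, h6⟩ := stepH S s.hl (half_pos s.he) (by linarith [s.he1, s.he])
    (by linarith [s.hs]) B hc
  refine ⟨_, rfl, h1, ?_⟩
  set k := ⌊lam * ((Y - (2*m+1) : ℤ):ℝ)⌋ - ⌊lam * ((m - Y : ℤ):ℝ)⌋ with hk
  have x1 := Int.floor_le (lam*X); rw [G.hm] at x1
  have y1 := Int.floor_le (lam*Y); rw [G.hn] at y1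
  have m0 : (0:ℝ) ≤ m := by exact_mod_cast B.m0
  have n0 : (0:ℝ) ≤ n := by exact_mod_cast B.n0
  have hmv' : (m:ℝ) ≤ v := by exact_mod_cast G.mv
  have hnv' : (n:ℝ) ≤ v := by exact_mod_cast G.nv
  have hK : (K:ℝ) = 2*v+1 := by exact_mod_cast S.hK
  have lm0 : 0 ≤ lam * m := by positivity
  have ln0 : 0 ≤ lam * n := by positivity
  have lmK : lam * (2*m+1) ≤ lam * K := mul_le_mul_of_nonneg_left (by rw [hK]; linarith) hl.le
  have mz := B.m0
  have nz := B.n0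
  by_cases hy : n ≤ lam * Y - lam * (2*m+1)
  · left
    obtain ⟨a, b⟩ := h5 hy
    have hk' : k = 2*n+1 := by omega
    refine ⟨hy, hk', ?_⟩
    rw [hk']
    refine ⟨by have := G.X0; omega, ?_, ?_, ?_, G.mv, G.nv, ?_, ?_⟩
    · by_contra hneg
      push Not at hneg
      have : ((Y - (2*m+1) : ℤ):ℝ) < 0 := by exact_mod_cast hneg
      have h7 : lam * ((Y - (2*m+1) : ℤ):ℝ) < 0 := mul_neg_of_pos_of_neg hl this
      push_cast at h7; linarith
    · rw [Int.floor_eq_iff]; push_cast; constructor <;> linarith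
    · exact a
    · have := G.lo; push_cast; linarith
    · have := G.hi; push_cast; linarith
  · right
    push Not at hy
    have a := h6 hy
    have hk' : k = 2*n-1 ∨ k = 2*n := by omega
    refine ⟨hy, hk', fun hn1 => ?_⟩
    have hn1' : (1:ℝ) ≤ n := by exact_mod_cast hn1
    have lnn : lam ≤ lam * n := by nlinarith
    have hk1 : (1:ℤ) ≤ k := by omega
    have hkr : (2*n-1:ℝ) ≤ k ∧ (k:ℝ) ≤ 2*n := by
      rcases hk' with h | h <;> rw [h] <;> push_cast <;> constructor <;> linarith
    have lk1 : lam * (2*n-1) ≤ lam * k := mul_le_mul_of_nonneg_left hkr.1 hl.le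
    have lk2 : lam * k ≤ lam * (2*n) := mul_le_mul_of_nonneg_left hkr.2 hl.le
    refine ⟨by have := G.X0; omega, ?_, ?_, a, G.mv, by have := G.nv; omega, ?_, ?_⟩
    · have h0 : (0:ℤ) ≤ ⌊lam * ((Y - (2*m+1) : ℤ):ℝ)⌋ := by omega
      rw [Int.floor_nonneg] at h0
      by_contra hneg
      push Not at hneg
      have : ((Y - (2*m+1) : ℤ):ℝ) < 0 := by exact_mod_cast hneg
      have h7 : lam * ((Y - (2*m+1) : ℤ):ℝ) < 0 := mul_neg_of_pos_of_neg hl this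
      linarith
    · rw [Int.floor_eq_iff]; push_cast; constructor <;> linarith
    · have := G.lo
      push_cast
      have e1 : (2*m+1)*(lam*(2*n-1)) ≤ (2*m+1)*(lam*k) :=
        mul_le_mul_of_nonneg_left lk1 (by linarith)
      nlinarith
    · have := G.hi
      push_cast
      have e1 : (2*m+1)*(lam*k) ≤ (2*m+1)*(lam*(2*n)) :=
        mul_le_mul_of_nonneg_left lk2 (by linarith)
      nlinarith

theorem goodV {e f v K : ℤ} (S : Setup e f v K) {lam eps : ℝ} {X Y m n : ℤ}
    (s : SmallP K lam eps) (G : Good e f v K lam eps X Y m n) (hc : (m+1)^2+n^2 ≤ e) :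
    ∃ k : ℤ, k = -⌊lam * ((-n-1-X : ℤ):ℝ)⌋ + m ∧
      (Fe lam ^ 4) (X, Y) = (X + (2*n+1), Y - k) ∧
      ((lam * X + lam * (2*n+1) < m+1 ∧ k = 2*m+1 ∧
        Good e f v K lam eps (X+(2*n+1)) (Y-k) m n) ∨
       (m+1 ≤ lam * X + lam * (2*n+1) ∧ (k = 2*m+1 ∨ k = 2*m+2) ∧
        Good e f v K lam eps (X+(2*n+1)) (Y-k) (m+1) n)) := by
  have B := G.inBox S s
  have hl := s.hl
  obtain ⟨h1, h2, h3, h4⟩ := stepV S s.hl (half_pos s.he) (by linarith [s.he1, s.he])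
    (by linarith [s.hs]) B hc
  refine ⟨_, rfl, by rw [h1]; ext <;> simp; ring, ?_⟩
  set k := -⌊lam * ((-n-1-X : ℤ):ℝ)⌋ + m with hk
  have x1 := Int.floor_le (lam*X); rw [G.hm] at x1
  have x2 := Int.lt_floor_add_one (lam*X); rw [G.hm] at x2
  have y1 := Int.floor_le (lam*Y); rw [G.hn] at y1
  have y2 := Int.lt_floor_add_one (lam*Y); rw [G.hn] at y2
  have m0 : (0:ℝ) ≤ m := by exact_mod_cast B.m0
  have n0 : (0:ℝ) ≤ n := by exact_mod_cast B.n0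
  have hmv' : (m:ℝ) ≤ v := by exact_mod_cast G.mv
  have hnv' : (n:ℝ) ≤ v := by exact_mod_cast G.nv
  have hK : (K:ℝ) = 2*v+1 := by exact_mod_cast S.hK
  have hK1 : (1:ℝ) ≤ K := by rw [hK]; linarith
  have lm0 : 0 ≤ lam * m := by positivity
  have ln0 : 0 ≤ lam * n := by positivity
  have lnK : lam * (2*n+1) ≤ lam * K := mul_le_mul_of_nonneg_left (by rw [hK]; linarith) hl.le
  have hlK : lam * K ≤ lam * K^2 :=
    mul_le_mul_of_nonneg_left (by nlinarith) hl.le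
  have mz := B.m0
  have nz := B.n0
  have hk' : k = 2*m+1 ∨ k = 2*m+2 := by omega
  have hkr : (2*m+1:ℝ) ≤ k ∧ (k:ℝ) ≤ 2*m+2 := by
    rcases hk' with h | h <;> rw [h] <;> push_cast <;> constructor <;> linarith
  have lk1 : lam * (2*m+1) ≤ lam * k := mul_le_mul_of_nonneg_left hkr.1 hl.le
  have lk2 : lam * k ≤ lam * (2*m+2) := mul_le_mul_of_nonneg_left hkr.2 hl.le
  have hY : 0 ≤ Y - k := by
    by_contra hneg
    push Not at hneg
    have : ((Y - k : ℤ):ℝ) < 0 := by exact_mod_cast hneg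
    have h7 : lam * ((Y - k : ℤ):ℝ) < 0 := mul_neg_of_pos_of_neg hl this
    push_cast at h7; linarith
  have hfY : ⌊lam * ((Y - k : ℤ):ℝ)⌋ = n := by
    rw [Int.floor_eq_iff]; push_cast; constructor <;> linarith
  have s1 := s.hs
  have s2 := s.he1
  by_cases hx : lam * X + lam * (2*n+1) < m+1
  · left
    have a := h4 hx
    have hk'' : k = 2*m+1 := by omega
    refine ⟨hx, hk'', by have := G.X0; omega, hY, ?_, hfY, G.mv, G.nv, ?_, ?_⟩
    · rw [Int.floor_eq_iff]; push_cast; constructor <;> linarith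
    · have := G.lo; rw [hk'']; push_cast; linarith
    · have := G.hi; rw [hk'']; push_cast; linarith
  · right
    push Not at hx
    have hmv := (box_le S (by omega) B.n0 hc).1
    refine ⟨hx, hk', by have := G.X0; omega, hY, ?_, hfY, hmv, G.nv, ?_, ?_⟩
    · rw [Int.floor_eq_iff]; push_cast; constructor <;> linarith
    · have := G.lo
      push_cast
      have e1 : (2*n+1)*(lam*k) ≤ (2*n+1)*(lam*(2*m+2)) :=
        mul_le_mul_of_nonneg_left lk2 (by linarith)
      nlinarith
    · have := G.hi
      push_cast
      have e1 : (2*n+1)*(lam*(2*m+1)) ≤ (2*n+1)*(lam*k) :=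
        mul_le_mul_of_nonneg_left lk1 (by linarith)
      nlinarith

/-- `q` is the first point on the `F⁴`-orbit of `p` with second coordinate below `K`. -/
def EndAt (lam : ℝ) (K : ℤ) (p : ℤ × ℤ) (i : ℕ) (q : ℤ × ℤ) : Prop :=
  ((Fe lam ^ 4)^i) p = q ∧ q.2 < K ∧ ∀ j < i, K ≤ (((Fe lam ^ 4)^j) p).2

theorem endAt_step {lam : ℝ} {K : ℤ} {p q : ℤ × ℤ} {i : ℕ} (h : EndAt lam K p i q)
    (hp : K ≤ p.2) : ∃ i', i = i' + 1 ∧ EndAt lam K ((Fe lam ^ 4) p) i' q := by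
  obtain ⟨h1, h2, h3⟩ := h
  cases i with
  | zero => simp at h1; subst h1; omega
  | succ i =>
    refine ⟨i, rfl, ?_, h2, fun j hj => ?_⟩
    · rw [← h1, pow_succ]; rfl
    · have := h3 (j+1) (by omega)
      rw [pow_succ] at this; exact this

theorem endAt_step' {lam : ℝ} {K : ℤ} {p q : ℤ × ℤ} {i : ℕ} (hp : K ≤ p.2)
    (h : EndAt lam K ((Fe lam ^ 4) p) i q) : EndAt lam K p (i+1) q := by
  obtain ⟨h1, h2, h3⟩ := h
  refine ⟨by rw [pow_succ]; exact h1, h2, fun j hj => ?_⟩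
  cases j with
  | zero => simpa using hp
  | succ j => rw [pow_succ]; exact h3 j (by omega)

theorem endAt_zero {lam : ℝ} {K : ℤ} {p q : ℤ × ℤ} {i : ℕ} (h : EndAt lam K p i q)
    (hp : p.2 < K) : i = 0 ∧ q = p := by
  obtain ⟨h1, h2, h3⟩ := h
  cases i with
  | zero => simp at h1; exact ⟨rfl, h1.symm⟩
  | succ i => have := h3 0 (by omega); simp at this; omega

theorem endAt_unique {lam : ℝ} {K : ℤ} {p q q' : ℤ × ℤ} {i i' : ℕ} (h : EndAt lam K p i q)
    (h' : EndAt lam K p i' q') : i = i' ∧ q = q' := by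
  obtain ⟨h1, h2, h3⟩ := h
  obtain ⟨h1', h2', h3'⟩ := h'
  have : i = i' := by
    rcases lt_trichotomy i i' with hlt | heq | hgt
    · have := h3' i hlt; rw [h1] at this; omega
    · exact heq
    · have := h3 i' hgt; rw [h1'] at this; omega
  subst this
  exact ⟨rfl, by rw [← h1, ← h1']⟩

theorem final_box {e f v K : ℤ} (S : Setup e f v K) {lam eps : ℝ} {X Y m n : ℤ}
    (s : SmallP K lam eps) (G : Good e f v K lam eps X Y m n) (hY : Y < K) : m = v ∧ n = 0 := by
  have B := G.inBox S s
  have hl := s.hl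
  have x2 := Int.lt_floor_add_one (lam*X); rw [G.hm] at x2
  have m0 : (0:ℝ) ≤ m := by exact_mod_cast B.m0
  have hv0 : (0:ℝ) ≤ v := by exact_mod_cast S.v0
  have hK : (K:ℝ) = 2*v+1 := by exact_mod_cast S.hK
  have hK1 : (1:ℝ) ≤ K := by rw [hK]; linarith
  have hlK : lam * K ≤ lam * K^2 :=
    mul_le_mul_of_nonneg_left (by nlinarith) hl.le
  have hYK : lam * Y ≤ lam * K := mul_le_mul_of_nonneg_left (by exact_mod_cast hY.le) hl.le
  have s1 := s.hs
  have s2 := s.he1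
  have s3 := s.he
  have hY0 : (0:ℝ) ≤ Y := by exact_mod_cast G.Y0
  have n0 : n = 0 := by
    rw [← G.hn, Int.floor_eq_iff]; push_cast
    constructor
    · positivity
    · linarith
  refine ⟨?_, n0⟩
  by_contra hne
  have hlt : m + 1 ≤ v := by have := G.mv; omega
  have hlt' : (m:ℝ) + 1 ≤ v := by exact_mod_cast hlt
  have hv : (v:ℝ)^2 ≤ e := by exact_mod_cast S.hv
  have lo := B.lo
  rw [n0] at lo; push_cast at lo
  nlinarith

theorem boxcase {e f v K : ℤ} (S : Setup e f v K) (m n : ℤ) :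
    (f ≤ (m+1)^2+n^2) ∨ ((m+1)^2+n^2 ≤ e) := (S.gap (m+1) n).symm

theorem good_step {e f v K : ℤ} (S : Setup e f v K) {lam eps : ℝ} {X Y m n : ℤ}
    (s : SmallP K lam eps) (G : Good e f v K lam eps X Y m n)
    (hY : K ≤ Y ∨ 1 ≤ n) :
    ∃ X' Y' m' n' : ℤ, (Fe lam ^ 4) (X, Y) = (X', Y') ∧ Good e f v K lam eps X' Y' m' n' ∧
      X - Y + 2 ≤ X' - Y' ∧ Y' + 1 ≤ Y := by
  have m0 := G.m0 s.hl
  have n0 := G.n0 s.hl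
  have hK := S.hK
  have hmv := G.mv
  rcases boxcase S m n with hc | hc
  · obtain ⟨k, -, h2, h3⟩ := goodH S s G hc
    rcases h3 with ⟨a, b, c⟩ | ⟨a, b, c⟩
    · exact ⟨_, _, _, _, h2, c, by omega, by omega⟩
    · have hn1 : 1 ≤ n := by
        rcases hY with hY | hY
        · by_contra hn
          have hn' : n = 0 := by omega
          rw [hn'] at a; push_cast at a
          have h5 : (0:ℤ) ≤ Y - (2*m+1) := by omega
          have h6 : (0:ℝ) ≤ (Y:ℝ) - (2*m+1) := by exact_mod_cast h5
          have h7 := mul_nonneg s.hl.le h6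
          linarith
        · exact hY
      exact ⟨_, _, _, _, h2, c hn1, by omega, by omega⟩
  · obtain ⟨k, -, h2, h3⟩ := goodV S s G hc
    rcases h3 with ⟨a, b, c⟩ | ⟨a, b, c⟩
    · exact ⟨_, _, _, _, h2, c, by omega, by omega⟩
    · exact ⟨_, _, _, _, h2, c, by omega, by omega⟩

theorem end_exists {e f v K : ℤ} (S : Setup e f v K) {lam eps : ℝ} {X Y m n : ℤ}
    (s : SmallP K lam eps) (G : Good e f v K lam eps X Y m n) :
    ∃ i X' Y', EndAt lam K (X, Y) i (X', Y') ∧ Good e f v K lam eps X' Y' v 0 := by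
  obtain ⟨N, hN⟩ : ∃ N : ℕ, Y ≤ N := ⟨Y.toNat, by omega⟩
  induction N generalizing X Y m n with
  | zero =>
    have h1 : Y < K := by have := S.hK; have := S.v0; omega
    obtain ⟨rfl, rfl⟩ := final_box S s G h1
    exact ⟨0, X, Y, ⟨rfl, h1, by simp⟩, G⟩
  | succ N ih =>
    by_cases h1 : Y < K
    · obtain ⟨rfl, rfl⟩ := final_box S s G h1
      exact ⟨0, X, Y, ⟨rfl, h1, by simp⟩, G⟩
    · push Not at h1
      obtain ⟨X', Y', m', n', h2, h3, h4, h5⟩ := good_step S s G (Or.inl h1)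
      obtain ⟨i, X'', Y'', a, b⟩ := ih h3 (by push_cast at hN; omega)
      exact ⟨i+1, X'', Y'', endAt_step' (p := (X, Y)) h1 (by rw [h2]; exact a), b⟩

theorem good_along {e f v K : ℤ} (S : Setup e f v K) {lam eps : ℝ} {X Y m n : ℤ}
    (s : SmallP K lam eps) (G : Good e f v K lam eps X Y m n) {i : ℕ} {q : ℤ × ℤ}
    (h : EndAt lam K (X, Y) i q) : ∀ j ≤ i, ∃ X' Y' m' n',
      ((Fe lam ^ 4)^j) (X, Y) = (X', Y') ∧ Good e f v K lam eps X' Y' m' n' := by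
  intro j
  induction j with
  | zero => intro _; exact ⟨X, Y, m, n, rfl, G⟩
  | succ j ih =>
    intro hj
    obtain ⟨X', Y', m', n', h1, h2⟩ := ih (by omega)
    have h3 := h.2.2 j (by omega)
    rw [h1] at h3
    obtain ⟨X'', Y'', m'', n'', h4, h5, -⟩ := good_step S s h2 (Or.inl h3)
    refine ⟨X'', Y'', m'', n'', ?_, h5⟩
    rw [pow_succ']
    change (Fe lam ^ 4) (((Fe lam ^ 4)^j) (X, Y)) = _
    rw [h1, h4]

theorem u_along {e f v K : ℤ} (S : Setup e f v K) {lam eps : ℝ} {X Y m n : ℤ}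
    (s : SmallP K lam eps) (G : Good e f v K lam eps X Y m n) {i : ℕ} {q : ℤ × ℤ}
    (h : EndAt lam K (X, Y) i q) : ∀ j < i,
      (((Fe lam ^ 4)^j) (X, Y)).1 - (((Fe lam ^ 4)^j) (X, Y)).2 + 2 ≤
      (((Fe lam ^ 4)^(j+1)) (X, Y)).1 - (((Fe lam ^ 4)^(j+1)) (X, Y)).2 := by
  intro j hj
  obtain ⟨X', Y', m', n', h1, h2⟩ := good_along S s G h j hj.le
  have h3 := h.2.2 j hj
  rw [h1] at h3
  obtain ⟨X'', Y'', m'', n'', h4, h5, h6, -⟩ := good_step S s h2 (Or.inl h3)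
  have : ((Fe lam ^ 4)^(j+1)) (X, Y) = (X'', Y'') := by
    rw [pow_succ']
    change (Fe lam ^ 4) (((Fe lam ^ 4)^j) (X, Y)) = _
    rw [h1, h4]
  rw [this, h1]; exact h6

theorem col_end {e f v K : ℤ} (S : Setup e f v K) {lam eps : ℝ} (s : SmallP K lam eps) {i : ℕ} :
    ∀ {X Y n : ℤ} {q : ℤ × ℤ}, Good e f v K lam eps X Y v n →
    EndAt lam K (X, Y) i q → q.2 = Y % K := by
  have hK := S.hK
  have hv0 := S.v0
  induction i with
  | zero =>
    intro X Y n q G h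
    obtain ⟨h1, h2, h3⟩ := h
    simp at h1; subst h1
    exact (Int.emod_eq_of_lt G.Y0 h2).symm
  | succ i ih =>
    intro X Y n q G h
    have h1 : K ≤ Y := by simpa using h.2.2 0 (by omega)
    obtain ⟨i', hi', h2⟩ := endAt_step h h1
    have hi'' : i = i' := by omega
    subst hi''
    have hc : f ≤ (v+1)^2+n^2 := by have := S.hf; nlinarith
    obtain ⟨k, -, h3, h4⟩ := goodH S s G hc
    rw [h3] at h2
    have n0 := G.n0 s.hl
    have e1 : Y - (2*v+1) = Y - K := by rw [hK]
    have e2 : (Y - K) % K = Y % K := by simp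
    rcases h4 with ⟨a, b, c⟩ | ⟨a, b, c⟩
    · rw [ih c h2, e1, e2]
    · have hn1 : 1 ≤ n := by
        by_contra hn
        have hn' : n = 0 := by omega
        rw [hn'] at a; push_cast at a
        have h5 : (0:ℤ) ≤ Y - (2*v+1) := by omega
        have h6 : (0:ℝ) ≤ (Y:ℝ) - (2*v+1) := by exact_mod_cast h5
        have h7 := mul_nonneg s.hl.le h6
        linarith
      rw [ih (c hn1) h2, e1, e2]

/-- vertex types -/
def IsT (e f t : ℤ) : Prop := 0 ≤ t ∧ ∃ c : ℤ, 0 ≤ c ∧ t^2+c^2 ≤ e ∧ f ≤ (t+1)^2+c^2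

theorem pair_lemma {e f v K : ℤ} (S : Setup e f v K) {lam eps : ℝ} (s : SmallP K lam eps)
    (Q : ℤ) (hQ : ∀ t t', IsT e f t → IsT e f t' → t < t' → t' < v → (2*t+1)*(2*t'+1) ∣ Q)
    (N : ℕ) :
    ∀ {X Y X' Y' m n : ℤ} {i i' : ℕ} {q q' : ℤ × ℤ},
    Good e f v K lam eps X Y m n → Good e f v K lam eps X' Y' m n →
    n ≤ m → m < v → (2*m+1)*(X'-X) + (2*n+1)*(Y'-Y) = Q →
    (f ≤ (m+1)^2+n^2 → (2*m+1) ∣ Y'-Y) → ((m+1)^2+n^2 ≤ e → (2*n+1) ∣ X'-X) →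
    EndAt lam K (X, Y) i q → EndAt lam K (X', Y') i' q' → Y + Y' ≤ N →
    ∃ t s : ℤ, IsT e f t ∧ t < v ∧ (2*t+1)*s = Q ∧ q'.2 ≡ q.2 + s [ZMOD K] := by
  induction N with
  | zero =>
    intro X Y X' Y' m n i i' q q' G G' hnm hmv hQe hH hV hE hE' hN
    have := G.Y0; have := G'.Y0; have := S.hK; have := S.v0
    have := (final_box S s G (by push_cast at hN; omega)).1
    omega
  | succ N ih =>
    intro X Y X' Y' m n i i' q q' G G' hnm hmv hQe hH hV hE hE' hN
    push_cast at hN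
    have hKY : K ≤ Y := by
      by_contra h; push Not at h
      have := (final_box S s G h).1; omega
    have hKY' : K ≤ Y' := by
      by_contra h; push Not at h
      have := (final_box S s G' h).1; omega
    obtain ⟨j, -, hEs⟩ := endAt_step hE hKY
    obtain ⟨j', -, hEs'⟩ := endAt_step hE' hKY'
    have m0 := G.m0 s.hl
    have n0 := G.n0 s.hl
    have hl := s.hl
    have cor := (G.inBox S s).corner S (half_pos s.he)
    have cor2 := (G.inBox S s).corner2 S (half_pos s.he)
    have hK := S.hK
    have nok : ∀ Y : ℤ, K ≤ Y → lam * Y - lam * (2*m+1) < n → 1 ≤ n := by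
      intro Y hY a
      by_contra hn
      have hn' : n = 0 := by omega
      rw [hn'] at a; push_cast at a
      have h5 : (0:ℤ) ≤ Y - (2*m+1) := by omega
      have h6 : (0:ℝ) ≤ (Y:ℝ) - (2*m+1) := by exact_mod_cast h5
      have h7 := mul_nonneg s.hl.le h6
      linarith
    rcases boxcase S m n with hc | hc
    · obtain ⟨k, hk, h2, h3⟩ := goodH S s G hc
      obtain ⟨k', hk', h2', h3'⟩ := goodH S s G' hc
      obtain ⟨g, hg⟩ := hH hc
      have hVf : ¬ ((m+1)^2+n^2 ≤ e) := by have := S.hef; omega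
      have y1 := Int.floor_le (lam*Y); rw [G.hn] at y1
      have y1' := Int.floor_le (lam*Y'); rw [G'.hn] at y1'
      rcases lt_trichotomy g 0 with hg0 | hg0 | hg0
      · -- `Y' < Y` : move the first point
        have h5 : Y' ≤ Y - (2*m+1) := by nlinarith
        have h6 : lam * Y' ≤ lam * (Y - (2*m+1)) :=
          mul_le_mul_of_nonneg_left (by exact_mod_cast h5) hl.le
        rcases h3 with ⟨a, b, c⟩ | ⟨a, b, c⟩
        · rw [h2] at hEs
          exact ih c G' hnm hmv (by rw [b, ← hQe]; ring) (fun _ => ⟨g+1, by linarith⟩)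
            (fun h => absurd h hVf) hEs hE' (by omega)
        · exfalso; linarith
      · subst hg0
        have hYY : Y' = Y := by linarith
        subst hYY
        have hkk : k = k' := by rw [hk, hk']
        subst hkk
        rw [h2] at hEs
        rw [h2'] at hEs'
        rcases h3 with ⟨a, b, c⟩ | ⟨a, b, c⟩
        · rcases h3' with ⟨a', b', c'⟩ | ⟨a', b', c'⟩
          · exact ih c c' hnm hmv (by rw [← hQe]; ring) (fun _ => ⟨0, by ring⟩)
              (fun h => absurd h hVf) hEs hEs' (by omega)
          · exfalso; linarith
        · rcases h3' with ⟨a', b', c'⟩ | ⟨a', b', c'⟩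
          · exfalso; linarith
          · have hn1 := nok _ hKY a
            have hQ2 : (2*m+1)*(X'-X) = Q := by rw [← hQe]; ring
            refine ih (c hn1) (c' hn1) (by omega) hmv ?_ (fun _ => ⟨0, by ring⟩) ?_ hEs hEs'
              (by omega)
            · rw [← hQ2]; ring
            · intro hV'
              have cc2 := ((c hn1).inBox S s).corner2 S (half_pos s.he)
              have t1 : IsT e f (n-1) := ⟨by omega, m+1, by omega, by linarith, by
                have : n - 1 + 1 = n := by ring
                nlinarith⟩
              have t2 : IsT e f m := ⟨m0, n, n0, cor, hc⟩
              obtain ⟨w, hw⟩ := hQ _ _ t1 t2 (by omega) hmv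
              refine ⟨w, ?_⟩
              have : (2*m+1) * (X'-X) = (2*m+1) * ((2*(n-1)+1)*w) := by rw [hQ2, hw]; ring
              have := mul_left_cancel₀ (by omega) this
              linarith
      · have h5 : Y ≤ Y' - (2*m+1) := by nlinarith
        have h6 : lam * Y ≤ lam * (Y' - (2*m+1)) :=
          mul_le_mul_of_nonneg_left (by exact_mod_cast h5) hl.le
        rcases h3' with ⟨a, b, c⟩ | ⟨a, b, c⟩
        · rw [h2'] at hEs'
          exact ih G c hnm hmv (by rw [b, ← hQe]; ring) (fun _ => ⟨g-1, by linarith⟩)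
            (fun h => absurd h hVf) hE hEs' (by omega)
        · exfalso; linarith
    · obtain ⟨k, hk, h2, h3⟩ := goodV S s G hc
      obtain ⟨k', hk', h2', h3'⟩ := goodV S s G' hc
      obtain ⟨g, hg⟩ := hV hc
      have hHf : ¬ (f ≤ (m+1)^2+n^2) := by have := S.hef; omega
      have x1 := Int.lt_floor_add_one (lam*X); rw [G.hm] at x1
      have x1' := Int.lt_floor_add_one (lam*X'); rw [G'.hm] at x1'
      rcases lt_trichotomy g 0 with hg0 | hg0 | hg0
      · -- `X' < X` : move the second point
        have h5 : X' + (2*n+1) ≤ X := by nlinarith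
        have h6 : lam * (X' + (2*n+1)) ≤ lam * X :=
          mul_le_mul_of_nonneg_left (by exact_mod_cast h5) hl.le
        rcases h3' with ⟨a, b, c⟩ | ⟨a, b, c⟩
        · rw [h2'] at hEs'
          exact ih G c hnm hmv (by rw [b, ← hQe]; ring) (fun h => absurd h hHf)
            (fun _ => ⟨g+1, by linarith⟩) hE hEs' (by omega)
        · exfalso; linarith
      · subst hg0
        have hXX : X' = X := by linarith
        subst hXX
        have hkk : k = k' := by rw [hk, hk']
        subst hkk
        rw [h2] at hEs
        rw [h2'] at hEs'
        rcases h3 with ⟨a, b, c⟩ | ⟨a, b, c⟩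
        · rcases h3' with ⟨a', b', c'⟩ | ⟨a', b', c'⟩
          · exact ih c c' hnm hmv (by rw [← hQe]; ring) (fun h => absurd h hHf)
              (fun _ => ⟨0, by ring⟩) hEs hEs' (by omega)
          · exfalso; linarith
        · rcases h3' with ⟨a', b', c'⟩ | ⟨a', b', c'⟩
          · exfalso; linarith
          · have hQ2 : (2*n+1)*(Y'-Y) = Q := by rw [← hQe]; ring
            have t1 : IsT e f n := ⟨n0, m+1, by omega, by linarith, by linarith⟩
            by_cases hmv1 : m + 1 = v
            · rw [hmv1] at c c'
              refine ⟨n, Y'-Y, t1, by omega, hQ2, ?_⟩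
              rw [col_end S s c hEs, col_end S s c' hEs']
              have e1 : (Y - k) % K ≡ Y - k [ZMOD K] := Int.mod_modEq _ _
              have e2 : (Y' - k) % K ≡ Y' - k [ZMOD K] := Int.mod_modEq _ _
              calc (Y' - k) % K ≡ Y' - k [ZMOD K] := e2
                _ = (Y - k) + (Y' - Y) := by ring
                _ ≡ (Y-k) % K + (Y'-Y) [ZMOD K] := e1.symm.add_right _
            · refine ih c c' (by omega) (by omega) ?_ ?_ (fun _ => ⟨0, by ring⟩) hEs hEs'
                (by omega)
              · rw [← hQ2]; ring
              · intro hH'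
                have cc := (c.inBox S s).corner S (half_pos s.he)
                have t2 : IsT e f (m+1) := ⟨by omega, n, n0, cc, hH'⟩
                obtain ⟨w, hw⟩ := hQ _ _ t1 t2 (by omega) (by omega)
                refine ⟨w, ?_⟩
                have : (2*n+1) * (Y'-Y) = (2*n+1) * ((2*(m+1)+1)*w) := by rw [hQ2, hw]; ring
                have := mul_left_cancel₀ (by omega) this
                linarith
      · have h5 : X + (2*n+1) ≤ X' := by nlinarith
        have h6 : lam * (X + (2*n+1)) ≤ lam * X' :=
          mul_le_mul_of_nonneg_left (by exact_mod_cast h5) hl.le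
        rcases h3 with ⟨a, b, c⟩ | ⟨a, b, c⟩
        · rw [h2] at hEs
          exact ih c G' hnm hmv (by rw [b, ← hQe]; ring) (fun h => absurd h hHf)
            (fun _ => ⟨g-1, by linarith⟩) hEs hE' (by omega)
        · exfalso; linarith

/-! ### The symmetry and the return domain -/

theorem Fe_inv_apply (lam : ℝ) (p : ℤ × ℤ) : (Fe lam)⁻¹ p = Gmap (Fe lam (Gmap p)) := by
  rfl

theorem Gmap_Gmap (p : ℤ × ℤ) : Gmap (Gmap p) = p := rfl

theorem Gmap_pow (lam : ℝ) (k : ℕ) (p : ℤ × ℤ) :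
    Gmap ((Fe lam ^ k) (Gmap p)) = ((Fe lam)⁻¹ ^ k) p := by
  induction k with
  | zero => rfl
  | succ k ih =>
    rw [pow_succ', pow_succ']
    change Gmap (Fe lam ((Fe lam ^ k) (Gmap p))) = (Fe lam)⁻¹ (((Fe lam)⁻¹ ^ k) p)
    rw [← ih, Fe_inv_apply]
    rfl

theorem Gmap_zpow (lam : ℝ) (k : ℤ) (p : ℤ × ℤ) :
    Gmap ((Fe lam ^ k) (Gmap p)) = (Fe lam ^ (-k)) p := by
  rcases Int.eq_nat_or_neg k with ⟨n, rfl | rfl⟩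
  · rw [zpow_natCast, Gmap_pow, zpow_neg, zpow_natCast, inv_pow]
  · rw [neg_neg, zpow_natCast, zpow_neg, zpow_natCast]
    have := Gmap_pow lam n (Gmap p)
    rw [Gmap_Gmap] at this
    rw [← inv_pow, ← this, Gmap_Gmap]

theorem dline_pt_le {lam : ℝ} (hl : 0 < lam) (p q : ℤ × ℤ) :
    dline (pt lam p) ≤ dline (pt lam q) ↔ |p.1 - p.2| ≤ |q.1 - q.2| := by
  have h2 : (0:ℝ) < Real.sqrt 2 := by positivity
  unfold dline pt
  rw [div_le_div_iff_of_pos_right h2]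
  simp only
  rw [← mul_sub, ← mul_sub, abs_mul, abs_mul, mul_le_mul_iff_right₀ (abs_pos.2 hl.ne')]
  norm_cast

theorem dline_pt_lt {lam : ℝ} (hl : 0 < lam) (p q : ℤ × ℤ) :
    dline (pt lam p) < dline (pt lam q) ↔ |p.1 - p.2| < |q.1 - q.2| := by
  rw [← not_le, dline_pt_le hl, not_le]

theorem mem_Xset {lam : ℝ} (hl : 0 < lam) (p : ℤ × ℤ) :
    p ∈ Xset lam ↔ 0 ≤ p.1 ∧ 0 ≤ p.2 ∧
      |p.1 - p.2| ≤ |((Fe lam ^ 4) p).1 - ((Fe lam ^ 4) p).2| ∧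
      |p.1 - p.2| < |((Fe lam ^ 4) (Gmap p)).1 - ((Fe lam ^ 4) (Gmap p)).2| := by
  unfold Xset
  rw [Set.mem_ofPred_eq, dline_pt_le hl, dline_pt_lt hl, ← Gmap_zpow, abs_sub_comm (Gmap _).1]
  rfl

theorem Pfun_tangent (x : ℝ) (m : ℤ) : (2*m+1)*x - m*(m+1) ≤ Pfun x := by
  unfold Pfun
  have h1 := Int.floor_le x
  have h2 := Int.lt_floor_add_one x
  rcases lt_trichotomy ⌊x⌋ m with h | h | h
  · have h' : ((⌊x⌋:ℤ):ℝ) + 1 ≤ m := by exact_mod_cast h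
    nlinarith [mul_nonneg (sub_nonneg.2 h2.le) (sub_nonneg.2 h'),
      mul_nonneg (sub_nonneg.2 h') (by linarith : (0:ℝ) ≤ m - ⌊x⌋)]
  · rw [h]; nlinarith
  · have h' : (m:ℝ) + 1 ≤ ((⌊x⌋:ℤ):ℝ) := by exact_mod_cast h
    nlinarith [mul_nonneg (sub_nonneg.2 h1) (by linarith : (0:ℝ) ≤ ⌊x⌋ - m),
      mul_nonneg (sub_nonneg.2 h') (by linarith : (0:ℝ) ≤ ⌊x⌋ - m)]

theorem Pfun_eq (x : ℝ) : Pfun x = (2*⌊x⌋+1)*x - ⌊x⌋*(⌊x⌋+1) := by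
  unfold Pfun; ring

theorem Pfun_diff (x y : ℝ) : Pfun x - Pfun y ≤ (2*⌊x⌋+1)*(x-y) := by
  have := Pfun_tangent y ⌊x⌋
  rw [Pfun_eq x]; linarith

theorem Pfun_int (m : ℤ) : Pfun (m:ℝ) = (m:ℝ)^2 := by
  unfold Pfun; simp

theorem Pfun_ge (x : ℝ) : x ≤ Pfun x := by
  have := Pfun_tangent x 0
  push_cast at this; linarith

/-- `T` moves points above the diagonal strictly closer to it. -/
theorem far_step {lam : ℝ} {f X Y : ℤ} (hl : 0 < lam) (hf : 1 ≤ f) (hs : lam * (f+1) ≤ 1)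
    (hX : 0 ≤ X) (h : ham (pt lam (X,Y)) ≤ f) (hu : X - Y < -(4*f+10)) :
    |((Fe lam ^ 4) (X,Y)).1 - ((Fe lam ^ 4) (X,Y)).2| < |X-Y| := by
  have hfr : (1:ℝ) ≤ f := by exact_mod_cast hf
  have hXr : (0:ℝ) ≤ X := by exact_mod_cast hX
  have hY0 : 0 ≤ Y := by omega
  have hYr : (0:ℝ) ≤ Y := by exact_mod_cast hY0
  have hx0 := mul_nonneg hl.le hXr
  have hy0 := mul_nonneg hl.le hYr
  have hl1 : lam ≤ 1 := by nlinarith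
  unfold ham pt at h
  simp only at h
  have hx : lam * X ≤ f := by
    linarith [Pfun_ge (lam*X), Pfun_ge (lam*Y)]
  have hy : lam * Y ≤ f := by
    linarith [Pfun_ge (lam*X), Pfun_ge (lam*Y)]
  obtain ⟨m, hm⟩ : ∃ m, ⌊lam*X⌋ = m := ⟨_, rfl⟩
  obtain ⟨a1, h1⟩ : ∃ a1, ⌊lam*((m-Y:ℤ):ℝ)⌋ = a1 := ⟨_, rfl⟩
  obtain ⟨a2, h2⟩ : ∃ a2, ⌊lam*((a1-X:ℤ):ℝ)⌋ = a2 := ⟨_, rfl⟩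
  obtain ⟨a3, h3⟩ : ∃ a3, ⌊lam*((Y+a2-m:ℤ):ℝ)⌋ = a3 := ⟨_, rfl⟩
  rw [Fe4_apply lam X Y m a1 a2 a3 hm h1 h2 h3]
  have m0 : 0 ≤ m := by rw [← hm]; exact Int.floor_nonneg.2 hx0
  have mf : m ≤ f := by
    have := Int.floor_le (lam*X); rw [hm] at this
    have : (m:ℝ) ≤ f := by linarith
    exact_mod_cast this
  have m0r : (0:ℝ) ≤ m := by exact_mod_cast m0
  have b1 : a1 ≤ -1 := by
    have h4 : m - Y ≤ -1 := by omega
    have h4r : ((m-Y:ℤ):ℝ) ≤ -1 := by exact_mod_cast h4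
    have : a1 < 0 := by rw [← h1]; apply Int.floor_lt.2; push_cast at h4r ⊢; nlinarith
    omega
  have c1 : -(f+1) ≤ a1 := by
    rw [← h1]; apply Int.le_floor.2; push_cast; nlinarith
  have c1r : -((f:ℝ)+1) ≤ a1 := by exact_mod_cast c1
  have b2 : a2 ≤ -1 := by
    have h4 : a1 - X ≤ -1 := by omega
    have h4r : ((a1-X:ℤ):ℝ) ≤ -1 := by exact_mod_cast h4
    have : a2 < 0 := by rw [← h2]; apply Int.floor_lt.2; push_cast at h4r ⊢; nlinarith
    omega
  have c2 : -(f+1) ≤ a2 := by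
    rw [← h2]; apply Int.le_floor.2; push_cast
    have : lam * -((f:ℝ)+1) ≤ lam * a1 := mul_le_mul_of_nonneg_left c1r hl.le
    nlinarith
  have b3 : 0 ≤ a3 := by
    rw [← h3]; apply Int.floor_nonneg.2
    have h4 : 0 ≤ Y + a2 - m := by omega
    have h4r : (0:ℝ) ≤ ((Y+a2-m:ℤ):ℝ) := by exact_mod_cast h4
    exact mul_nonneg hl.le h4r
  have c3 : a3 ≤ f := by
    have h4 : Y + a2 - m ≤ Y := by omega
    have h4r : ((Y+a2-m:ℤ):ℝ) ≤ Y := by exact_mod_cast h4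
    have h5 := mul_le_mul_of_nonneg_left h4r hl.le
    have h6 := Int.floor_le (lam*((Y+a2-m:ℤ):ℝ)); rw [h3] at h6
    have : (a3:ℝ) ≤ f := by linarith
    exact_mod_cast this
  simp only
  rw [abs_lt, abs_of_neg (by omega : X - Y < 0)]
  constructor <;> omega

theorem ham_swap (lam : ℝ) (p : ℤ × ℤ) : ham (pt lam (Gmap p)) = ham (pt lam p) := by
  unfold ham pt Gmap; simp only; ring

theorem Xset_near {lam : ℝ} {f : ℤ} {p : ℤ × ℤ} (hl : 0 < lam) (hf : 1 ≤ f)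
    (hs : lam * (f+1) ≤ 1) (hp : p ∈ Xset lam) (h : ham (pt lam p) ≤ f) :
    |p.1 - p.2| ≤ 4*f+10 := by
  obtain ⟨h1, h2, h3, h4⟩ := (mem_Xset hl p).1 hp
  rw [abs_le]
  constructor
  · by_contra hc; push Not at hc
    have := far_step (X := p.1) (Y := p.2) hl hf hs h1 h hc
    exact absurd h3 (not_le.2 this)
  · by_contra hc; push Not at hc
    have := far_step (X := p.2) (Y := p.1) hl hf hs h2 (by rw [← ham_swap] at h; exact h)
      (by omega)
    rw [abs_sub_comm p.2 p.1] at this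
    exact absurd h4 (not_lt.2 this.le)

/-- numerical data at the diagonal -/
structure Setup1 (e f w W : ℤ) : Prop where
  w0 : 0 ≤ w
  hW : W = 2*w+1
  h1 : 2*w^2 ≤ e
  h2 : f ≤ 2*(w+1)^2
  hef : e < f

structure SmallZ (f : ℤ) (lam eps : ℝ) : Prop where
  hl : 0 < lam
  he : 0 < eps
  he1 : eps ≤ 1
  hs : 400*((f:ℝ)+5)^2*lam ≤ eps

theorem Setup1.facts {e f w W : ℤ} (S : Setup1 e f w W) : 1 ≤ f ∧ w ≤ f ∧ 1 ≤ W ∧ W ≤ 2*f+1 := by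
  have := S.w0; have := S.hW; have := S.h1; have := S.hef
  have h3 : w ≤ f := by nlinarith
  have h4 : 1 ≤ f := by nlinarith
  refine ⟨h4, h3, by omega, by omega⟩

/-- The zone near the diagonal. -/
structure Zn (e f w W : ℤ) (lam eps : ℝ) (X Y : ℤ) : Prop where
  u1 : -W ≤ X - Y
  u2 : X - Y < W
  lo : e + eps ≤ W*(lam*(X+Y)) - 2*w*(w+1)
  hi : W*(lam*(X+Y)) - 2*w*(w+1) ≤ f - eps

theorem margins {e f w W : ℤ} (S : Setup1 e f w W) {lam eps : ℝ} (s : SmallZ f lam eps) {X Y : ℤ}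
    (hu : |X-Y| ≤ 4*f+10) (lo : e + eps ≤ W*(lam*(X+Y)) - 2*w*(w+1))
    (hi : W*(lam*(X+Y)) - 2*w*(w+1) ≤ f - eps) :
    w + 3*(lam*W) ≤ lam*X ∧ lam*X + 3*(lam*W) < w+1 := by
  obtain ⟨f1, wf, W1, Wf⟩ := S.facts
  have f1r : (1:ℝ) ≤ f := by exact_mod_cast f1
  have W1r : (1:ℝ) ≤ W := by exact_mod_cast W1
  have Wfr : (W:ℝ) ≤ 2*f+1 := by exact_mod_cast Wf
  have hW : (W:ℝ) = 2*w+1 := by exact_mod_cast S.hW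
  have h1 : 2*(w:ℝ)^2 ≤ e := by exact_mod_cast S.h1
  have h2 : (f:ℝ) ≤ 2*((w:ℝ)+1)^2 := by exact_mod_cast S.h2
  have hl := s.hl
  have hu' := abs_le.1 hu
  have u1 : -(4*(f:ℝ)+10) ≤ X - Y := by exact_mod_cast hu'.1
  have u2 : (X:ℝ) - Y ≤ 4*f+10 := by exact_mod_cast hu'.2
  have k1 : (W:ℝ)*(4*f+10) ≤ (2*f+1)*(4*f+10) := by gcongr
  have k2 : (W:ℝ)*W ≤ (2*f+1)*(2*f+1) := by gcongr
  have k3 : (W:ℝ)*(4*f+10) + 6*(W*W) < 400*((f:ℝ)+5)^2 := by nlinarith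
  have k4 := mul_lt_mul_of_pos_right k3 hl
  have k5 := s.hs
  have W0 : (0:ℝ) < W := by linarith
  have p1 : W*(lam*(X-Y)) ≤ W*(lam*(4*f+10)) := by gcongr
  have p2 : W*(lam*(-(4*f+10))) ≤ W*(lam*(X-Y)) := by gcongr
  constructor
  · have : (W:ℝ)*(w + 3*(lam*W)) ≤ W*(lam*X) := by
      have e1 : (W:ℝ)*w = 2*w^2+w := by rw [hW]; ring
      nlinarith
    exact le_of_mul_le_mul_left this W0
  · have : W*(lam*X + 3*(lam*W)) < (W:ℝ)*(w+1) := by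
      have e1 : (W:ℝ)*(w+1) = 2*w^2+3*w+1 := by rw [hW]; ring
      nlinarith
    exact lt_of_mul_lt_mul_left this W0.le

structure ZB (w W : ℤ) (lam : ℝ) (X : ℤ) : Prop where
  lo : w + 3*(lam*W) ≤ lam*X
  hi : lam*X + 3*(lam*W) < w+1

theorem Zn.zb {e f w W : ℤ} (S : Setup1 e f w W) {lam eps : ℝ} (s : SmallZ f lam eps) {X Y : ℤ}
    (Z : Zn e f w W lam eps X Y) : ZB w W lam X ∧ ZB w W lam Y := by
  obtain ⟨f1, wf, W1, Wf⟩ := S.facts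
  have hu : |X - Y| ≤ 4*f+10 := by
    have := Z.u1; have := Z.u2
    rw [abs_le]; constructor <;> omega
  obtain ⟨a, b⟩ := margins S s hu Z.lo Z.hi
  obtain ⟨c, d⟩ := margins S s (X := Y) (Y := X) (by rwa [abs_sub_comm]) (by rw [add_comm (Y:ℝ)]; exact Z.lo)
    (by rw [add_comm (Y:ℝ)]; exact Z.hi)
  exact ⟨⟨a, b⟩, ⟨c, d⟩⟩

theorem ZB.floor {w W : ℤ} {lam : ℝ} (hl : 0 < lam) (hW : 1 ≤ W) {X : ℤ} (h : ZB w W lam X) (k : ℤ)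
    (h1 : -3*W ≤ k) (h2 : k ≤ 3*W) : ⌊lam*((X+k:ℤ):ℝ)⌋ = w := by
  have h1' : -3*(W:ℝ) ≤ k := by exact_mod_cast h1
  have h2' : (k:ℝ) ≤ 3*W := by exact_mod_cast h2
  have a1 := mul_le_mul_of_nonneg_left h1' hl.le
  have a2 := mul_le_mul_of_nonneg_left h2' hl.le
  rw [Int.floor_eq_iff]; push_cast
  have := h.lo; have := h.hi
  constructor <;> linarith

theorem ZB.floor_neg {w W : ℤ} {lam : ℝ} (hl : 0 < lam) (hW : 1 ≤ W) {X : ℤ} (h : ZB w W lam X) (k : ℤ)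
    (h1 : -3*W < k) (h2 : k < 3*W) : ⌊lam*((k-X:ℤ):ℝ)⌋ = -w-1 := by
  have h1' : -3*(W:ℝ) < k := by exact_mod_cast h1
  have h2' : (k:ℝ) < 3*W := by exact_mod_cast h2
  have a1 := mul_lt_mul_of_pos_left h1' hl
  have a2 := mul_lt_mul_of_pos_left h2' hl
  rw [Int.floor_eq_iff]; push_cast
  have := h.lo; have := h.hi
  constructor <;> linarith

theorem ZB.step {w W : ℤ} {lam : ℝ} (hl : 0 < lam) (hw : 0 ≤ w) (hW : W = 2*w+1) {X Y : ℤ}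
    (hX : ZB w W lam X) (hY : ZB w W lam Y) : (Fe lam ^ 4) (X,Y) = (X+W, Y-W) := by
  have hW1 : 1 ≤ W := by omega
  rw [Fe4_apply lam X Y w (-w-1) (-w-1) w]
  · rw [hW]; ext <;> simp <;> ring
  · simpa using hX.floor hl hW1 0 (by omega) (by omega)
  · exact hY.floor_neg hl hW1 w (by omega) (by omega)
  · exact hX.floor_neg hl hW1 (-w-1) (by omega) (by omega)
  · have := hY.floor hl hW1 (-2*w-1) (by omega) (by omega)
    rw [show Y + (-w-1) - w = Y + (-2*w-1) by ring]; exact this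

theorem ZB.ham {w W : ℤ} {lam : ℝ} (hl : 0 < lam) (hw : 0 ≤ w) (hW : W = 2*w+1) {X Y : ℤ}
    (hX : ZB w W lam X) (hY : ZB w W lam Y) :
    ham (pt lam (X,Y)) = W*(lam*(X+Y)) - 2*w*(w+1) := by
  have hW1 : 1 ≤ W := by omega
  rw [ham_box lam X Y w w (by simpa using hX.floor hl hW1 0 (by omega) (by omega))
    (by simpa using hY.floor hl hW1 0 (by omega) (by omega)), hW]
  push_cast; ring

theorem ZB.nonneg {w W : ℤ} {lam : ℝ} (hl : 0 < lam) (hw : 0 ≤ w) (hW : W = 2*w+1) {X : ℤ}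
    (hX : ZB w W lam X) : 0 ≤ X := by
  have W0 : 0 < W := by omega
  have W0r : (0:ℝ) < W := by exact_mod_cast W0
  have w0r : (0:ℝ) ≤ w := by exact_mod_cast hw
  have h := hX.lo
  have := mul_pos hl W0r
  have : 0 < lam * X := by linarith
  have := pos_of_mul_pos_right this hl.le
  have : 0 < X := by exact_mod_cast this
  exact this.le

theorem Zn.mem {e f w W : ℤ} (S : Setup1 e f w W) {lam eps : ℝ} (s : SmallZ f lam eps) {X Y : ℤ}
    (Z : Zn e f w W lam eps X Y) : (X,Y) ∈ Xset lam := by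
  obtain ⟨f1, wf, W1, Wf⟩ := S.facts
  obtain ⟨a, b⟩ := Z.zb S s
  have u1 := Z.u1; have u2 := Z.u2
  rw [mem_Xset s.hl]
  have h1 := ZB.step s.hl S.w0 S.hW a b
  have h2 := ZB.step s.hl S.w0 S.hW b a
  refine ⟨a.nonneg s.hl S.w0 S.hW, b.nonneg s.hl S.w0 S.hW, ?_, ?_⟩
  · rw [h1]; simp only
    rw [abs_of_nonneg (by omega : 0 ≤ X + W - (Y - W)), abs_le]; constructor <;> omega
  · rw [Gmap, h2]; simp only
    rw [abs_of_pos (by omega : 0 < Y + W - (X - W)), abs_lt]; constructor <;> omega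

theorem zone_floor {e f w W : ℤ} (S : Setup1 e f w W) {lam eps : ℝ} (s : SmallZ f lam eps) {X Y : ℤ}
    (hX : 0 ≤ X) (hY : 0 ≤ Y) (hu : |X-Y| ≤ 4*f+10) (lo : e + eps ≤ ham (pt lam (X,Y)))
    (hi : ham (pt lam (X,Y)) ≤ f - eps) : ⌊lam*X⌋ = w := by
  obtain ⟨f1, wf, W1, Wf⟩ := S.facts
  have f1r : (1:ℝ) ≤ f := by exact_mod_cast f1
  have W1r : (1:ℝ) ≤ W := by exact_mod_cast W1
  have Wfr : (W:ℝ) ≤ 2*f+1 := by exact_mod_cast Wf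
  have hW : (W:ℝ) = 2*w+1 := by exact_mod_cast S.hW
  have h1 : 2*(w:ℝ)^2 ≤ e := by exact_mod_cast S.h1
  have h2 : (f:ℝ) ≤ 2*((w:ℝ)+1)^2 := by exact_mod_cast S.h2
  have hl := s.hl
  have hu' := abs_le.1 hu
  have u1 : -(4*(f:ℝ)+10) ≤ X - Y := by exact_mod_cast hu'.1
  have u2 : (X:ℝ) - Y ≤ 4*f+10 := by exact_mod_cast hu'.2
  have k1 : (W:ℝ)*(4*f+10) ≤ (2*f+1)*(4*f+10) := by gcongr
  have k3 : (2*(f:ℝ)+1)*(4*f+10) < 400*((f:ℝ)+5)^2 := by nlinarith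
  have k4 := mul_lt_mul_of_pos_right k3 hl
  have k6 := mul_le_mul_of_nonneg_right k1 hl.le
  have k5 := s.hs
  have ul := mul_le_mul_of_nonneg_left u1 hl.le
  have uh := mul_le_mul_of_nonneg_left u2 hl.le
  have w0r : (0:ℝ) ≤ w := by exact_mod_cast S.w0
  unfold ham pt at lo hi
  simp only at lo hi
  have X0 : (0:ℝ) ≤ X := by exact_mod_cast hX
  have Y0 : (0:ℝ) ≤ Y := by exact_mod_cast hY
  have x0 := mul_nonneg hl.le X0
  have y0 := mul_nonneg hl.le Y0
  have xm : (0:ℝ) ≤ ⌊lam*X⌋ := by exact_mod_cast Int.floor_nonneg.2 x0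
  have ym : (0:ℝ) ≤ ⌊lam*Y⌋ := by exact_mod_cast Int.floor_nonneg.2 y0
  rw [Int.floor_eq_iff]
  constructor
  · by_contra hc
    push Not at hc
    have t1 := Pfun_diff (lam*X) w
    have t2 := Pfun_diff (lam*Y) w
    rw [Pfun_int] at t1 t2
    have t3 : (2*(⌊lam*X⌋:ℝ)+1)*(lam*X-w) ≤ 0 :=
      mul_nonpos_of_nonneg_of_nonpos (by linarith) (by linarith)
    have yf : (⌊lam*Y⌋:ℝ) ≤ f := by
      have := Int.floor_le (lam*Y)
      linarith [Pfun_ge (lam*X), Pfun_ge (lam*Y), s.he]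
    have t4 : (2*(⌊lam*Y⌋:ℝ)+1)*(lam*Y-w) ≤ (2*(⌊lam*Y⌋:ℝ)+1)*(lam*(4*f+10)) :=
      mul_le_mul_of_nonneg_left (by linarith) (by linarith)
    have t5 : (2*(⌊lam*Y⌋:ℝ)+1)*(lam*(4*f+10)) ≤ (2*f+1)*(lam*(4*f+10)) :=
      mul_le_mul_of_nonneg_right (by linarith) (by positivity)
    linarith
  · by_contra hc
    push Not at hc
    have t1 := Pfun_tangent (lam*X) w
    have t2 := Pfun_tangent (lam*Y) w
    rw [← hW] at t1 t2
    have t3 : (W:ℝ)*(2*(w+1) - lam*(4*f+10)) ≤ W*(lam*X+lam*Y) :=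
      mul_le_mul_of_nonneg_left (by linarith) (by linarith)
    have t4 : (W:ℝ)*(2*(w+1)) = 2*((w:ℝ)+1)^2 + 2*w*(w+1) := by rw [hW]; ring
    linarith

theorem Zn.of_mem {e f w W : ℤ} (S : Setup1 e f w W) {lam eps : ℝ} (s : SmallZ f lam eps) {X Y : ℤ}
    (hX : (X,Y) ∈ Xset lam) (lo : e + eps ≤ ham (pt lam (X,Y)))
    (hi : ham (pt lam (X,Y)) ≤ f - eps) : Zn e f w W lam eps X Y := by
  obtain ⟨f1, wf, W1, Wf⟩ := S.facts
  have hl := s.hl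
  have f1r : (1:ℝ) ≤ f := by exact_mod_cast f1
  have hs1 : lam*(f+1) ≤ 1 := by
    have := s.hs; have := s.he1
    have k : (f:ℝ)+1 ≤ 400*((f:ℝ)+5)^2 := by nlinarith
    have := mul_le_mul_of_nonneg_right k hl.le
    linarith
  have hu : |X-Y| ≤ 4*f+10 := Xset_near (p := (X,Y)) hl f1 hs1 hX (by linarith [s.he])
  obtain ⟨h1, h2, h3, h4⟩ := (mem_Xset hl _).1 hX
  simp only at h1 h2 h3
  have fx := zone_floor S s h1 h2 hu lo hi
  have fy := zone_floor S s (X := Y) (Y := X) h2 h1 (by rwa [abs_sub_comm])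
    (by rw [← ham_swap] at lo; exact lo) (by rw [← ham_swap] at hi; exact hi)
  have hh := ham_box lam X Y w w fx fy
  have hW : (W:ℝ) = 2*w+1 := by exact_mod_cast S.hW
  have hh' : ham (pt lam (X,Y)) = W*(lam*(X+Y)) - 2*w*(w+1) := by rw [hh, hW]; ring
  rw [hh'] at lo hi
  obtain ⟨a, b⟩ := margins S s hu lo hi
  obtain ⟨c, d⟩ := margins S s (X := Y) (Y := X) (by rwa [abs_sub_comm]) (by rw [add_comm (Y:ℝ)]; exact lo)
    (by rw [add_comm (Y:ℝ)]; exact hi)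
  rw [ZB.step hl S.w0 S.hW ⟨a,b⟩ ⟨c,d⟩] at h3
  rw [Gmap, ZB.step hl S.w0 S.hW ⟨c,d⟩ ⟨a,b⟩] at h4
  simp only at h3 h4
  refine ⟨?_, ?_, lo, hi⟩
  · by_contra hc; push Not at hc
    rw [abs_of_neg (by omega : X - Y < 0)] at h3
    have : |X + W - (Y - W)| < -(X-Y) := by rw [abs_lt]; constructor <;> omega
    omega
  · by_contra hc; push Not at hc
    rw [abs_of_pos (by omega : 0 < X - Y)] at h4
    have : |Y + W - (X - W)| ≤ (X-Y) := by rw [abs_le]; constructor <;> omega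
    omega

theorem Zn.ham {e f w W : ℤ} (S : Setup1 e f w W) {lam eps : ℝ} (s : SmallZ f lam eps) {X Y : ℤ}
    (Z : Zn e f w W lam eps X Y) : ham (pt lam (X,Y)) = W*(lam*(X+Y)) - 2*w*(w+1) :=
  ZB.ham s.hl S.w0 S.hW (Z.zb S s).1 (Z.zb S s).2

theorem zone_iff {e f w W : ℤ} (S : Setup1 e f w W) {lam eps : ℝ} (s : SmallZ f lam eps) {X Y : ℤ} :
    ((X,Y) ∈ Xset lam ∧ e + eps ≤ _root_.ham (pt lam (X,Y)) ∧ _root_.ham (pt lam (X,Y)) ≤ f - eps) ↔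
      Zn e f w W lam eps X Y := by
  constructor
  · rintro ⟨a, b, c⟩; exact Zn.of_mem S s a b c
  · intro Z; refine ⟨Z.mem S s, ?_, ?_⟩
    · rw [Z.ham S s]; exact Z.lo
    · rw [Z.ham S s]; exact Z.hi

theorem Zn.step {e f w W : ℤ} (S : Setup1 e f w W) {lam eps : ℝ} (s : SmallZ f lam eps) {X Y : ℤ}
    (Z : Zn e f w W lam eps X Y) : (Fe lam ^ 4) (X,Y) = (X+W,Y-W) :=
  ZB.step s.hl S.w0 S.hW (Z.zb S s).1 (Z.zb S s).2

/-! ### Symmetric fixed points -/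

theorem SmallZ.toP {e f v K : ℤ} (S : Setup e f v K) {lam eps : ℝ} (s : SmallZ f lam eps) (e0 : 0 ≤ e) :
    SmallP K lam (eps/4) ∧ SmallP K lam eps := by
  have h1 := S.hv; have h2 := S.hef; have h3 := S.v0; have hK := S.hK
  have hvf : v ≤ f := by nlinarith
  have hKf : K ≤ 2*f+1 := by omega
  have hK0 : 0 ≤ K := by omega
  have a : (K:ℝ) ≤ 2*f+1 := by exact_mod_cast hKf
  have b : (0:ℝ) ≤ K := by exact_mod_cast hK0
  have hf0 : 0 ≤ f := by omega
  have f0 : (0:ℝ) ≤ f := by exact_mod_cast hf0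
  have c : (K:ℝ)^2 ≤ (2*f+1)^2 := by gcongr
  have d : 64*(K:ℝ)^2 ≤ 400*((f:ℝ)+5)^2 := by nlinarith
  have := mul_le_mul_of_nonneg_right d s.hl.le
  have := s.hs
  have := s.he
  have := s.he1
  refine ⟨⟨s.hl, by linarith, by linarith, by nlinarith⟩, ⟨s.hl, s.he, s.he1, by nlinarith⟩⟩

theorem Zn.good {e f v K w W : ℤ} (S : Setup e f v K) (S1 : Setup1 e f w W) (wv : w ≤ v)
    {lam eps : ℝ} (s : SmallZ f lam eps) {X Y : ℤ}
    (Z : Zn e f w W lam eps X Y) : Good e f v K lam eps X Y w w := by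
  obtain ⟨a, b⟩ := Z.zb S1 s
  obtain ⟨f1, wf, W1, Wf⟩ := S1.facts
  have hW : (W:ℝ) = 2*w+1 := by exact_mod_cast S1.hW
  have hK0 : 0 ≤ K := by have := S.hK; have := S.v0; omega
  have k0 : (0:ℝ) ≤ K := by exact_mod_cast hK0
  have v0 : (0:ℝ) ≤ v := by exact_mod_cast S.v0
  have := mul_nonneg (mul_nonneg s.hl.le k0) v0
  have hlo := Z.lo
  have hhi := Z.hi
  rw [hW] at hlo hhi
  refine ⟨a.nonneg s.hl S1.w0 S1.hW, b.nonneg s.hl S1.w0 S1.hW,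
    by simpa using a.floor s.hl W1 0 (by omega) (by omega),
    by simpa using b.floor s.hl W1 0 (by omega) (by omega), wv, wv, ?_, ?_⟩ <;> nlinarith

theorem end_good {e f v K : ℤ} (S : Setup e f v K) {lam eps : ℝ} {X Y m n : ℤ}
    (s : SmallP K lam eps) (G : Good e f v K lam eps X Y m n) {i : ℕ} {X' Y' : ℤ}
    (h : EndAt lam K (X, Y) i (X', Y')) : Good e f v K lam eps X' Y' v 0 := by
  obtain ⟨i', X1, Y1, a, b⟩ := end_exists S s G
  have := (endAt_unique h a).2
  simp only [Prod.mk.injEq] at this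
  rw [this.1, this.2]; exact b

theorem X_big {e f v K : ℤ} (S : Setup e f v K) {lam eps : ℝ} {X Y : ℤ}
    (s : SmallP K lam eps) (G : Good e f v K lam eps X Y v 0) (hY : Y < K) : 7*K ≤ X := by
  have B := (G.inBox S s).lo
  have hv : (v:ℝ)^2 ≤ e := by exact_mod_cast S.hv
  have hK : (K:ℝ) = 2*v+1 := by exact_mod_cast S.hK
  have K1 : 1 ≤ K := by have := S.hK; have := S.v0; omega
  have K1r : (1:ℝ) ≤ K := by exact_mod_cast K1
  have hYr : (Y:ℝ) ≤ K := by exact_mod_cast hY.le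
  have v0 : (0:ℝ) ≤ v := by exact_mod_cast S.v0
  have hl := s.hl
  have h1 := mul_le_mul_of_nonneg_left hYr hl.le
  have hs := s.hs
  rw [← hK] at B
  push_cast at B
  have hK2 : (K:ℝ) ≤ K^2 := by nlinarith
  have h2 := mul_le_mul_of_nonneg_left hK2 hl.le
  have h3 : K*(lam*(7*K)) ≤ K*(lam*X) := by
    have : 0 ≤ (v:ℝ)^2 + v^2 := by positivity
    nlinarith
  have h4 := le_of_mul_le_mul_left (le_of_mul_le_mul_left h3 (by linarith)) hl
  exact_mod_cast h4

theorem lamK {K : ℤ} {lam eps : ℝ} (s : SmallP K lam eps) (K1 : 1 ≤ K) : lam * K < 1 := by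
  have K1r : (1:ℝ) ≤ K := by exact_mod_cast K1
  have hK2 : (K:ℝ) ≤ K^2 := by nlinarith
  have h2 := mul_le_mul_of_nonneg_left hK2 s.hl.le
  have := s.hs; have := s.he1
  have := mul_pos s.hl (by linarith : (0:ℝ) < K)
  linarith

theorem last_step {e f v K : ℤ} (S : Setup e f v K) {lam eps : ℝ} {X Y : ℤ}
    (s : SmallP K lam eps) (G : Good e f v K lam eps X Y v 0) (hY : Y < K) :
    ∃ k : ℤ, -1 ≤ k ∧ (Fe lam ^ 4) (X, Y) = (X + k, Y - K) ∧ (v < Y → k = 0) := by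
  obtain ⟨k, h1, h2, h3⟩ := goodH S s G (by have := S.hf; linarith)
  have K1 : 1 ≤ K := by have := S.hK; have := S.v0; omega
  have Y0 := G.Y0
  rw [← S.hK] at h1 h2
  refine ⟨k, ?_, h2, ?_⟩
  · rcases h3 with ⟨-, a, -⟩ | ⟨-, a, -⟩ <;> omega
  · intro hv
    have hl := s.hl
    have hk := lamK s K1
    have b1 : ((Y-K:ℤ):ℝ) ≤ -1 := by
      have : Y - K ≤ -1 := by omega
      exact_mod_cast this
    have b2 : -(K:ℝ) ≤ ((Y-K:ℤ):ℝ) := by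
      have : -K ≤ Y - K := by omega
      exact_mod_cast this
    have b3 : ((v-Y:ℤ):ℝ) ≤ -1 := by
      have : v - Y ≤ -1 := by omega
      exact_mod_cast this
    have b4 : -(K:ℝ) ≤ ((v-Y:ℤ):ℝ) := by
      have : -K ≤ v - Y := by have := S.v0; omega
      exact_mod_cast this
    have c1 := mul_le_mul_of_nonneg_left b1 hl.le
    have c2 := mul_le_mul_of_nonneg_left b2 hl.le
    have c3 := mul_le_mul_of_nonneg_left b3 hl.le
    have c4 := mul_le_mul_of_nonneg_left b4 hl.le
    have d1 : ⌊lam * ((Y-K:ℤ):ℝ)⌋ = -1 := by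
      rw [Int.floor_eq_iff]; push_cast at *; constructor <;> linarith
    have d2 : ⌊lam * ((v-Y:ℤ):ℝ)⌋ = -1 := by
      rw [Int.floor_eq_iff]; push_cast at *; constructor <;> linarith
    rw [h1, d1, d2]; norm_num

theorem Fe_pow_add (lam : ℝ) (a b : ℕ) (p : ℤ × ℤ) : (Fe lam ^ (a+b)) p = (Fe lam ^ a) ((Fe lam ^ b) p) := by
  rw [pow_add]; rfl

theorem Fe_zpow_add (lam : ℝ) (a b : ℤ) (p : ℤ × ℤ) : (Fe lam ^ (a+b)) p = (Fe lam ^ a) ((Fe lam ^ b) p) := by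
  rw [zpow_add]; rfl

theorem T_pow (lam : ℝ) (j : ℕ) (p : ℤ × ℤ) : ((Fe lam ^ 4)^j) p = (Fe lam ^ (4*j)) p := by
  rw [pow_mul]

/-- `G Fᵏ z = F^{c-k} z` when `G z = F^c z`. -/
theorem G_pow_of {lam : ℝ} {z : ℤ × ℤ} {c : ℤ} (hG : Gmap z = (Fe lam ^ c) z) (k : ℤ) :
    Gmap ((Fe lam ^ k) z) = (Fe lam ^ (c-k)) z := by
  have := Gmap_zpow lam k (Gmap z)
  rw [Gmap_Gmap, hG, ← Fe_zpow_add] at this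
  rw [this]; congr 2; ring

theorem fix_of {lam : ℝ} {z : ℤ × ℤ} {c J N : ℕ} (hz : z ∈ Xset lam) (hG : Gmap z = (Fe lam ^ (c:ℤ)) z)
    (hN : (Fe lam ^ (N:ℤ)) z = z) (hNJ : N + 1 + c = 2*J) (hN1 : 1 ≤ N)
    (h1 : ∀ k : ℕ, 1 ≤ k → k < J → (Fe lam ^ (k:ℤ)) z ∉ Xset lam)
    (h2 : ∀ k : ℕ, c < k → k < J → Gmap ((Fe lam ^ (k:ℤ)) z) ∉ Xset lam) :
    Phi lam z = z ∧ Gmap '' orbitSet lam z = orbitSet lam z := by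
  constructor
  · have : tauPlus lam z = N := by
      unfold tauPlus
      apply le_antisymm
      · exact Nat.sInf_le ⟨hN1, by rw [hN]; exact hz⟩
      · refine le_csInf (s := {k : ℕ | 1 ≤ k ∧ (Fe lam ^ (k : ℤ)) z ∈ Xset lam})
          ⟨N, hN1, by rw [hN]; exact hz⟩ ?_
        rintro k ⟨hk1, hk2⟩
        by_contra hc
        push Not at hc
        rcases lt_or_ge k J with h | h
        · exact h1 k hk1 h hk2
        · apply h2 (N - k + c) (by omega) (by omega)
          rw [G_pow_of hG]
          have e1 : ((c:ℤ) - ((N - k + c : ℕ):ℤ)) = k + (-N) := by omega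
          rw [e1, Fe_zpow_add]
          have e2 : (Fe lam ^ (-(N:ℤ))) z = z := by
            conv_lhs => rw [← hN]
            rw [← Fe_zpow_add]; simp
          rw [e2]; exact hk2
    unfold Phi
    rw [this]; exact hN
  · apply Set.Subset.antisymm
    · rintro _ ⟨_, ⟨k, rfl⟩, rfl⟩
      exact ⟨_, G_pow_of hG k⟩
    · rintro _ ⟨k, rfl⟩
      refine ⟨(Fe lam ^ ((c:ℤ)-k)) z, ⟨_, rfl⟩, ?_⟩
      rw [G_pow_of hG]; congr 2; ring

theorem Fe1 (lam : ℝ) (X Y m : ℤ) (h : ⌊lam * X⌋ = m) : Fe lam (X,Y) = (m-Y, X) := by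
  rw [← h]; rfl

theorem not_mem_neg {lam : ℝ} {p : ℤ × ℤ} (h : p.1 < 0 ∨ p.2 < 0) : p ∉ Xset lam ∧ Gmap p ∉ Xset lam := by
  constructor
  · rintro ⟨a, b, -⟩; omega
  · rintro ⟨a, b, -⟩; simp only [Gmap] at a b; omega

theorem inter_neg {lam : ℝ} {X Y m : ℤ} (hl : 0 < lam) (h : ⌊lam * X⌋ = m) (hX : 0 ≤ X) (hY : m < Y) :
    ∀ r : ℕ, 1 ≤ r → r ≤ 3 → (((Fe lam ^ r) (X,Y)).1 < 0 ∨ ((Fe lam ^ r) (X,Y)).2 < 0) := by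
  have e1 := Fe1 lam X Y m h
  have e2 := Fe1 lam (m-Y) X _ rfl
  have e3 := Fe1 lam (⌊lam * ((m-Y:ℤ):ℝ)⌋ - X) (m-Y) _ rfl
  have h1 : ⌊lam * ((m-Y:ℤ):ℝ)⌋ < 0 := by
    apply Int.floor_lt.2
    have : m - Y < 0 := by omega
    have : ((m-Y:ℤ):ℝ) < 0 := by exact_mod_cast this
    push_cast at this ⊢
    exact mul_neg_of_pos_of_neg hl this
  intro r r1 r3
  interval_cases r
  · rw [pow_one, e1]; left; show m - Y < 0; omega
  · rw [pow_succ', pow_one, Equiv.Perm.mul_apply, e1, e2]; right; show m - Y < 0; omega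
  · rw [pow_succ', pow_succ', pow_one, Equiv.Perm.mul_apply, Equiv.Perm.mul_apply, e1, e2, e3]
    right; show ⌊lam * ((m-Y:ℤ):ℝ)⌋ - X < 0; omega

/-- data of a zone point together with its end point -/
structure ZE (e f v K w W : ℤ) (lam eps : ℝ) (x y : ℤ) (i : ℕ) (X Y : ℤ) : Prop where
  S : Setup e f v K
  S1 : Setup1 e f w W
  wv : w ≤ v
  e0 : 0 ≤ e
  s : SmallZ f lam eps
  Z : Zn e f w W lam eps x y
  E : EndAt lam K (x,y) i (X,Y)

section
variable {e f v K w W : ℤ} {lam eps : ℝ} {x y X Y : ℤ} {i : ℕ}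

theorem ZE.sp (D : ZE e f v K w W lam eps x y i X Y) : SmallP K lam eps := (D.s.toP D.S D.e0).2

theorem ZE.g (D : ZE e f v K w W lam eps x y i X Y) : Good e f v K lam eps x y w w :=
  D.Z.good D.S D.S1 D.wv D.s

theorem ZE.gE (D : ZE e f v K w W lam eps x y i X Y) : Good e f v K lam eps X Y v 0 :=
  end_good D.S D.sp D.g D.E

theorem ZE.i1 (D : ZE e f v K w W lam eps x y i X Y) : 1 ≤ i := by
  by_contra hc
  have hi : i = 0 := by omega
  have h := D.E
  subst hi
  have h1 : (x,y) = (X,Y) := h.1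
  have h2 := h.2.1
  simp only [Prod.mk.injEq] at h1
  simp only at h2
  rw [← h1.2] at h2
  obtain ⟨a, b⟩ := final_box D.S D.sp D.g h2
  have hz := (D.Z.zb D.S1 D.s).2.lo
  have hW : W = K := by have := D.S1.hW; have := D.S.hK; omega
  have K1 : 1 ≤ K := by have := D.S.hK; have := D.S.v0; omega
  have h2r : (y:ℝ) < K := by exact_mod_cast h2
  have := mul_lt_mul_of_pos_left h2r D.s.hl
  rw [hW, b] at hz
  push_cast at hz
  have K1r : (1:ℝ) ≤ K := by exact_mod_cast K1
  have := mul_pos D.s.hl (by linarith : (0:ℝ) < K)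
  linarith

/-- second-difference facts along the path -/
theorem ZE.u_ge (D : ZE e f v K w W lam eps x y i X Y) : ∀ j, 1 ≤ j → j ≤ i →
    W ≤ (((Fe lam ^ 4)^j) (x,y)).1 - (((Fe lam ^ 4)^j) (x,y)).2 := by
  intro j hj
  induction j with
  | zero => omega
  | succ j ih =>
    intro hji
    rcases Nat.eq_zero_or_pos j with rfl | h
    · rw [zero_add, pow_one, D.Z.step D.S1 D.s]
      have := D.Z.u1; simp only; omega
    · have := u_along D.S D.sp D.g D.E j (by omega)
      have := ih h (by omega)
      omega

theorem ZE.abs_u (D : ZE e f v K w W lam eps x y i X Y) (j : ℕ) (hj : j < i) :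
    |(((Fe lam ^ 4)^j) (x,y)).1 - (((Fe lam ^ 4)^j) (x,y)).2| ≤
      |(((Fe lam ^ 4)^(j+1)) (x,y)).1 - (((Fe lam ^ 4)^(j+1)) (x,y)).2| ∧
    ((1 ≤ j ∨ x = y) →
    |(((Fe lam ^ 4)^j) (x,y)).1 - (((Fe lam ^ 4)^j) (x,y)).2| <
      |(((Fe lam ^ 4)^(j+1)) (x,y)).1 - (((Fe lam ^ 4)^(j+1)) (x,y)).2|) := by
  obtain ⟨f1, wf, W1, Wf⟩ := D.S1.facts
  have h1 := u_along D.S D.sp D.g D.E j hj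
  have h2 := D.u_ge (j+1) (by omega) (by omega)
  rw [abs_of_pos (by omega : 0 < (((Fe lam ^ 4)^(j+1)) (x,y)).1 - (((Fe lam ^ 4)^(j+1)) (x,y)).2)]
  rcases Nat.eq_zero_or_pos j with rfl | h
  · have := D.Z.u1; have := D.Z.u2
    simp only [pow_zero, Equiv.Perm.one_apply, zero_add] at *
    constructor
    · rw [abs_le]; constructor <;> omega
    · rintro (h | h)
      · omega
      · rw [h, sub_self, abs_zero]; rw [h] at h2; omega
  · have h3 := D.u_ge j h hj.le
    rw [abs_of_pos (by omega)]
    omega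

theorem ZE.not_mem (D : ZE e f v K w W lam eps x y i X Y) (k : ℕ) (h1 : 1 ≤ k) (h2 : k ≤ 4*i) :
    (Fe lam ^ (k:ℤ)) (x,y) ∉ Xset lam ∧
    ((4 < k ∨ x = y) → Gmap ((Fe lam ^ (k:ℤ)) (x,y)) ∉ Xset lam) := by
  have hl := D.s.hl
  rw [zpow_natCast]
  obtain ⟨j, r, hr, rfl⟩ : ∃ j r : ℕ, r < 4 ∧ k = r + 4*j := ⟨k/4, k%4, by omega, by omega⟩
  rcases Nat.eq_zero_or_pos r with rfl | r1
  · obtain ⟨j, rfl⟩ : ∃ j', j = j'+1 := ⟨j-1, by omega⟩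
    rw [zero_add, ← T_pow]
    obtain ⟨a, b⟩ := D.abs_u j (by omega)
    rw [mem_Xset hl, mem_Xset hl]
    have e1 : Gmap ((Fe lam ^ 4) (Gmap ((((Fe lam)^4)^(j+1)) (x,y)))) = (((Fe lam)^4)^j) (x,y) := by
      rw [Gmap_pow, pow_succ' (Fe lam ^ 4) j]
      change ((Fe lam)⁻¹ ^ 4) ((Fe lam ^ 4) ((((Fe lam)^4)^j) (x,y))) = _
      rw [inv_pow]
      exact Equiv.symm_apply_apply _ _
    constructor
    · rintro ⟨-, -, -, h⟩
      rw [abs_sub_comm ((Fe lam ^ 4) _).1] at h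
      have h' : |(((Fe lam ^ 4)^(j+1)) (x,y)).1 - (((Fe lam ^ 4)^(j+1)) (x,y)).2| <
        |(Gmap ((Fe lam ^ 4) (Gmap ((((Fe lam)^4)^(j+1)) (x,y))))).1 -
          (Gmap ((Fe lam ^ 4) (Gmap ((((Fe lam)^4)^(j+1)) (x,y))))).2| := h
      rw [e1] at h'
      omega
    · rintro h0 ⟨-, -, h, -⟩
      rw [abs_sub_comm ((Fe lam ^ 4) _).1] at h
      have h' : |(Gmap (((Fe lam ^ 4)^(j+1)) (x,y))).1 - (Gmap (((Fe lam ^ 4)^(j+1)) (x,y))).2| ≤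
        |(Gmap ((Fe lam ^ 4) (Gmap ((((Fe lam)^4)^(j+1)) (x,y))))).1 -
          (Gmap ((Fe lam ^ 4) (Gmap ((((Fe lam)^4)^(j+1)) (x,y))))).2| := h
      rw [e1, abs_sub_comm (Gmap _).1] at h'
      have := b (by omega)
      simp only [Gmap] at h'
      omega
  · rw [Fe_pow_add, ← T_pow]
    obtain ⟨X', Y', m', n', a, b⟩ := good_along D.S D.sp D.g D.E j (by omega)
    have c := D.E.2.2 j (by omega)
    rw [a] at c ⊢
    simp only at c
    have := b.mv; have := D.S.hK; have := D.S.v0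
    have := not_mem_neg (lam := lam) (inter_neg hl b.hm b.X0 (by omega : m' < Y') r r1 (by omega))
    exact ⟨this.1, fun _ => this.2⟩

theorem ZE.fixed_of (D : ZE e f v K w W lam eps x y i X Y) (hu : x = y ∨ x - y = -W)
    (ht : 2*Y = v ∨ 2*Y = 3*v+1) :
    Phi lam (x,y) = (x,y) ∧ Gmap '' orbitSet lam (x,y) = orbitSet lam (x,y) := by
  have hl := D.s.hl
  have i1 := D.i1
  have hz := D.Z.mem D.S1 D.s
  have hE : (Fe lam ^ ((4*i:ℕ):ℤ)) (x,y) = (X,Y) := by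
    rw [zpow_natCast, ← T_pow]; exact D.E.1
  have gE := D.gE
  have hYK : Y < K := D.E.2.1
  obtain ⟨c, hc, hG⟩ : ∃ c : ℕ, ((c = 0 ∧ x = y) ∨ c = 4) ∧ Gmap (x,y) = (Fe lam ^ (c:ℤ)) (x,y) := by
    rcases hu with h | h
    · refine ⟨0, Or.inl ⟨rfl, h⟩, ?_⟩
      rw [h]; rfl
    · refine ⟨4, Or.inr rfl, ?_⟩
      rw [zpow_natCast, D.Z.step D.S1 D.s, Gmap]
      ext <;> simp only <;> omega
  have per : ∀ a b : ℤ, (Fe lam ^ a) (x,y) = Gmap ((Fe lam ^ b) (x,y)) →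
      (Fe lam ^ (a+b-c)) (x,y) = (x,y) := by
    intro a b h
    rw [G_pow_of hG] at h
    have e1 : a + b - (c:ℤ) = -(c-b) + a := by ring
    rw [e1, Fe_zpow_add, h, ← Fe_zpow_add]; simp
  rcases ht with ht | ht
  · have h1 : (Fe lam ^ ((4*i+1:ℕ):ℤ)) (x,y) = Gmap ((Fe lam ^ ((4*i:ℕ):ℤ)) (x,y)) := by
      rw [hE, Nat.cast_add, add_comm, Fe_zpow_add, hE, Nat.cast_one, zpow_one, Fe1 lam X Y v gE.hm, Gmap]
      ext <;> simp only; omega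
    have h2 := per _ _ h1
    refine fix_of (c := c) (J := 4*i+1) (N := 4*i+1+4*i-c) hz hG ?_ (by omega) (by omega) ?_ ?_
    · have e1 : ((4*i+1+4*i-c:ℕ):ℤ) = ((4*i+1:ℕ):ℤ) + ((4*i:ℕ):ℤ) - c := by omega
      rw [e1]; exact h2
    · intro k k1 k2; exact (D.not_mem k k1 (by omega)).1
    · intro k k1 k2; exact (D.not_mem k (by omega) (by omega)).2 (by omega)
  · have hvY : v < Y := by have := D.S.v0; omega
    obtain ⟨k, -, hk, hk0⟩ := last_step D.S D.sp gE hYK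
    rw [hk0 hvY, add_zero] at hk
    have h1 : (Fe lam ^ ((4*i+5:ℕ):ℤ)) (x,y) = Gmap ((Fe lam ^ ((4*i:ℕ):ℤ)) (x,y)) := by
      rw [hE, show ((4*i+5:ℕ):ℤ) = 1 + (4 + (4*i:ℕ)) by push_cast; ring, Fe_zpow_add, Fe_zpow_add, hE,
        show ((4:ℤ)) = ((4:ℕ):ℤ) by norm_num, zpow_natCast, hk, zpow_one, Fe1 lam X _ v gE.hm, Gmap]
      have := D.S.hK
      ext <;> simp only; omega
    have h2 := per _ _ h1
    have h3 : ∀ k : ℕ, 4*i < k → k < 4*i+3 →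
      (Fe lam ^ (k:ℤ)) (x,y) ∉ Xset lam ∧ Gmap ((Fe lam ^ (k:ℤ)) (x,y)) ∉ Xset lam := by
      intro k k1 k2
      obtain ⟨r, rfl⟩ : ∃ r : ℕ, k = r + 4*i := ⟨k - 4*i, by omega⟩
      rw [Nat.cast_add, Fe_zpow_add, hE, zpow_natCast]
      exact not_mem_neg (inter_neg hl gE.hm gE.X0 hvY r (by omega) (by omega))
    refine fix_of (c := c) (J := 4*i+3) (N := 4*i+5+4*i-c) hz hG ?_ (by omega) (by omega) ?_ ?_
    · have e1 : ((4*i+5+4*i-c:ℕ):ℤ) = ((4*i+5:ℕ):ℤ) + ((4*i:ℕ):ℤ) - c := by omega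
      rw [e1]; exact h2
    · intro k k1 k2
      rcases le_or_gt k (4*i) with h | h
      · exact (D.not_mem k k1 h).1
      · exact (h3 k h k2).1
    · intro k k1 k2
      rcases le_or_gt k (4*i) with h | h
      · exact (D.not_mem k (by omega) h).2 (by omega)
      · exact (h3 k h k2).2

end

/-! ### Symmetric fixed points: necessity -/

section
variable {e f v K w W : ℤ} {lam eps : ℝ} {x y X Y : ℤ} {i : ℕ}

theorem step_bound (S : Setup e f v K) {m n : ℤ}
    (s : SmallP K lam eps) (G : Good e f v K lam eps X Y m n) :
    ((Fe lam ^ 4) (X,Y)).1 - ((Fe lam ^ 4) (X,Y)).2 ≤ X - Y + 2*K + 1 := by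
  have := G.mv; have := G.nv; have := S.hK
  rcases boxcase S m n with hc | hc
  · obtain ⟨k, -, h2, h3⟩ := goodH S s G hc
    rw [h2]; simp only
    rcases h3 with ⟨-, b, -⟩ | ⟨-, b, -⟩ <;> omega
  · obtain ⟨k, -, h2, h3⟩ := goodV S s G hc
    rw [h2]; simp only
    rcases h3 with ⟨-, b, -⟩ | ⟨-, b, -⟩ <;> omega

/-- the first point of the second quarter -/
theorem ZE.second (D : ZE e f v K w W lam eps x y i X Y) :
    ∃ (N : ℕ) (r : ℤ), 1 ≤ N ∧ (Fe lam ^ N) (x,y) = (r, X) ∧ 0 ≤ r ∧ r < K ∧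
      (r = v - Y ∨ r = 3*v+1-Y) := by
  have hl := D.s.hl
  have hE : (Fe lam ^ (4*i)) (x,y) = (X,Y) := by
    rw [← T_pow]; exact D.E.1
  have gE := D.gE
  have hYK : Y < K := D.E.2.1
  have hY0 := gE.Y0
  have hK := D.S.hK
  have v0 := D.S.v0
  rcases le_or_gt Y v with h | h
  · refine ⟨1 + 4*i, v - Y, by omega, ?_, by omega, by omega, Or.inl rfl⟩
    rw [Fe_pow_add, hE, pow_one, Fe1 lam X Y v gE.hm]
  · obtain ⟨k, -, hk, hk0⟩ := last_step D.S D.sp gE hYK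
    rw [hk0 h, add_zero] at hk
    refine ⟨1 + (4 + 4*i), 3*v+1-Y, by omega, ?_, by omega, by omega, Or.inr rfl⟩
    rw [Fe_pow_add, Fe_pow_add, hE, hk, pow_one, Fe1 lam X _ v gE.hm]
    ext <;> simp only; omega

theorem ZE.second_good (D : ZE e f v K w W lam eps x y i X Y) {r : ℤ} (h0 : 0 ≤ r) (hr : r < K) :
    Good e f v K lam (eps/4) r X 0 v := by
  have gE := D.gE
  have hK := D.S.hK
  have v0 := D.S.v0
  have sp := D.sp
  have s4 := (D.s.toP D.S D.e0).1
  have hl := sp.hl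
  have K1 : 1 ≤ K := by omega
  have hk := lamK sp K1
  have h0r : (0:ℝ) ≤ r := by exact_mod_cast h0
  have hrr : (r:ℝ) < K := by exact_mod_cast hr
  have a1 := mul_nonneg hl.le h0r
  have a2 := mul_lt_mul_of_pos_left hrr hl
  have Y0 : (0:ℝ) ≤ Y := by exact_mod_cast gE.Y0
  have hYK : Y < K := D.E.2.1
  have YK : (Y:ℝ) < K := by exact_mod_cast hYK
  have b1 := mul_nonneg hl.le Y0
  have b2 := mul_lt_mul_of_pos_left YK hl
  have lo := gE.lo
  have hi := gE.hi
  have hKr : (K:ℝ) = 2*v+1 := by exact_mod_cast hK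
  have v0r : (0:ℝ) ≤ v := by exact_mod_cast v0
  have hs := s4.hs
  have c1 : 2*(lam*K)*(v-0+v) + lam*K ≤ 3*(lam*K^2) := by
    have : (K:ℝ) * (2*v) ≤ K*K := mul_le_mul_of_nonneg_left (by linarith) (by linarith)
    have := mul_le_mul_of_nonneg_left this hl.le
    have : (K:ℝ) ≤ K*K := by nlinarith
    have := mul_le_mul_of_nonneg_left this hl.le
    nlinarith
  push_cast at lo hi
  refine ⟨h0, gE.X0, ?_, gE.hm, v0, le_rfl, ?_, ?_⟩
  · rw [Int.floor_eq_iff]; push_cast; constructor <;> linarith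
  · push_cast; nlinarith [sp.he]
  · push_cast; nlinarith [sp.he]

/-- return to the domain `X` -/
theorem ret_exists (S : Setup e f v K) {R m n : ℤ} (s : SmallP K lam eps)
    (G : Good e f v K lam eps R X m n) (hR : R < K) (hX : 7*K ≤ X) :
    ∃ i : ℕ, (((Fe lam ^ 4)^i) (R,X)) ∈ Xset lam ∧
      ∀ t ≤ i, 0 ≤ (((Fe lam ^ 4)^t) (R,X)).1 ∧ 0 ≤ (((Fe lam ^ 4)^t) (R,X)).2 := by
  have hl := s.hl
  have K1 : 1 ≤ K := by have := S.hK; have := S.v0; omega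
  obtain ⟨i1, X1, Y1, hE, gE⟩ := end_exists S s G
  have hga := good_along S s G hE
  have hua := u_along S s G hE
  obtain ⟨u, hu⟩ : ∃ u : ℕ → ℤ, ∀ j, u j = (((Fe lam ^ 4)^j) (R,X)).1 - (((Fe lam ^ 4)^j) (R,X)).2 :=
    ⟨fun j => (((Fe lam ^ 4)^j) (R,X)).1 - (((Fe lam ^ 4)^j) (R,X)).2, fun _ => rfl⟩
  have hua' : ∀ j < i1, u j + 2 ≤ u (j+1) := by intro j hj; rw [hu, hu]; exact hua j hj
  have u0 : u 0 ≤ -6*K := by rw [hu]; simp only [pow_zero, Equiv.Perm.one_apply]; omega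
  have hY1 : Y1 < K := hE.2.1
  have hX1 := X_big S s gE hY1
  have ue : 0 < u i1 := by rw [hu, hE.1]; simp only; omega
  have u1 : u 1 ≤ u 0 + 2*K+1 := by
    rw [hu, hu]
    have := step_bound S s G
    simp only [pow_zero, pow_one, Equiv.Perm.one_apply]; omega
  have ulast : u i1 ≤ u (i1+1) := by
    obtain ⟨k, hk, hk2, -⟩ := last_step S s gE hY1
    rw [hu, hu, pow_succ' (Fe lam ^ 4) i1, Equiv.Perm.mul_apply, hE.1, hk2]; simp only; omega
  have hex : ∃ t, i1 ≤ t ∨ 0 ≤ u t + u (t+1) := ⟨i1, Or.inl le_rfl⟩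
  classical
  obtain ⟨i, hi⟩ : ∃ i, i = Nat.find hex := ⟨_, rfl⟩
  have hsp := Nat.find_spec hex
  rw [← hi] at hsp
  have hmin : ∀ t < i, t < i1 ∧ u t + u (t+1) < 0 := by
    intro t ht
    rw [hi] at ht
    have := Nat.find_min hex ht
    push Not at this; exact this
  have hile : i ≤ i1 := by
    by_contra hc; push Not at hc
    have := (hmin i1 hc).1; omega
  have hi1 : i ≠ 0 := by
    rintro h0; rw [h0] at hsp
    rcases hsp with h | h
    · have : i1 = 0 := by omega
      rw [this] at ue; omega
    · simp only [zero_add] at h; omega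
  refine ⟨i, ?_, ?_⟩
  · rw [mem_Xset hl]
    obtain ⟨X', Y', m', n', a, b⟩ := hga i hile
    obtain ⟨j, rfl⟩ : ∃ j, i = j+1 := ⟨i-1, by omega⟩
    obtain ⟨p1, p2⟩ := hmin j (by omega)
    have p3 := hua' j p1
    have e1 : Gmap ((Fe lam ^ 4) (Gmap ((((Fe lam)^4)^(j+1)) (R,X)))) = (((Fe lam)^4)^j) (R,X) := by
      rw [Gmap_pow, pow_succ' (Fe lam ^ 4) j]
      change ((Fe lam)⁻¹ ^ 4) ((Fe lam ^ 4) ((((Fe lam)^4)^j) (R,X))) = _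
      rw [inv_pow]
      exact Equiv.symm_apply_apply _ _
    refine ⟨by rw [a]; exact b.X0, by rw [a]; exact b.Y0, ?_, ?_⟩
    · have hh : |u (j+1)| ≤ |u (j+1+1)| := by
        have q : u (j+1) ≤ u (j+1+1) ∧ 0 ≤ u (j+1) + u (j+1+1) := by
          rcases Nat.lt_or_ge (j+1) i1 with h | h
          · have := hua' (j+1) h
            rcases hsp with h' | h'
            · omega
            · exact ⟨by omega, h'⟩
          · have : j+1 = i1 := by omega
            rw [this]; exact ⟨ulast, by omega⟩
        rw [abs_of_nonneg (by omega : 0 ≤ u (j+1+1)), abs_le]; constructor <;> omega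
      rw [hu, hu, pow_succ' (Fe lam ^ 4) (j+1), Equiv.Perm.mul_apply] at hh
      exact hh
    · have hh : |u (j+1)| < |u j| := by
        rw [abs_of_neg (by omega : u j < 0), abs_lt]; constructor <;> omega
      rw [hu, hu, ← e1] at hh
      rw [abs_sub_comm ((Fe lam ^ 4) _).1]
      exact hh
  · intro t ht
    obtain ⟨X', Y', m', n', a, b⟩ := hga t (by omega)
    rw [a]; exact ⟨b.X0, b.Y0⟩

theorem ZE.of_fixed (D : ZE e f v K w W lam eps x y i X Y)
    (hfix : Phi lam (x,y) = (x,y)) (hsym : Gmap '' orbitSet lam (x,y) = orbitSet lam (x,y)) :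
    (x = y ∨ x - y = -W) ∧ (2*Y = v ∨ 2*Y = 3*v+1) := by
  have hl := D.s.hl
  have i1 := D.i1
  have gE := D.gE
  have hYK : Y < K := D.E.2.1
  have hz := D.Z.mem D.S1 D.s
  obtain ⟨f1, wf, W1, Wf⟩ := D.S1.facts
  obtain ⟨N, r, N1, hN, r0, rK, hr⟩ := D.second
  obtain ⟨t, ht, htp⟩ := ret_exists D.S (D.s.toP D.S D.e0).1 (D.second_good r0 rK) rK
    (X_big D.S D.sp gE hYK)
  -- the transit time
  have hne : {k : ℕ | 1 ≤ k ∧ (Fe lam ^ (k : ℤ)) (x,y) ∈ Xset lam}.Nonempty := by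
    refine ⟨4*t+N, by omega, ?_⟩
    rw [zpow_natCast, Fe_pow_add, hN, ← T_pow]; exact ht
  have htau := Nat.sInf_mem hne
  have hmin : ∀ k : ℕ, k < tauPlus lam (x,y) → 1 ≤ k → (Fe lam ^ (k : ℤ)) (x,y) ∉ Xset lam := by
    intro k hk k1 hm
    exact Nat.notMem_of_lt_sInf hk ⟨k1, hm⟩
  have htau1 : 1 ≤ tauPlus lam (x,y) := htau.1
  unfold Phi at hfix
  obtain ⟨τ, hτ⟩ : ∃ τ, τ = tauPlus lam (x,y) := ⟨_, rfl⟩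
  rw [← hτ] at hfix hmin htau1
  have hmul : ∀ k : ℤ, (Fe lam ^ ((τ:ℤ) * k)) (x,y) = (x,y) := by
    intro k
    rw [zpow_mul]
    exact Equiv.Perm.zpow_apply_eq_self_of_apply_eq_self hfix k
  have huniq : ∀ k : ℤ, (Fe lam ^ k) (x,y) ∈ Xset lam → (Fe lam ^ k) (x,y) = (x,y) := by
    intro k hk
    have e1 : (Fe lam ^ k) (x,y) = (Fe lam ^ ((k % τ).toNat : ℤ)) (x,y) := by
      have : k = k % τ + τ * (k / τ) := (Int.emod_add_mul_ediv k τ).symm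
      conv_lhs => rw [this, Fe_zpow_add, hmul]
      rw [Int.toNat_of_nonneg (Int.emod_nonneg _ (by omega))]
    rw [e1] at hk ⊢
    have h2 : k % τ < τ := Int.emod_lt_of_pos _ (by omega)
    have h3 : 0 ≤ k % τ := Int.emod_nonneg _ (by omega)
    rcases Nat.eq_zero_or_pos (k % τ).toNat with h | h
    · rw [h]; rfl
    · exact absurd hk (hmin _ (by omega) h)
  -- symmetric case
  obtain ⟨c, hc1, hG, hu⟩ : ∃ c : ℕ, c ≤ 1 ∧ Gmap (x,y) = ((Fe lam ^ 4)^c) (x,y) ∧ (x = y ∨ x - y = -W) := by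
    by_cases hW : x - y = -W
    · refine ⟨1, le_rfl, ?_, Or.inr hW⟩
      rw [pow_one, D.Z.step D.S1 D.s, Gmap]
      ext <;> simp only <;> omega
    · have u1 := D.Z.u1
      have u2 := D.Z.u2
      have hm : Gmap (x,y) ∈ Xset lam :=
        Zn.mem (X := y) (Y := x) D.S1 D.s ⟨by omega, by omega, by rw [add_comm (y:ℝ)]; exact D.Z.lo,
          by rw [add_comm (y:ℝ)]; exact D.Z.hi⟩
      have hmo : Gmap (x,y) ∈ orbitSet lam (x,y) := by
        rw [← hsym]; exact ⟨_, ⟨0, rfl⟩, rfl⟩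
      obtain ⟨k, hk⟩ := hmo
      rw [hk] at hm
      have := huniq k hm
      rw [← hk] at this
      refine ⟨0, by omega, this, Or.inl ?_⟩
      simp only [Gmap, Prod.mk.injEq] at this
      exact this.2
  refine ⟨hu, ?_⟩
  have hret : ((Fe lam ^ 4)^t) (r,X) = (x,y) := by
    have := huniq ((4*t+N:ℕ):ℤ)
    rw [zpow_natCast, Fe_pow_add, hN, ← T_pow] at this
    exact this ht
  have hrefl : ∀ k ≤ t, Gmap (((Fe lam ^ 4)^(t-k)) (r,X)) = ((Fe lam ^ 4)^(k+c)) (x,y) := by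
    intro k hk
    have h1 : ((Fe lam ^ 4)^k) (((Fe lam ^ 4)^(t-k)) (r,X)) = (x,y) := by
      rw [← Equiv.Perm.mul_apply, ← pow_add, show k + (t-k) = t by omega, hret]
    have h2 : ((Fe lam ^ 4)^(t-k)) (r,X) = ((Fe lam)⁻¹ ^ (4*k)) (x,y) := by
      rw [T_pow] at h1
      rw [← h1, inv_pow]
      exact (Equiv.symm_apply_apply _ _).symm
    rw [h2, ← Gmap_pow, Gmap_Gmap, hG, pow_add, Equiv.Perm.mul_apply, T_pow lam k]
  have h0 := hrefl t le_rfl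
  rw [Nat.sub_self, pow_zero, Equiv.Perm.one_apply] at h0
  have hge : i ≤ t + c := by
    by_contra hc; push Not at hc
    have := D.E.2.2 (t+c) hc
    rw [← h0] at this
    simp only [Gmap] at this; omega
  have hle : t + c ≤ i := by
    by_contra hc; push Not at hc
    have := hrefl (i+1-c) (by omega)
    rw [show i + 1 - c + c = i+1 by omega, pow_succ' (Fe lam ^ 4) i, Equiv.Perm.mul_apply, D.E.1] at this
    obtain ⟨k, -, hk, -⟩ := last_step D.S D.sp gE hYK
    rw [hk] at this
    have hp := (htp (t-(i+1-c)) (by omega)).1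
    have h3 := congrArg Prod.snd this
    simp only [Gmap] at h3
    omega
  have heq : t + c = i := by omega
  rw [heq, D.E.1] at h0
  simp only [Gmap, Prod.mk.injEq] at h0
  omega

end

/-! ### Counting lemmas -/

theorem sum_sub_le {I J : Finset ℤ} (hJ : J ⊆ I) (φ : ℤ → ℤ) {M : ℤ} (h0 : ∀ x, 0 ≤ φ x) (h1 : ∀ x, φ x ≤ M) :
    0 ≤ ∑ x ∈ I, φ x - ∑ x ∈ J, φ x ∧
    ∑ x ∈ I, φ x - ∑ x ∈ J, φ x ≤ ((I.card:ℤ) - J.card) * M := by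
  have h := Finset.sum_sdiff (f := φ) hJ
  have h2 : ∑ x ∈ I, φ x - ∑ x ∈ J, φ x = ∑ x ∈ I \ J, φ x := by linarith
  rw [h2]
  constructor
  · exact Finset.sum_nonneg (fun x _ => h0 x)
  · calc ∑ x ∈ I \ J, φ x ≤ ∑ x ∈ I \ J, M := Finset.sum_le_sum (fun x _ => h1 x)
      _ = _ := by
        rw [Finset.sum_const, Finset.card_sdiff_of_subset hJ, nsmul_eq_mul,
          Nat.cast_sub (Finset.card_le_card hJ)]

theorem sum_shift (lo hi d : ℤ) (φ : ℤ → ℤ) :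
    ∑ x ∈ Finset.Icc lo hi, φ (x + d) = ∑ x ∈ Finset.Icc (lo+d) (hi+d), φ x := by
  refine Finset.sum_nbij' (fun x => x + d) (fun x => x - d) ?_ ?_ ?_ ?_ ?_ <;>
    intro x hx <;> simp only [Finset.mem_Icc] at * <;> first | omega | (congr 1; done) | skip

theorem count_lemma (lo hi : ℤ) (a : ℤ) (n : ℕ) (ha : 0 ≤ a) (φ c : ℤ → ℤ)
    (p0 : ∀ x, 0 ≤ φ x) (p1 : ∀ x, φ x ≤ 1) (c0 : ∀ x, 0 ≤ c x) (c1 : ∀ x, c x ≤ n)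
    (h : ∀ x, lo ≤ x → x + a*n ≤ hi → ∑ i ∈ Finset.range n, φ (x + a*i) = c x) :
    |(n:ℤ) * ∑ x ∈ Finset.Icc lo hi, φ x - ∑ x ∈ Finset.Icc lo hi, c x| ≤ a*n*n := by
  have han : 0 ≤ a*n := by positivity
  set J := Finset.Icc lo (hi - a*n) with hJ
  set I := Finset.Icc lo hi with hI
  have hJI : J ⊆ I := Finset.Icc_subset_Icc le_rfl (by omega)
  have k1 : ∑ x ∈ J, c x = ∑ i ∈ Finset.range n, ∑ x ∈ J, φ (x + a*i) := by
    rw [Finset.sum_comm]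
    apply Finset.sum_congr rfl
    intro x hx
    rw [hJ, Finset.mem_Icc] at hx
    rw [h x hx.1 (by omega)]
  have cardb : (I.card:ℤ) - J.card ≤ a*n := by
    rw [hI, hJ, Int.card_Icc, Int.card_Icc]; omega
  have k2 := sum_sub_le hJI c c0 c1
  have k3 : ∀ i ∈ Finset.range n, 0 ≤ ∑ x ∈ I, φ x - ∑ x ∈ J, φ (x + a*i) ∧
      ∑ x ∈ I, φ x - ∑ x ∈ J, φ (x + a*i) ≤ a*n := by
    intro i hi'
    rw [Finset.mem_range] at hi'
    have hi2 : a*i ≤ a*n := mul_le_mul_of_nonneg_left (by exact_mod_cast hi'.le) ha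
    have hi3 : 0 ≤ a*i := by positivity
    rw [hJ, sum_shift]
    have := sum_sub_le (I := I) (J := Finset.Icc (lo+a*i) (hi - a*n + a*i))
      (Finset.Icc_subset_Icc (by omega) (by omega)) φ p0 p1
    refine ⟨this.1, this.2.trans ?_⟩
    rw [hI, Int.card_Icc, Int.card_Icc]; omega
  have k4 : (n:ℤ) * ∑ x ∈ I, φ x - ∑ x ∈ J, c x =
      ∑ i ∈ Finset.range n, (∑ x ∈ I, φ x - ∑ x ∈ J, φ (x + a*i)) := by
    rw [Finset.sum_sub_distrib, ← k1]; simp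
  have k5 : 0 ≤ ∑ i ∈ Finset.range n, (∑ x ∈ I, φ x - ∑ x ∈ J, φ (x + a*i)) :=
    Finset.sum_nonneg (fun i hi => (k3 i hi).1)
  have k6 : ∑ i ∈ Finset.range n, (∑ x ∈ I, φ x - ∑ x ∈ J, φ (x + a*i)) ≤ n * (a*n) := by
    calc _ ≤ ∑ i ∈ Finset.range n, (a*n) := Finset.sum_le_sum (fun i hi => (k3 i hi).2)
      _ = _ := by simp
  have k7 : ((I.card:ℤ) - J.card) * n ≤ a*n*n := mul_le_mul_of_nonneg_right cardb (by positivity)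
  have k8 : (n:ℤ)*(a*n) = a*n*n := by ring
  rw [abs_le]
  constructor <;> linarith

/-- a map of `range n` that is injective mod `n` permutes residues -/
theorem perm_residues (n : ℕ) (s : ℕ → ℤ) (hinj : ∀ i < n, ∀ j < n, (n:ℤ) ∣ s j - s i → i = j)
    (G : ℤ → ℤ) (hG : ∀ x y, x ≡ y [ZMOD n] → G x = G y) :
    ∑ i ∈ Finset.range n, G (s i) = ∑ i ∈ Finset.range n, G i := by
  rcases Nat.eq_zero_or_pos n with rfl | hn
  · simp
  have hn' : (0:ℤ) < n := by exact_mod_cast hn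
  let t : ℕ → ℕ := fun i => (s i % n).toNat
  have ht : ∀ i, (t i : ℤ) = s i % n := fun i => Int.toNat_of_nonneg (Int.emod_nonneg _ hn'.ne')
  have hlt : ∀ i, t i < n := by
    intro i
    have := Int.emod_lt_of_pos (s i) hn'
    rw [← ht] at this; exact_mod_cast this
  have hti : Set.InjOn t (Finset.range n) := by
    intro i hi j hj hij
    simp only [Finset.coe_range, Set.mem_Iio] at hi hj
    apply hinj i hi j hj
    apply Int.ModEq.dvd
    have : (t i : ℤ) = t j := by exact_mod_cast hij
    rw [ht, ht] at this; exact this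
  have himg : (Finset.range n).image t = Finset.range n := by
    apply Finset.eq_of_subset_of_card_le
    · intro x hx
      obtain ⟨i, -, rfl⟩ := Finset.mem_image.1 hx
      exact Finset.mem_range.2 (hlt i)
    · rw [Finset.card_image_of_injOn hti]
  conv_rhs => rw [← himg, Finset.sum_image hti]
  apply Finset.sum_congr rfl
  intro i _
  apply hG
  rw [ht]
  exact (Int.mod_modEq _ _).symm

/-! ### Counting in the zone -/

open Classical in
/-- The `y`-coordinate of the end point of the transit. -/
noncomputable def yE (lam : ℝ) (K : ℤ) (p : ℤ × ℤ) : ℤ :=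
  if h : ∃ q : ℤ × ℤ, ∃ i, EndAt lam K p i q then h.choose.2 else 0

theorem yE_eq {lam : ℝ} {K : ℤ} {p q : ℤ × ℤ} {i : ℕ} (h : EndAt lam K p i q) : yE lam K p = q.2 := by
  have h' : ∃ q : ℤ × ℤ, ∃ i, EndAt lam K p i q := ⟨q, i, h⟩
  unfold yE
  rw [dif_pos h']
  obtain ⟨j, hj⟩ := h'.choose_spec
  rw [(endAt_unique hj h).2]

structure Ctx (e f v K w W : ℤ) (lam eps : ℝ) : Prop where
  S : Setup e f v K
  S1 : Setup1 e f w W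
  wv : w ≤ v
  e0 : 0 ≤ e
  s : SmallZ f lam eps

section
variable {e f v K w W : ℤ} {lam eps : ℝ}

theorem Ctx.ze (c : Ctx e f v K w W lam eps) {x y : ℤ} (Z : Zn e f w W lam eps x y) :
    ∃ i X Y, ZE e f v K w W lam eps x y i X Y ∧ yE lam K (x, y) = Y := by
  obtain ⟨i, X, Y, h, -⟩ := end_exists c.S (c.s.toP c.S c.e0).2 (Z.good c.S c.S1 c.wv c.s)
  exact ⟨i, X, Y, ⟨c.S, c.S1, c.wv, c.e0, c.s, Z, h⟩, yE_eq h⟩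

theorem Ctx.yE_range (c : Ctx e f v K w W lam eps) {x y : ℤ} (Z : Zn e f w W lam eps x y) :
    0 ≤ yE lam K (x, y) ∧ yE lam K (x, y) < K := by
  obtain ⟨i, X, Y, D, h⟩ := c.ze Z
  rw [h]
  exact ⟨D.gE.Y0, D.E.2.1⟩

/-- The admissible range of `x+y`. -/
def InR (e f w W : ℤ) (lam eps : ℝ) (σ : ℤ) : Prop :=
  e + eps ≤ W * (lam * σ) - 2*w*(w+1) ∧ W * (lam * σ) - 2*w*(w+1) ≤ f - eps

/-- The unique point with `x+y = σ`, `-W ≤ x-y < W`, `y ≡ r mod W`. -/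
def pp (W σ r : ℤ) : ℤ × ℤ :=
  (σ - (((σ-W)/2+1) + (r - ((σ-W)/2+1)) % W), ((σ-W)/2+1) + (r - ((σ-W)/2+1)) % W)

theorem pp_sum (W σ r : ℤ) : (pp W σ r).1 + (pp W σ r).2 = σ := by simp [pp]

theorem pp_mod (W σ r : ℤ) : W ∣ (pp W σ r).2 - r := by
  simp only [pp]
  have := Int.emod_add_mul_ediv (r - ((σ-W)/2+1)) W
  exact ⟨-((r - ((σ-W)/2+1)) / W), by linarith⟩

theorem pp_u {W : ℤ} (hW : 1 ≤ W) (σ r : ℤ) :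
    -W ≤ (pp W σ r).1 - (pp W σ r).2 ∧ (pp W σ r).1 - (pp W σ r).2 < W := by
  simp only [pp]
  have h1 := Int.emod_nonneg (r - ((σ-W)/2+1)) (show W ≠ 0 by omega)
  have h2 := Int.emod_lt_of_pos (r - ((σ-W)/2+1)) (show 0 < W by omega)
  generalize (r - ((σ-W)/2+1)) % W = k at *
  omega

theorem pp_uniq {W : ℤ} (hW : 1 ≤ W) {x y r : ℤ} (h1 : -W ≤ x - y) (h2 : x - y < W) (h3 : W ∣ y - r) :
    (x, y) = pp W (x+y) r := by
  have a := pp_sum W (x+y) r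
  have b := pp_mod W (x+y) r
  have c := pp_u hW (x+y) r
  have d : W ∣ (pp W (x+y) r).2 - y := by
    have := dvd_sub b h3; simpa using this
  have : (pp W (x+y) r).2 - y = 0 := by
    apply Int.eq_zero_of_abs_lt_dvd d
    rw [abs_lt]; constructor <;> omega
  ext <;> simp <;> omega

theorem pp_congr {W : ℤ} (σ : ℤ) {r r' : ℤ} (h : r ≡ r' [ZMOD W]) : pp W σ r = pp W σ r' := by
  have : (r - ((σ-W)/2+1)) % W = (r' - ((σ-W)/2+1)) % W := h.sub_right _
  simp only [pp, this]

theorem Ctx.pp_zn (c : Ctx e f v K w W lam eps) {σ : ℤ} (h : InR e f w W lam eps σ) (r : ℤ) :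
    Zn e f w W lam eps (pp W σ r).1 (pp W σ r).2 := by
  obtain ⟨a, b⟩ := pp_u c.S1.facts.2.2.1 σ r
  have d : (((pp W σ r).1:ℝ) + (pp W σ r).2) = σ := by exact_mod_cast pp_sum W σ r
  refine ⟨a, b, ?_, ?_⟩ <;> rw [d]
  · exact h.1
  · exact h.2

theorem zn_inR {x y : ℤ} (Z : Zn e f w W lam eps x y) : InR e f w W lam eps (x+y) := by
  refine ⟨?_, ?_⟩ <;> push_cast
  · exact Z.lo
  · exact Z.hi

theorem Ctx.pp_range (c : Ctx e f v K w W lam eps) {σ : ℤ} (h : InR e f w W lam eps σ) (r : ℤ) :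
    0 ≤ yE lam K (pp W σ r) ∧ yE lam K (pp W σ r) < K := c.yE_range (c.pp_zn h r)

/-- Comparison of two transits. -/
theorem Ctx.pair (c : Ctx e f v K w W lam eps) (hwv : w < v) {σ σ' r r' : ℤ}
    (h : InR e f w W lam eps σ) (h' : InR e f w W lam eps σ')
    (hQ : ∀ t t', IsT e f t → IsT e f t' → t < t' → t' < v → (2*t+1)*(2*t'+1) ∣ W * (σ' - σ))
    (hH : f ≤ (w+1)^2+w^2 → W ∣ r' - r)
    (hV : (w+1)^2+w^2 ≤ e → W ∣ (σ' - r') - (σ - r)) :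
    ∃ t s, IsT e f t ∧ t < v ∧ (2*t+1)*s = W * (σ' - σ) ∧
      yE lam K (pp W σ' r') ≡ yE lam K (pp W σ r) + s [ZMOD K] := by
  have Z := c.pp_zn h r
  have Z' := c.pp_zn h' r'
  obtain ⟨i, X, Y, D, hy⟩ := c.ze Z
  obtain ⟨i', X', Y', D', hy'⟩ := c.ze Z'
  have hs := pp_sum W σ r
  have hs' := pp_sum W σ' r'
  have hm := pp_mod W σ r
  have hm' := pp_mod W σ' r'
  have hW := c.S1.hW
  have hy2 : yE lam K (pp W σ r) = Y := hy
  have hy2' : yE lam K (pp W σ' r') = Y' := hy'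
  rw [hy2, hy2']
  have key := pair_lemma c.S D.sp (W * (σ' - σ)) hQ ((pp W σ r).2 + (pp W σ' r').2).toNat
    D.g D'.g le_rfl hwv (by
      rw [← hW]; linear_combination W * hs' - W * hs)
    (fun hh => by
      have := dvd_add (dvd_sub hm' hm) (hH hh)
      rw [← hW]
      have e1 : (pp W σ' r').2 - (pp W σ r).2
        = ((pp W σ' r').2 - r') - ((pp W σ r).2 - r) + (r' - r) := by ring
      rw [e1]; exact this)
    (fun hh => by
      have := dvd_add (dvd_sub hm hm') (hV hh)
      rw [← hW]
      have e1 : (pp W σ' r').1 - (pp W σ r).1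
        = ((pp W σ r).2 - r) - ((pp W σ' r').2 - r') + ((σ' - r') - (σ - r)) := by linarith
      rw [e1]; exact this)
    D.E D'.E (Int.self_le_toNat _)
  exact key

/-- `K ∣ 2Y - v` characterises the fixed line. -/
theorem Ystar_iff (v0 : 0 ≤ v) (hK : K = 2*v+1) {Y : ℤ} (h0 : 0 ≤ Y) (h1 : Y < K) :
    (2*Y = v ∨ 2*Y = 3*v+1) ↔ K ∣ 2*Y - v := by
  constructor
  · rintro (h | h)
    · rw [h]; simp
    · exact ⟨1, by omega⟩
  · rintro ⟨k, hk⟩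
    have k1 : -1 < k := by
      by_contra h; push Not at h
      have : K * k ≤ K * (-1) := mul_le_mul_of_nonneg_left h (by omega)
      omega
    have k2 : k < 2 := by
      by_contra h; push Not at h
      have : K * 2 ≤ K * k := mul_le_mul_of_nonneg_left h (by omega)
      omega
    have : k = 0 ∨ k = 1 := by omega
    rcases this with rfl | rfl <;> omega

/-- The symmetric fixed points in the zone. -/
theorem Ctx.fix_iff (c : Ctx e f v K w W lam eps) {x y : ℤ} (Z : Zn e f w W lam eps x y) :
    (Phi lam (x,y) = (x,y) ∧ Gmap '' orbitSet lam (x,y) = orbitSet lam (x,y)) ↔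
    (W ∣ y - (x+y)*(w+1) ∧ K ∣ 2 * yE lam K (x,y) - v) := by
  obtain ⟨i, X, Y, D, h⟩ := c.ze Z
  have hr := c.yE_range Z
  rw [h] at hr ⊢
  rw [← Ystar_iff c.S.v0 c.S.hK hr.1 hr.2]
  have hW := c.S1.hW
  have hw := c.S1.w0
  have e1 : W ∣ y - (x+y)*(w+1) ↔ (x = y ∨ x - y = -W) := by
    have e2 : (y - (x+y)*(w+1)) = -(x-y)*(w+1) + (-y)*W := by rw [hW]; ring
    have e3 : (x - y) = (x-y)*(w+1)*2 + (-(x-y))*W := by rw [hW]; ring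
    constructor
    · intro hd
      have a1 : W ∣ (x-y)*(w+1) := by
        have := dvd_sub (Dvd.intro_left (-y) rfl : W ∣ (-y)*W) hd
        have e4 : (x-y)*(w+1) = (-y)*W - (y - (x+y)*(w+1)) := by rw [e2]; ring
        rw [e4]; exact this
      have a2 : W ∣ x - y := by
        rw [e3]; exact dvd_add (a1.mul_right 2) (Dvd.intro_left _ rfl)
      obtain ⟨k, hk⟩ := a2
      have u1 := Z.u1; have u2 := Z.u2
      have k1 : -2 < k := by
        by_contra h; push Not at h
        have : W * k ≤ W * (-2) := mul_le_mul_of_nonneg_left h (by omega)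
        omega
      have k2 : k < 1 := by
        by_contra h; push Not at h
        have : W * 1 ≤ W * k := mul_le_mul_of_nonneg_left h (by omega)
        omega
      have : k = 0 ∨ k = -1 := by omega
      rcases this with rfl | rfl <;> omega
    · intro hd
      rw [e2]
      refine dvd_add ?_ (Dvd.intro_left _ rfl)
      rcases hd with hd | hd
      · rw [hd]; simp
      · rw [hd]; exact ⟨w+1, by ring⟩
  rw [e1]
  constructor
  · rintro ⟨a, b⟩; exact D.of_fixed a b
  · rintro ⟨a, b⟩; exact D.fixed_of a b

end

/-! ### Averaging over the zone -/

/-- indicator of the fixed line, periodic mod `K` -/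
def ind (K v y : ℤ) : ℤ := if K ∣ 2*y - v then 1 else 0

theorem ind_nonneg (K v y : ℤ) : 0 ≤ ind K v y := by unfold ind; split_ifs <;> simp

theorem ind_le (K v y : ℤ) : ind K v y ≤ 1 := by unfold ind; split_ifs <;> simp

theorem ind_congr (K v : ℤ) {x y : ℤ} (h : x ≡ y [ZMOD K]) : ind K v x = ind K v y := by
  have h1 : K ∣ y - x := h.dvd
  have : K ∣ 2*x - v ↔ K ∣ 2*y - v := by
    constructor
    · intro h2
      have := dvd_add h2 (h1.mul_left 2)
      have e1 : 2*y - v = 2*x - v + 2*(y-x) := by ring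
      rw [e1]; exact this
    · intro h2
      have := dvd_sub h2 (h1.mul_left 2)
      have e1 : 2*x - v = 2*y - v - 2*(y-x) := by ring
      rw [e1]; exact this
  simp only [ind, this]

theorem ind_star {K v : ℤ} (v0 : 0 ≤ v) (hK : K = 2*v+1) :
    ∃ y0 : ℤ, 0 ≤ y0 ∧ y0 < K ∧ ∀ y, 0 ≤ y → y < K → (K ∣ 2*y - v ↔ y = y0) := by
  refine ⟨(v*(v+1)) % K, Int.emod_nonneg _ (by omega), Int.emod_lt_of_pos _ (by omega), ?_⟩
  intro y h0 h1
  have hc : y = (v*(v+1)) % K ↔ K ∣ y - v*(v+1) := by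
    constructor
    · intro h
      rw [h]
      have := Int.emod_add_mul_ediv (v*(v+1)) K
      exact ⟨-((v*(v+1)) / K), by linarith⟩
    · intro h
      have : y % K = (v*(v+1)) % K := 
        Int.emod_eq_emod_iff_emod_sub_eq_zero.mpr (Int.emod_eq_zero_of_dvd h)
      rw [← this, Int.emod_eq_of_lt h0 h1]
  rw [hc]
  constructor
  · intro h
    have := dvd_sub (h.mul_left (v+1)) (Dvd.intro y rfl : K ∣ K*y)
    have e1 : y - v*(v+1) = (v+1)*(2*y-v) - K*y := by rw [hK]; ring
    rw [e1]; exact this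
  · intro h
    have := dvd_add (h.mul_left 2) (Dvd.intro v rfl : K ∣ K*v)
    have e1 : 2*y - v = 2*(y - v*(v+1)) + K*v := by rw [hK]; ring
    rw [e1]; exact this

theorem sum_ind {K v : ℤ} (v0 : 0 ≤ v) (hK : K = 2*v+1) :
    ∑ i ∈ Finset.range K.toNat, ind K v i = 1 := by
  obtain ⟨y0, h0, h1, h2⟩ := ind_star v0 hK
  rw [Finset.sum_eq_single y0.toNat]
  · rw [Int.toNat_of_nonneg h0, ind, if_pos ((h2 y0 h0 h1).2 rfl)]
  · intro b hb hne
    rw [Finset.mem_range] at hb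
    rw [ind, if_neg]
    rw [h2 b (by omega) (by omega)]
    omega
  · intro h
    exfalso; apply h; rw [Finset.mem_range]; omega

section
variable {e f v K w W : ℤ} {lam eps : ℝ}

/-- indicator that the symmetric candidate on the row `σ` is fixed -/
noncomputable def phi (lam : ℝ) (K v w W : ℤ) (σ : ℤ) : ℤ := ind K v (yE lam K (pp W σ (σ*(w+1))))

theorem Ctx.caseK (c : Ctx e f v K w W lam eps) (hwv : w < v) {lo hi : ℤ}
    (hR : ∀ σ, lo ≤ σ → σ ≤ hi → InR e f w W lam eps σ)
    {P : ℤ} (hP : ∀ t, IsT e f t → t < v → (2*t+1) ∣ P) (hWP : W ∣ P)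
    (cop : IsCoprime K P) :
    |K * ∑ σ ∈ Finset.Icc lo hi, phi lam K v w W σ - ∑ _σ ∈ Finset.Icc lo hi, 1| ≤ P^2*K*K := by
  have hK := c.S.hK
  have v0 := c.S.v0
  have hKn : (K.toNat : ℤ) = K := Int.toNat_of_nonneg (by omega)
  have := count_lemma lo hi (P^2) K.toNat (by positivity) (phi lam K v w W) (fun _ => 1)
    (fun x => ind_nonneg _ _ _) (fun x => ind_le _ _ _) (fun _ => by simp) (fun _ => by omega) ?_
  · rwa [hKn] at this
  intro σ h1 h2
  rw [hKn] at h2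
  have key : ∀ i < K.toNat, InR e f w W lam eps (σ + P^2 * i) := by
    intro i hi'
    have h3 : (i:ℤ) ≤ K := by omega
    have h4 : P^2 * (i:ℤ) ≤ P^2 * K := mul_le_mul_of_nonneg_left h3 (by positivity)
    have h5 : 0 ≤ P^2 * (i:ℤ) := by positivity
    exact hR _ (by omega) (by omega)
  have := perm_residues K.toNat
    (fun i => yE lam K (pp W (σ + P^2 * i) ((σ + P^2 * i)*(w+1)))) ?_ (ind K v) ?_
  · unfold phi
    rw [this, sum_ind v0 hK]
  · intro i hi' j hj hd
    rw [hKn] at hd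
    have hw2 : ∀ x : ℤ, W ∣ P^2 * x := fun x => (Dvd.dvd.mul_right (dvd_pow hWP two_ne_zero) x)
    obtain ⟨t, s, ht, htv, hs, hmod⟩ := c.pair hwv (r := (σ + P^2 * i)*(w+1)) (r' := (σ + P^2 * j)*(w+1))
      (key i hi') (key j hj)
      (fun t t' ht ht' a b => by
        have := mul_dvd_mul (hP t ht (by omega)) (hP t' ht' b)
        have e1 : W * ((σ + P^2 * j) - (σ + P^2 * i)) = P * P * (W * (j - i)) := by ring
        rw [e1]; exact this.mul_right _)
      (fun _ => by
        have e1 : (σ + P^2 * j)*(w+1) - (σ + P^2 * i)*(w+1) = P^2 * ((j - i)*(w+1)) := by ring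
        rw [e1]; exact hw2 _)
      (fun _ => by
        have e1 : (σ + P^2 * j) - (σ + P^2 * j)*(w+1) - ((σ + P^2 * i) - (σ + P^2 * i)*(w+1))
          = P^2 * ((i - j)*w) := by ring
        rw [e1]; exact hw2 _)
    have h3 := hmod.dvd
    have h4 : K ∣ s := by
      have := dvd_add h3 hd
      have e1 : s = yE lam K (pp W (σ + P^2 * i) ((σ + P^2 * i)*(w+1))) + s
        - yE lam K (pp W (σ + P^2 * j) ((σ + P^2 * j)*(w+1)))
        + (yE lam K (pp W (σ + P^2 * j) ((σ + P^2 * j)*(w+1)))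
          - yE lam K (pp W (σ + P^2 * i) ((σ + P^2 * i)*(w+1)))) := by ring
      rw [e1]; exact this
    have h5 : K ∣ (W * P^2) * (j - i) := by
      have e1 : (W * P^2) * (j - i) = (2*t+1)*s := by rw [hs]; ring
      rw [e1]; exact h4.mul_left _
    have cW : IsCoprime K W := cop.of_isCoprime_of_dvd_right hWP
    have h6 : K ∣ (j:ℤ) - i := (cW.mul_right (cop.pow_right)).dvd_of_dvd_mul_left h5
    have : (j:ℤ) - i = 0 := by
      apply Int.eq_zero_of_abs_lt_dvd h6
      rw [abs_lt]; constructor <;> omega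
    omega
  · intro x y h
    rw [hKn] at h
    exact ind_congr K v h

open Classical in
/-- the points of row `σ`, indexed so that parallel transport preserves the index -/
noncomputable def qq (f w W σ r : ℤ) : ℤ × ℤ := pp W σ (if f ≤ (w+1)^2+w^2 then r else σ - r)

theorem qq_congr {f w W : ℤ} (σ : ℤ) {r r' : ℤ} (h : r ≡ r' [ZMOD W]) : qq f w W σ r = qq f w W σ r' := by
  unfold qq
  apply pp_congr
  split_ifs
  · exact h
  · exact Int.ModEq.sub_left σ h

theorem qq_cand {f w W : ℤ} (hW : W = 2*w+1) (σ : ℤ) : qq f w W σ (σ*(w+1)) = pp W σ (σ*(w+1)) := by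
  unfold qq
  apply pp_congr
  split_ifs
  · rfl
  · apply Int.ModEq.symm
    rw [Int.modEq_iff_dvd, hW]
    exact ⟨-σ, by ring⟩

theorem Ctx.case1 (c : Ctx e f v K w W lam eps) {lo hi : ℤ}
    (hR : ∀ σ, lo ≤ σ → σ ≤ hi → InR e f w W lam eps σ)
    {P : ℤ} (cop : IsCoprime W P)
    (inv : ∀ σ r, ∀ i : ℕ, InR e f w W lam eps σ → InR e f w W lam eps (σ + P^2*i) →
      yE lam K (qq f w W (σ + P^2*i) r) ≡ yE lam K (qq f w W σ r) [ZMOD K]) :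
    |W * ∑ σ ∈ Finset.Icc lo hi, phi lam K v w W σ -
      ∑ σ ∈ Finset.Icc lo hi, ∑ r ∈ Finset.range W.toNat, ind K v (yE lam K (qq f w W σ r))| ≤ P^2*W*W := by
  have hW := c.S1.hW
  have w0 := c.S1.w0
  have hWn : (W.toNat : ℤ) = W := Int.toNat_of_nonneg (by omega)
  have := count_lemma lo hi (P^2) W.toNat (by positivity) (phi lam K v w W)
    (fun σ => ∑ r ∈ Finset.range W.toNat, ind K v (yE lam K (qq f w W σ r)))
    (fun x => ind_nonneg _ _ _) (fun x => ind_le _ _ _)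
    (fun _ => Finset.sum_nonneg (fun _ _ => ind_nonneg _ _ _))
    (fun σ => by
      refine (Finset.sum_le_sum (fun r _ => ind_le K v _)).trans ?_
      simp) ?_
  · rwa [hWn] at this
  intro σ h1 h2
  rw [hWn] at h2
  have key : ∀ i < W.toNat, InR e f w W lam eps (σ + P^2 * i) := by
    intro i hi'
    have h3 : (i:ℤ) ≤ W := by omega
    have h4 : P^2 * (i:ℤ) ≤ P^2 * W := mul_le_mul_of_nonneg_left h3 (by positivity)
    have h5 : 0 ≤ P^2 * (i:ℤ) := by positivity
    exact hR _ (by omega) (by omega)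
  have k0 : InR e f w W lam eps σ := by
    have := key 0 (by omega); simpa using this
  have e1 : ∀ i ∈ Finset.range W.toNat, phi lam K v w W (σ + P^2*i)
      = ind K v (yE lam K (qq f w W σ ((σ + P^2*i)*(w+1)))) := by
    intro i hi'
    rw [Finset.mem_range] at hi'
    unfold phi
    rw [← qq_cand (f := f) hW]
    exact ind_congr K v (inv σ _ i k0 (key i hi'))
  rw [Finset.sum_congr rfl e1]
  refine perm_residues W.toNat (fun i => (σ + P^2*i)*(w+1)) ?_
    (fun r => ind K v (yE lam K (qq f w W σ r))) ?_
  · intro i hi' j hj hd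
    rw [hWn] at hd
    have h5 : W ∣ (P^2 * (w+1)) * (j - i) := by
      have e1 : (P^2 * (w+1)) * (j - i) = (σ + P^2 * j)*(w+1) - (σ + P^2 * i)*(w+1) := by ring
      rw [e1]; exact hd
    have cw : IsCoprime W (w+1) := ⟨-1, 2, by rw [hW]; ring⟩
    have h6 : W ∣ (j:ℤ) - i := (cop.pow_right.mul_right cw).dvd_of_dvd_mul_left h5
    have : (j:ℤ) - i = 0 := by
      apply Int.eq_zero_of_abs_lt_dvd h6
      rw [abs_lt]; constructor <;> omega
    omega
  · intro x y h
    rw [hWn] at h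
    simp only [qq_congr σ h]

theorem Ctx.inv (c : Ctx e f v K w W lam eps) {P : ℤ}
    (hP : ∀ t, IsT e f t → t ≠ w → (2*t+1) ∣ P) (hv : IsT e f v) :
    ∀ σ r, ∀ i : ℕ, InR e f w W lam eps σ → InR e f w W lam eps (σ + P^2*i) →
      yE lam K (qq f w W (σ + P^2*i) r) ≡ yE lam K (qq f w W σ r) [ZMOD K] := by
  intro σ r i h h'
  have hK := c.S.hK
  have hW := c.S1.hW
  have w0 := c.S1.w0
  rcases c.wv.lt_or_eq with hwv | hwv
  · have KP : K ∣ P := by rw [hK]; exact hP v hv (by omega)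
    obtain ⟨t, s, ht, htv, hs, hmod⟩ := c.pair hwv
      (r := if f ≤ (w+1)^2+w^2 then r else σ - r)
      (r' := if f ≤ (w+1)^2+w^2 then r else σ + P^2*i - r) h h'
      (fun t t' ht ht' a b => by
        have e1 : W * ((σ + P^2 * i) - σ) = (W * P) * (P * i) := by ring
        rw [e1]
        by_cases h1 : t = w
        · apply Dvd.dvd.mul_right
          apply mul_dvd_mul
          · rw [hW, h1]
          · exact hP t' ht' (by omega)
        · by_cases h2 : t' = w
          · apply Dvd.dvd.mul_right
            rw [mul_comm]
            apply mul_dvd_mul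
            · rw [hW, h2]
            · exact hP t ht h1
          · exact mul_dvd_mul ((hP t ht h1).mul_left _) ((hP t' ht' h2).mul_right _))
      (fun hh => by simp [hh])
      (fun hh => by
        have : ¬ (f ≤ (w+1)^2+w^2) := by have := c.S.hef; omega
        simp [this])
    have hKs : K ∣ s := by
      have tp : 2*t+1 ≠ 0 := by omega
      by_cases h1 : t = w
      · have : s = P^2 * i := by
          apply mul_left_cancel₀ tp
          rw [hs, h1, ← hW]; ring
        rw [this]
        exact Dvd.dvd.mul_right (dvd_pow KP two_ne_zero) _
      · obtain ⟨P', hP'⟩ := hP t ht h1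
        have : s = P * (P' * W * i) := by
          apply mul_left_cancel₀ tp
          rw [hs]
          have : P^2 = P * ((2*t+1)*P') := by rw [← hP']; ring
          rw [this]; ring
        rw [this]
        exact Dvd.dvd.mul_right KP _
    have : yE lam K (qq f w W (σ + P^2*i) r) ≡ yE lam K (qq f w W σ r) + s [ZMOD K] := by
      unfold qq; exact hmod
    refine this.trans ?_
    exact ((Int.ModEq.refl _).add (Int.modEq_zero_iff_dvd.2 hKs)).trans (by rw [add_zero])
  · have hf : f ≤ (w+1)^2+w^2 := by
      have := c.S.hf; rw [← hwv] at this; nlinarith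
    have hWK : W = K := by rw [hW, hK, hwv]
    have aux : ∀ σ, InR e f w W lam eps σ → yE lam K (qq f w W σ r) ≡ r [ZMOD K] := by
      intro σ h
      have hq : qq f w W σ r = pp W σ r := by unfold qq; rw [if_pos hf]
      rw [hq]
      have Z := c.pp_zn h r
      obtain ⟨j, X, Y, D, hy⟩ := c.ze Z
      have hy2 : yE lam K (pp W σ r) = Y := hy
      have g := D.g
      rw [hwv] at g
      have := col_end c.S D.sp g D.E
      rw [hy2]
      simp only at this
      rw [this]
      refine (Int.mod_modEq _ _).trans ?_
      have := pp_mod W σ r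
      rw [← hWK]
      exact (Int.modEq_iff_dvd.2 this).symm
    exact (aux _ h').trans (aux _ h).symm

end

/-! ### Equidistribution over end rows -/

theorem card_le_real {S : Finset ℤ} {A B : ℝ} (h : ∀ s ∈ S, A ≤ (s:ℝ) ∧ (s:ℝ) ≤ B) (hAB : 0 ≤ B - A + 1) :
    (S.card : ℝ) ≤ B - A + 1 := by
  have h1 : S ⊆ Finset.Icc ⌈A⌉ ⌊B⌋ := by
    intro s hs
    rw [Finset.mem_Icc]
    exact ⟨Int.ceil_le.2 (h s hs).1, Int.le_floor.2 (h s hs).2⟩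
  have h2 := Finset.card_le_card h1
  rw [Int.card_Icc] at h2
  have h3 : (S.card : ℝ) ≤ ((⌊B⌋ + 1 - ⌈A⌉).toNat : ℝ) := by exact_mod_cast h2
  refine h3.trans ?_
  have h4 : ((⌊B⌋ + 1 - ⌈A⌉).toNat : ℝ) = max ((⌊B⌋:ℝ) + 1 - ⌈A⌉) 0 := by
    have := Int.toNat_eq_max (⌊B⌋ + 1 - ⌈A⌉)
    have h5 : (((⌊B⌋ + 1 - ⌈A⌉).toNat : ℤ) : ℝ) = ((max (⌊B⌋ + 1 - ⌈A⌉) 0 : ℤ) : ℝ) := by rw [this]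
    push_cast at h5
    exact h5
  rw [h4]
  have := Int.floor_le B
  have := Int.le_ceil A
  exact max_le (by linarith) hAB

theorem card_Icc_ge (A B : ℝ) : B - A - 1 ≤ ((Finset.Icc ⌈A⌉ ⌊B⌋).card : ℝ) := by
  rw [Int.card_Icc]
  have h : (⌊B⌋ + 1 - ⌈A⌉ : ℤ) ≤ ((⌊B⌋ + 1 - ⌈A⌉).toNat : ℤ) := Int.self_le_toNat _
  have h' : ((⌊B⌋ + 1 - ⌈A⌉ : ℤ) : ℝ) ≤ ((⌊B⌋ + 1 - ⌈A⌉).toNat : ℝ) := by exact_mod_cast h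
  push_cast at h'
  have := Int.lt_floor_add_one B
  have := Int.ceil_lt_add_one A
  linarith

open Classical in
/-- The `x`-coordinate of the end point of the transit. -/
noncomputable def xE (lam : ℝ) (K : ℤ) (p : ℤ × ℤ) : ℤ :=
  if h : ∃ q : ℤ × ℤ, ∃ i, EndAt lam K p i q then h.choose.1 else 0

theorem xE_eq {lam : ℝ} {K : ℤ} {p q : ℤ × ℤ} {i : ℕ} (h : EndAt lam K p i q) : xE lam K p = q.1 := by
  have h' : ∃ q : ℤ × ℤ, ∃ i, EndAt lam K p i q := ⟨q, i, h⟩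
  unfold xE
  rw [dif_pos h']
  obtain ⟨j, hj⟩ := h'.choose_spec
  rw [(endAt_unique hj h).2]

section
variable {e f v K w W : ℤ} {lam eps : ℝ}

theorem end_inj_aux {x y x' y' X Y : ℤ} {i i' : ℕ} (D : ZE e f v K w W lam eps x y i X Y)
    (D' : ZE e f v K w W lam eps x' y' i' X Y) (h : i ≤ i') : (x, y) = (x', y') := by
  have h1 := D.E.1
  have h2 := D'.E.1
  obtain ⟨d, rfl⟩ := Nat.exists_eq_add_of_le h
  rw [pow_add] at h2
  change ((Fe lam ^ 4)^i) (((Fe lam ^ 4)^d) (x', y')) = (X, Y) at h2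
  rw [← h1] at h2
  have h3 := ((Fe lam ^ 4)^i).injective h2
  rcases Nat.eq_zero_or_pos d with rfl | hd
  · simpa using h3.symm
  · have := D'.u_ge d hd (by omega)
    rw [h3] at this
    have := D.Z.u2
    simp only at *
    omega

theorem end_inj {x y x' y' X Y : ℤ} {i i' : ℕ} (D : ZE e f v K w W lam eps x y i X Y)
    (D' : ZE e f v K w W lam eps x' y' i' X Y) : (x, y) = (x', y') := by
  rcases le_total i i' with h | h
  · exact end_inj_aux D D' h
  · exact (end_inj_aux D' D h).symm

theorem qq_zn (c : Ctx e f v K w W lam eps) {σ : ℤ} (h : InR e f w W lam eps σ) (r : ℤ) :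
    Zn e f w W lam eps (qq f w W σ r).1 (qq f w W σ r).2 := c.pp_zn h _

theorem qq_inj {σ σ' : ℤ} {r r' : ℕ} (hr : (r:ℤ) < W) (hr' : (r':ℤ) < W)
    (h : qq f w W σ r = qq f w W σ' r') : σ = σ' ∧ r = r' := by
  unfold qq at h
  have a := pp_sum W σ (if f ≤ (w+1)^2+w^2 then (r:ℤ) else σ - r)
  have b := pp_sum W σ' (if f ≤ (w+1)^2+w^2 then (r':ℤ) else σ' - r')
  rw [h] at a
  have hs : σ = σ' := a.symm.trans b
  subst hs
  refine ⟨rfl, ?_⟩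
  have a := pp_mod W σ (if f ≤ (w+1)^2+w^2 then (r:ℤ) else σ - r)
  have b := pp_mod W σ (if f ≤ (w+1)^2+w^2 then (r':ℤ) else σ - r')
  rw [h] at a
  have d := dvd_sub a b
  have d' : W ∣ (r:ℤ) - r' := by
    split_ifs at d
    · have d2 := (dvd_neg.2 d)
      have e1 : ∀ z : ℤ, (r:ℤ) - r' = -(z - r - (z - r')) := fun z => by ring
      rw [e1]; exact d2
    · have e1 : ∀ z : ℤ, (r:ℤ) - r' = (z - (σ - r) - (z - (σ - r'))) := fun z => by ring
      rw [e1]; exact d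
  have := Int.eq_zero_of_abs_lt_dvd d' (by rw [abs_lt]; constructor <;> omega)
  omega

open Classical in
theorem Ctx.row_bound (c : Ctx e f v K w W lam eps) (h2e : 2*eps ≤ 1) {lo hi : ℤ}
    (hR : ∀ σ, lo ≤ σ → σ ≤ hi → InR e f w W lam eps σ) (Y : ℤ) :
    (K:ℝ) * (((Finset.Icc lo hi ×ˢ Finset.range W.toNat).filter
      (fun p => yE lam K (qq f w W p.1 p.2) = Y)).card : ℝ) ≤ (f-e-2*eps)/lam + K*(8*v+1) := by
  set T := (Finset.Icc lo hi ×ˢ Finset.range W.toNat).filter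
      (fun p => yE lam K (qq f w W p.1 p.2) = Y) with hT
  have hl := c.s.hl
  have K1 : 1 ≤ K := by have := c.S.hK; have := c.S.v0; omega
  have K1r : (1:ℝ) ≤ K := by exact_mod_cast K1
  have v0 : (0:ℝ) ≤ v := by exact_mod_cast c.S.v0
  have hK : (K:ℝ) = 2*v+1 := by exact_mod_cast c.S.hK
  have hef : (e:ℝ) + 1 ≤ f := by exact_mod_cast c.S.hef
  have kl : 0 < K * lam := by positivity
  have hmem : ∀ p ∈ T, InR e f w W lam eps p.1 ∧ (p.2:ℤ) < W ∧ yE lam K (qq f w W p.1 p.2) = Y := by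
    intro p hp
    rw [hT, Finset.mem_filter, Finset.mem_product, Finset.mem_Icc, Finset.mem_range] at hp
    exact ⟨hR _ hp.1.1.1 hp.1.1.2, by omega, hp.2⟩
  have hinj : Set.InjOn (fun p : ℤ × ℕ => xE lam K (qq f w W p.1 p.2)) T := by
    intro p hp p' hp' hx
    obtain ⟨a1, a2, a3⟩ := hmem p hp
    obtain ⟨b1, b2, b3⟩ := hmem p' hp'
    obtain ⟨i, X1, Y1, D, hy⟩ := c.ze (qq_zn c a1 p.2)
    obtain ⟨i', X1', Y1', D', hy'⟩ := c.ze (qq_zn c b1 p'.2)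
    have hx1 := xE_eq D.E
    have hx2 := xE_eq D'.E
    simp only [Prod.mk.eta] at hy hy' hx1 hx2 hx
    have e1 : X1 = X1' := by rw [← hx1, ← hx2, hx]
    have e2 : Y1 = Y1' := by rw [← hy, ← hy', a3, b3]
    subst e1; subst e2
    have := end_inj D D'
    simp only [Prod.mk.eta] at this
    obtain ⟨h1, h2⟩ := qq_inj a2 b2 this
    exact Prod.ext h1 h2
  have hc := Finset.card_image_of_injOn hinj
  have hb := card_le_real (S := T.image (fun p : ℤ × ℕ => xE lam K (qq f w W p.1 p.2)))
    (A := (e+eps-4*(lam*K*v)+v^2+v-lam*Y)/(K*lam)) (B := (f-eps+4*(lam*K*v)+v^2+v-lam*Y)/(K*lam)) ?_ ?_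
  · rw [hc] at hb
    have hm := mul_le_mul_of_nonneg_left hb (by linarith : (0:ℝ) ≤ K)
    refine hm.trans (le_of_eq ?_)
    field_simp
    ring
  · intro X hX
    rw [Finset.mem_image] at hX
    obtain ⟨p, hp, rfl⟩ := hX
    obtain ⟨a1, a2, a3⟩ := hmem p hp
    obtain ⟨i, X1, Y1, D, hy⟩ := c.ze (qq_zn c a1 p.2)
    have hx1 := xE_eq D.E
    simp only [Prod.mk.eta] at hy hx1
    rw [hx1]
    have e2 : Y1 = Y := by rw [← hy, a3]
    subst e2
    have G := D.gE
    have lo := G.lo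
    have hi := G.hi
    push_cast at lo hi
    rw [← hK] at lo hi
    constructor
    · rw [div_le_iff₀ kl]; nlinarith
    · rw [le_div_iff₀ kl]; nlinarith
  · rw [← sub_div]
    have : 0 ≤ (f-eps+4*(lam*K*v)+v^2+v-lam*Y - (e+eps-4*(lam*K*v)+v^2+v-lam*Y) : ℝ) := by
      have : 0 ≤ lam*K*v := by positivity
      linarith
    have := div_nonneg this kl.le
    linarith

open Classical in
theorem Ctx.row_count (c : Ctx e f v K w W lam eps) (h2e : 2*eps ≤ 1) {lo hi : ℤ}
    (hR : ∀ σ, lo ≤ σ → σ ≤ hi → InR e f w W lam eps σ)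
    (h1 : |(W:ℝ) * ((Finset.Icc lo hi).card:ℝ) - (f-e-2*eps)/lam| ≤ W) :
    |(K:ℝ) * ((∑ σ ∈ Finset.Icc lo hi, ∑ r ∈ Finset.range W.toNat,
      ind K v (yE lam K (qq f w W σ r)) : ℤ) : ℝ) - (f-e-2*eps)/lam| ≤ K*(W+K*(8*v+1)) := by
  obtain ⟨y0, h0, h0K, hy0⟩ := ind_star c.S.v0 c.S.hK
  have W1 := c.S1.facts.2.2.1
  have hWn : (W.toNat : ℤ) = W := Int.toNat_of_nonneg (by omega)
  have K1 : 1 ≤ K := by have := c.S.hK; have := c.S.v0; omega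
  have hKn : (K.toNat : ℤ) = K := Int.toNat_of_nonneg (by omega)
  set U := Finset.Icc lo hi ×ˢ Finset.range W.toNat with hU
  have hUm : ∀ p ∈ U, InR e f w W lam eps p.1 := by
    intro p hp
    rw [hU, Finset.mem_product, Finset.mem_Icc] at hp
    exact hR _ hp.1.1 hp.1.2
  have hn1 : ∑ σ ∈ Finset.Icc lo hi, ∑ r ∈ Finset.range W.toNat,
      ind K v (yE lam K (qq f w W σ r)) = ((U.filter (fun p => yE lam K (qq f w W p.1 p.2) = y0)).card : ℤ) := by
    rw [Finset.card_filter, ← Finset.sum_product']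
    push_cast
    apply Finset.sum_congr rfl
    intro p hp
    have := c.pp_range (hUm p hp) (if f ≤ (w+1)^2+w^2 then (p.2:ℤ) else p.1 - p.2)
    have := hy0 _ this.1 this.2
    unfold ind
    simp only [qq, this]
    split_ifs <;> rfl
  rw [hn1]
  have hsum : U.card = ∑ Y ∈ Finset.range K.toNat,
      (U.filter (fun p => yE lam K (qq f w W p.1 p.2) = (Y:ℤ))).card := by
    rw [Finset.card_eq_sum_card_fiberwise (f := fun p => (yE lam K (qq f w W p.1 p.2)).toNat)
      (t := Finset.range K.toNat)]
    · apply Finset.sum_congr rfl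
      intro Y hY
      congr 1
      apply Finset.filter_congr
      intro p hp
      have := c.pp_range (hUm p hp) (if f ≤ (w+1)^2+w^2 then (p.2:ℤ) else p.1 - p.2)
      have h2 : 0 ≤ yE lam K (qq f w W p.1 p.2) := this.1
      omega
    · intro p hp
      have := c.pp_range (hUm p hp) (if f ≤ (w+1)^2+w^2 then (p.2:ℤ) else p.1 - p.2)
      have h2 : 0 ≤ yE lam K (qq f w W p.1 p.2) := this.1
      have h3 : yE lam K (qq f w W p.1 p.2) < K := this.2
      simp only [Finset.coe_range, Set.mem_Iio]
      omega
  have hUc : (U.card : ℝ) = W * ((Finset.Icc lo hi).card:ℝ) := by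
    rw [hU, Finset.card_product, Finset.card_range]
    have : ((W.toNat:ℤ):ℝ) = W := by rw [hWn]
    push_cast at this ⊢
    rw [this, mul_comm]
  have hmem : y0.toNat ∈ Finset.range K.toNat := by rw [Finset.mem_range]; omega
  rw [← Finset.add_sum_erase _ _ hmem, Int.toNat_of_nonneg h0] at hsum
  set n1 := (U.filter (fun p => yE lam K (qq f w W p.1 p.2) = y0)).card with hn1'
  set Lr := (f-e-2*eps)/lam with hLr
  have b1 := c.row_bound h2e hR y0
  rw [← hU, ← hn1', ← hLr] at b1
  have b2 : (K:ℝ) * ((∑ Y ∈ (Finset.range K.toNat).erase y0.toNat,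
      (U.filter (fun p => yE lam K (qq f w W p.1 p.2) = (Y:ℤ))).card : ℕ):ℝ) ≤ (K-1) * (Lr + K*(8*v+1)) := by
    push_cast
    rw [Finset.mul_sum]
    refine (Finset.sum_le_card_nsmul _ _ (Lr + K*(8*v+1)) (fun (Y:ℕ) _ => c.row_bound h2e hR (Y:ℤ))).trans ?_
    rw [Finset.card_erase_of_mem hmem, Finset.card_range, nsmul_eq_mul]
    apply le_of_eq
    have : ((K.toNat - 1 : ℕ) : ℤ) = K - 1 := by omega
    have : (((K.toNat - 1 : ℕ) : ℤ):ℝ) = K - 1 := by rw [this]; push_cast; ring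
    push_cast at this
    rw [← this]
  have hs' : (U.card:ℝ) = n1 + ((∑ Y ∈ (Finset.range K.toNat).erase y0.toNat,
      (U.filter (fun p => yE lam K (qq f w W p.1 p.2) = (Y:ℤ))).card : ℕ):ℝ) := by exact_mod_cast hsum
  generalize ((∑ Y ∈ (Finset.range K.toNat).erase y0.toNat,
      (U.filter (fun p => yE lam K (qq f w W p.1 p.2) = (Y:ℤ))).card : ℕ):ℝ) = n2 at hs' b2
  rw [abs_le] at h1
  rw [← hUc] at h1
  have K1r : (1:ℝ) ≤ K := by exact_mod_cast K1
  have W1r : (1:ℝ) ≤ W := by exact_mod_cast W1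
  have v0 : (0:ℝ) ≤ v := by exact_mod_cast c.S.v0
  push_cast
  have M0 : (0:ℝ) ≤ K*(8*v+1) := by positivity
  have M1 := mul_le_mul_of_nonneg_right K1r M0
  have M2 : 0 ≤ (K:ℝ) * W := by positivity
  have M3 := mul_le_mul_of_nonneg_left h1.1 (by linarith : (0:ℝ) ≤ K)
  rw [abs_le]
  constructor
  · have : (K:ℝ) * n1 = K * U.card - K * n2 := by rw [hs']; ring
    rw [this]
    nlinarith
  · nlinarith

end

/-! ### Counting symmetric fixed points in the zone -/

/-- points of `X` well inside the critical interval -/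
def ZoneSet (lam : ℝ) (a b : ℝ) : Set (ℤ × ℤ) :=
  {p | p ∈ Xset lam ∧ a ≤ ham (pt lam p) ∧ ham (pt lam p) ≤ b}

/-- symmetric fixed points -/
def SymFix (lam : ℝ) : Set (ℤ × ℤ) :=
  {p | Phi lam p = p ∧ Gmap '' orbitSet lam p = orbitSet lam p}

section
variable {e f v K w W : ℤ} {lam eps : ℝ}

theorem Ctx.range (c : Ctx e f v K w W lam eps) : ∃ lo hi : ℤ,
    (∀ σ, (lo ≤ σ ∧ σ ≤ hi) ↔ InR e f w W lam eps σ) ∧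
    ((2*eps ≤ 1) → |(W:ℝ) * ((Finset.Icc lo hi).card:ℝ) - (f-e-2*eps)/lam| ≤ W) := by
  have hl := c.s.hl
  have W1 : (1:ℝ) ≤ W := by exact_mod_cast c.S1.facts.2.2.1
  have wl : 0 < W * lam := by positivity
  refine ⟨⌈(e+eps+2*w*(w+1))/(W*lam)⌉, ⌊(f-eps+2*w*(w+1))/(W*lam)⌋, ?_, ?_⟩
  · intro σ
    rw [Int.ceil_le, Int.le_floor, div_le_iff₀ wl, le_div_iff₀ wl]
    unfold InR
    constructor <;> rintro ⟨a, b⟩ <;> constructor <;> linarith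
  · intro h2e
    have hef : (e:ℝ) + 1 ≤ f := by exact_mod_cast c.S.hef
    have h1 := card_Icc_ge ((e+eps+2*w*(w+1))/(W*lam)) ((f-eps+2*w*(w+1))/(W*lam))
    have e1 : ((f-eps+2*w*(w+1))/(W*lam) - (e+eps+2*w*(w+1))/(W*lam) : ℝ) = (f-e-2*eps)/lam/W := by
      field_simp; ring
    have h2 := card_le_real (S := Finset.Icc ⌈(e+eps+2*w*(w+1))/(W*lam)⌉ ⌊(f-eps+2*w*(w+1))/(W*lam)⌋)
      (A := (e+eps+2*w*(w+1))/(W*lam)) (B := (f-eps+2*w*(w+1))/(W*lam)) (fun s hs => by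
        rw [Finset.mem_Icc, Int.ceil_le, Int.le_floor] at hs; exact hs) (by
        rw [e1]
        have : 0 ≤ ((f-e-2*eps)/lam/W:ℝ) := by
          apply div_nonneg (div_nonneg (by linarith) hl.le) (by linarith)
        linarith)
    rw [e1] at h1 h2
    have e2 : (W:ℝ) * ((f-e-2*eps)/lam/W) = (f-e-2*eps)/lam := by field_simp
    have h3 := mul_le_mul_of_nonneg_left h1 (by linarith : (0:ℝ) ≤ W)
    have h4 := mul_le_mul_of_nonneg_left h2 (by linarith : (0:ℝ) ≤ W)
    rw [mul_sub, e2] at h3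
    rw [mul_add (W:ℝ) ((f-e-2*eps)/lam/W) 1, e2] at h4
    rw [abs_le]; constructor <;> linarith

theorem Ctx.zone_eq (c : Ctx e f v K w W lam eps) {lo hi : ℤ}
    (hR : ∀ σ, (lo ≤ σ ∧ σ ≤ hi) ↔ InR e f w W lam eps σ) :
    ZoneSet lam (e+eps) (f-eps) = ((Finset.Icc lo hi ×ˢ Finset.range W.toNat).image
      (fun p : ℤ × ℕ => pp W p.1 p.2) : Finset (ℤ × ℤ)) := by
  have W1 := c.S1.facts.2.2.1
  ext ⟨x, y⟩
  have h := zone_iff c.S1 c.s (X := x) (Y := y)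
  unfold ZoneSet
  rw [Set.mem_ofPred_eq, h]
  simp only [Finset.coe_image, Set.mem_image, Finset.mem_coe, Finset.mem_product, Finset.mem_Icc,
    Finset.mem_range]
  constructor
  · intro Z
    refine ⟨(x+y, (y % W).toNat), ⟨(hR _).2 (zn_inR Z), ?_⟩, ?_⟩
    · have := Int.emod_lt_of_pos y (show 0 < W by omega); omega
    · have h0 := Int.emod_nonneg y (show W ≠ 0 by omega)
      refine (pp_uniq W1 Z.u1 Z.u2 ?_).symm
      simp only
      rw [Int.toNat_of_nonneg h0]
      have := Int.emod_add_mul_ediv y W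
      exact ⟨y / W, by linarith⟩
  · rintro ⟨p, ⟨h1, h2⟩, h3⟩
    have := c.pp_zn ((hR _).1 h1) p.2
    rw [h3] at this
    exact this

theorem Ctx.zone_card (c : Ctx e f v K w W lam eps) {lo hi : ℤ}
    (hR : ∀ σ, (lo ≤ σ ∧ σ ≤ hi) ↔ InR e f w W lam eps σ) :
    ((ZoneSet lam (e+eps) (f-eps)).ncard : ℝ) = W * ((Finset.Icc lo hi).card:ℝ) := by
  have W1 := c.S1.facts.2.2.1
  have hWn : (W.toNat : ℤ) = W := Int.toNat_of_nonneg (by omega)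
  rw [c.zone_eq hR, Set.ncard_coe_finset, Finset.card_image_of_injOn, Finset.card_product, Finset.card_range]
  · have : ((W.toNat:ℤ):ℝ) = W := by rw [hWn]
    push_cast at this ⊢
    rw [this, mul_comm]
  · rintro ⟨σ, r⟩ h ⟨σ', r'⟩ h' hh
    simp only [Finset.coe_product, Set.mem_prod, Finset.mem_coe, Finset.mem_range] at h h'
    simp only at hh
    have a := pp_sum W σ r
    have b := pp_sum W σ' r'
    have am := pp_mod W σ r
    have bm := pp_mod W σ' r'
    rw [hh] at a am
    have d : W ∣ (r:ℤ) - r' := by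
      have := dvd_sub bm am
      have e1 : ∀ z : ℤ, (r:ℤ) - r' = z - r' - (z - r) := fun z => by ring
      rw [e1]; exact this
    have := Int.eq_zero_of_abs_lt_dvd d (by rw [abs_lt]; constructor <;> omega)
    have h1 : σ = σ' := a.symm.trans b
    have h2 : r = r' := by omega
    rw [h1, h2]

theorem Ctx.fix_card (c : Ctx e f v K w W lam eps) {lo hi : ℤ}
    (hR : ∀ σ, (lo ≤ σ ∧ σ ≤ hi) ↔ InR e f w W lam eps σ) :
    ((ZoneSet lam (e+eps) (f-eps) ∩ SymFix lam).ncard : ℤ) =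
      ∑ σ ∈ Finset.Icc lo hi, phi lam K v w W σ := by
  have W1 := c.S1.facts.2.2.1
  have he : ZoneSet lam (e+eps) (f-eps) ∩ SymFix lam =
      (((Finset.Icc lo hi).filter (fun σ => K ∣ 2 * yE lam K (pp W σ (σ*(w+1))) - v)).image
        (fun σ => pp W σ (σ*(w+1))) : Finset (ℤ × ℤ)) := by
    ext ⟨x, y⟩
    have h := zone_iff c.S1 c.s (X := x) (Y := y)
    unfold ZoneSet SymFix
    rw [Set.mem_inter_iff, Set.mem_ofPred_eq, h, Set.mem_ofPred_eq]
    simp only [Finset.coe_image, Set.mem_image, Finset.mem_coe, Finset.mem_filter, Finset.mem_Icc]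
    constructor
    · rintro ⟨Z, hf⟩
      rw [c.fix_iff Z] at hf
      have := pp_uniq W1 Z.u1 Z.u2 hf.1
      refine ⟨x+y, ⟨(hR _).2 (zn_inR Z), ?_⟩, this.symm⟩
      rw [← this]; exact hf.2
    · rintro ⟨σ, ⟨h1, h2⟩, h3⟩
      have Z := c.pp_zn ((hR _).1 h1) (σ*(w+1))
      have hm := pp_mod W σ (σ*(w+1))
      have hs := pp_sum W σ (σ*(w+1))
      rw [h3] at h2 Z hm hs
      simp only at Z hm hs
      refine ⟨Z, (c.fix_iff Z).2 ⟨?_, h2⟩⟩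
      rw [hs]; exact hm
  rw [he, Set.ncard_coe_finset, Finset.card_image_of_injOn, Finset.card_filter]
  · push_cast
    rfl
  · intro σ _ σ' _ hh
    simp only at hh
    have a := pp_sum W σ (σ*(w+1))
    have b := pp_sum W σ' (σ'*(w+1))
    rw [hh] at a
    exact a.symm.trans b

/-- The arithmetic hypothesis in a usable form. -/
def Arith (e f v K w W P : ℤ) : Prop :=
  (w < v ∧ (∀ t, IsT e f t → t < v → (2*t+1) ∣ P) ∧ W ∣ P ∧ IsCoprime K P) ∨
  (IsCoprime W P ∧ (∀ t, IsT e f t → t ≠ w → (2*t+1) ∣ P) ∧ IsT e f v)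

theorem Ctx.main (c : Ctx e f v K w W lam eps) (h2e : 2*eps ≤ 1) {P : ℤ} (hP : Arith e f v K w W P) :
    (ZoneSet lam (e+eps) (f-eps)).Finite ∧
    |((ZoneSet lam (e+eps) (f-eps)).ncard : ℝ) - (f-e-2*eps)/lam| ≤ W ∧
    |(K:ℝ)*W*((ZoneSet lam (e+eps) (f-eps) ∩ SymFix lam).ncard : ℝ) - (f-e-2*eps)/lam| ≤
      W*(P^2*K*K) + W + (K*(P^2*W*W) + K*(W+K*(8*v+1))) := by
  obtain ⟨lo, hi, hR, hc⟩ := c.range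
  have hc := hc h2e
  have hR' : ∀ σ, lo ≤ σ → σ ≤ hi → InR e f w W lam eps σ := fun σ a b => (hR σ).1 ⟨a, b⟩
  refine ⟨?_, ?_, ?_⟩
  · rw [c.zone_eq hR]; exact Finset.finite_toSet _
  · rw [c.zone_card hR]; exact hc
  have hF : ((ZoneSet lam (e+eps) (f-eps) ∩ SymFix lam).ncard : ℝ) =
      ((∑ σ ∈ Finset.Icc lo hi, phi lam K v w W σ : ℤ) : ℝ) := by
    rw [← c.fix_card hR]; push_cast; rfl
  rw [hF]
  have K1 : 1 ≤ K := by have := c.S.hK; have := c.S.v0; omega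
  have K1r : (1:ℝ) ≤ K := by exact_mod_cast K1
  have W1r : (1:ℝ) ≤ W := by exact_mod_cast c.S1.facts.2.2.1
  have v0 : (0:ℝ) ≤ v := by exact_mod_cast c.S.v0
  have p1 : (0:ℝ) ≤ W*(P^2*K*K) := by positivity
  have p2 : (0:ℝ) ≤ K*(P^2*W*W) := by positivity
  have p3 : (0:ℝ) ≤ K*(W+K*(8*v+1)) := by positivity
  rcases hP with ⟨hwv, h1, h2, h3⟩ | ⟨h1, h2, h3⟩
  · have := c.caseK hwv hR' h1 h2 h3
    rw [Finset.sum_const, nsmul_eq_mul, mul_one] at this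
    generalize ∑ σ ∈ Finset.Icc lo hi, phi lam K v w W σ = F at *
    have t : |(K:ℝ) * F - ((Finset.Icc lo hi).card : ℝ)| ≤ P^2*K*K := by exact_mod_cast this
    rw [abs_le] at t hc
    have t1 := mul_le_mul_of_nonneg_left t.1 (by linarith : (0:ℝ) ≤ W)
    have t2 := mul_le_mul_of_nonneg_left t.2 (by linarith : (0:ℝ) ≤ W)
    rw [abs_le]; constructor <;> linarith
  · have := c.case1 hR' h1 (c.inv h2 h3)
    have hr := c.row_count h2e hR' hc
    generalize ∑ σ ∈ Finset.Icc lo hi, phi lam K v w W σ = F at *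
    generalize (∑ σ ∈ Finset.Icc lo hi, ∑ r ∈ Finset.range W.toNat,
      ind K v (yE lam K (qq f w W σ r))) = n1 at *
    have t : |(W:ℝ) * F - n1| ≤ P^2*W*W := by exact_mod_cast this
    rw [abs_le] at t hr
    have t1 := mul_le_mul_of_nonneg_left t.1 (by linarith : (0:ℝ) ≤ K)
    have t2 := mul_le_mul_of_nonneg_left t.2 (by linarith : (0:ℝ) ≤ K)
    rw [abs_le]; constructor <;> linarith

end

/-! ### Thin strips contain few points of `X` -/

theorem Pfun_gap {x y : ℝ} (hx : 0 ≤ x) (h : x ≤ y) : y - x ≤ Pfun y - Pfun x := by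
  have h1 := Pfun_diff x y
  have h2 : (0:ℤ) ≤ ⌊x⌋ := Int.floor_nonneg.2 hx
  have h3 : (0:ℝ) ≤ ⌊x⌋ := by exact_mod_cast h2
  have h4 := mul_nonneg h3 (sub_nonneg.2 h)
  linarith

theorem zone_finite {lam : ℝ} (hl : 0 < lam) (a b : ℝ) : (ZoneSet lam a b).Finite := by
  have : ZoneSet lam a b ⊆ (Finset.Icc 0 ⌊b/lam⌋ ×ˢ Finset.Icc 0 ⌊b/lam⌋ : Finset (ℤ × ℤ)) := by
    rintro ⟨x, y⟩ ⟨h1, h2, h3⟩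
    have x0 : 0 ≤ x := h1.1
    have y0 : 0 ≤ y := h1.2.1
    have x0r : (0:ℝ) ≤ x := by exact_mod_cast x0
    have y0r : (0:ℝ) ≤ y := by exact_mod_cast y0
    have p1 := mul_nonneg hl.le x0r
    have p2 := mul_nonneg hl.le y0r
    have q1 := Pfun_ge (lam * x)
    have q2 := Pfun_ge (lam * y)
    simp only [ham, pt] at h3
    simp only [Finset.coe_product, Set.mem_prod, Finset.mem_coe, Finset.mem_Icc]
    refine ⟨⟨x0, ?_⟩, ⟨y0, ?_⟩⟩ <;> rw [Int.le_floor, le_div_iff₀ hl] <;> linarith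
  exact (Finset.finite_toSet _).subset this

theorem strip_bound {lam : ℝ} {f : ℤ} {a b : ℝ} (hl : 0 < lam) (hf : 1 ≤ f) (hs : lam * (f+1) ≤ 1)
    (hab : a ≤ b) (hb : b ≤ f) :
    ((ZoneSet lam a b).ncard : ℝ) ≤ (2*(4*f+10)+1) * ((b-a)/lam + 1) := by
  have hfin := zone_finite hl a b
  rw [Set.ncard_eq_toFinset_card _ hfin]
  set T := hfin.toFinset with hT
  have hmem : ∀ p ∈ T, p ∈ ZoneSet lam a b := fun p hp => by simpa [hT] using hp
  have B0 : 0 ≤ (b-a)/lam := div_nonneg (by linarith) hl.le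
  rw [Finset.card_eq_sum_card_fiberwise (f := fun p : ℤ × ℤ => p.1 - p.2)
      (t := Finset.Icc (-(4*f+10)) (4*f+10))]
  · push_cast
    refine (Finset.sum_le_card_nsmul _ _ ((b-a)/lam + 1) ?_).trans ?_
    · intro u _
      have hinj : Set.InjOn (fun p : ℤ × ℤ => p.1) (T.filter (fun p => p.1 - p.2 = u)) := by
        intro p hp q hq h
        simp only [Finset.coe_filter, Set.mem_ofPred_eq] at hp hq
        simp only at h
        ext
        · exact h
        · omega
      rw [← Finset.card_image_of_injOn hinj]
      set V := (T.filter (fun p => p.1 - p.2 = u)).image (fun p : ℤ × ℤ => p.1) with hV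
      rcases V.eq_empty_or_nonempty with h0 | h0
      · rw [h0]; simp; linarith
      have hVm : ∀ x ∈ V, (x, x-u) ∈ ZoneSet lam a b := by
        intro x hx
        rw [hV, Finset.mem_image] at hx
        obtain ⟨p, hp, rfl⟩ := hx
        rw [Finset.mem_filter] at hp
        have : (p.1, p.1 - u) = p := by ext <;> simp; omega
        rw [this]; exact hmem p hp.1
      have hz := hVm _ (V.min'_mem h0)
      have := card_le_real (S := V) (A := V.min' h0) (B := V.min' h0 + (b-a)/lam) (fun x hx => by
        have h1 := V.min'_le x hx
        have h1r : ((V.min' h0 : ℤ):ℝ) ≤ x := by exact_mod_cast h1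
        refine ⟨h1r, ?_⟩
        have hx' := hVm x hx
        have a0 : (0:ℤ) ≤ V.min' h0 := hz.1.1
        have a1 : (0:ℤ) ≤ V.min' h0 - u := hz.1.2.1
        have a0r : (0:ℝ) ≤ V.min' h0 := by exact_mod_cast a0
        have a1r : (0:ℝ) ≤ ((V.min' h0 - u : ℤ):ℝ) := by exact_mod_cast a1
        have g1 := Pfun_gap (mul_nonneg hl.le a0r) (mul_le_mul_of_nonneg_left h1r hl.le)
        have h2r : ((V.min' h0 - u : ℤ):ℝ) ≤ ((x - u : ℤ) : ℝ) := by push_cast; linarith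
        have h2m := mul_le_mul_of_nonneg_left h2r hl.le
        have g2 := Pfun_gap (mul_nonneg hl.le a1r) h2m
        have k1 := hz.2.1
        have k2 := hx'.2.2
        simp only [ham, pt] at k1 k2
        have : lam * x - lam * (V.min' h0 : ℤ) ≤ b - a := by linarith
        have : (x:ℝ) - (V.min' h0 : ℤ) ≤ (b-a)/lam := by rw [le_div_iff₀ hl]; linarith
        linarith) (by linarith)
      linarith
    · rw [Int.card_Icc, nsmul_eq_mul]
      apply le_of_eq
      have h1 : (((4*f+10 + 1 - -(4*f+10)).toNat : ℤ)) = 2*(4*f+10)+1 := by omega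
      have h2 : (((4*f+10 + 1 - -(4*f+10)).toNat : ℝ)) = 2*(4*f+10)+1 := by exact_mod_cast h1
      rw [h2]
  · intro p hp
    have h := hmem p hp
    have := Xset_near hl hf hs h.1 (h.2.2.trans hb)
    rw [abs_le] at this
    simp only [Finset.coe_Icc, Set.mem_Icc]
    exact this

/-! ### Arithmetic of the vertex list -/

theorem mem_vertexList {e : ℕ} {t : ℤ} (h : IsT e (nextE e) t) : t.toNat ∈ vertexList e := by
  obtain ⟨t0, c, c0, h1, h2⟩ := h
  have hlt : (e:ℤ) < nextE e := by exact_mod_cast (nextE_spec e).1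
  obtain ⟨t, rfl⟩ := Int.eq_ofNat_of_zero_le t0
  obtain ⟨c, rfl⟩ := Int.eq_ofNat_of_zero_le c0
  have h1' : t^2 + c^2 ≤ e := by exact_mod_cast h1
  have h2' : e < (t+1)^2 + c^2 := by
    have := lt_of_lt_of_le hlt h2; exact_mod_cast this
  unfold vertexList
  rw [List.mem_map]
  refine ⟨c, ?_, ?_⟩
  · rw [List.mem_mergeSort, List.mem_range, Nat.lt_succ_iff, Nat.le_sqrt]
    nlinarith
  · rw [Int.toNat_natCast]
    symm
    rw [Nat.eq_sqrt]
    constructor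
    · have : t*t = t^2 := by ring
      omega
    · have : (t+1)*(t+1) = (t+1)^2 := by ring
      omega

section
variable (e : ℕ)

theorem setup_e : Setup (e:ℤ) (nextE e) (Nat.sqrt e) (2*Nat.sqrt e+1) := by
  have hlt : (e:ℤ) < nextE e := by exact_mod_cast (nextE_spec e).1
  have h1 : Nat.sqrt e ^2 ≤ e := Nat.sqrt_le' e
  have h2 : e < (Nat.sqrt e + 1)^2 := Nat.lt_succ_sqrt' e
  refine ⟨by positivity, rfl, by exact_mod_cast h1, ?_, ?_, hlt⟩
  · have h3 : (e:ℤ) < ((Nat.sqrt e:ℤ) + 1)^2 := by exact_mod_cast h2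
    rcases nextE_gap e (Nat.sqrt e + 1) 0 with h | h
    · exfalso; nlinarith
    · simpa using h
  · exact fun a b => nextE_gap e a b

theorem setup1_e : Setup1 (e:ℤ) (nextE e) (Nat.sqrt (e/2)) (2*Nat.sqrt (e/2)+1) := by
  have hlt : (e:ℤ) < nextE e := by exact_mod_cast (nextE_spec e).1
  have h1 : Nat.sqrt (e/2) ^2 ≤ e/2 := Nat.sqrt_le' _
  have h2 : e/2 < (Nat.sqrt (e/2) + 1)^2 := Nat.lt_succ_sqrt' _
  have h3 : 2 * Nat.sqrt (e/2) ^2 ≤ e := by omega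
  have h4 : e < 2 * (Nat.sqrt (e/2) + 1)^2 := by omega
  refine ⟨by positivity, rfl, by exact_mod_cast h3, ?_, hlt⟩
  have h5 : (e:ℤ) < 2*((Nat.sqrt (e/2):ℤ) + 1)^2 := by exact_mod_cast h4
  rcases nextE_gap e (Nat.sqrt (e/2) + 1) (Nat.sqrt (e/2) + 1) with h | h
  · exfalso; linarith
  · linarith

theorem isT_v : IsT (e:ℤ) (nextE e) (Nat.sqrt e) := by
  have S := setup_e e
  exact ⟨S.v0, 0, le_rfl, by simpa using S.hv, by simpa using S.hf⟩

theorem isT_w : IsT (e:ℤ) (nextE e) (Nat.sqrt (e/2)) := by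
  have S := setup1_e e
  have w0 := S.w0
  have h1 := S.h1
  have h2 := S.h2
  refine ⟨w0, ?_⟩
  rcases nextE_gap e (Nat.sqrt (e/2) + 1) (Nat.sqrt (e/2)) with h | h
  · exact ⟨Nat.sqrt (e/2) + 1, by omega, by linarith, by linarith⟩
  · exact ⟨Nat.sqrt (e/2), w0, by linarith, h⟩

theorem w_le_v : Nat.sqrt (e/2) ≤ Nat.sqrt e := Nat.sqrt_le_sqrt (Nat.div_le_self e 2)

theorem prod_types (m : ℕ) (h : ∀ t ∈ vertexList e, t ≠ m → Nat.gcd (2*m+1) (2*t+1) = 1) :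
    ∃ P : ℤ, IsCoprime (2*(m:ℤ)+1) P ∧ ∀ t, IsT e (nextE e) t → t ≠ m → (2*t+1) ∣ P := by
  refine ⟨∏ t ∈ (vertexList e).toFinset.erase m, (2*(t:ℤ)+1), ?_, ?_⟩
  · apply IsCoprime.prod_right
    intro t ht
    rw [Finset.mem_erase, List.mem_toFinset] at ht
    have := h t ht.2 ht.1
    have := Nat.isCoprime_iff_coprime.2 this
    exact_mod_cast this
  · intro t ht hne
    have hm := mem_vertexList ht
    have t0 := ht.1
    have : (2*t+1) = (2*((t.toNat:ℕ):ℤ)+1) := by rw [Int.toNat_of_nonneg t0]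
    rw [this]
    apply Finset.dvd_prod_of_mem (fun t : ℕ => 2*(t:ℤ)+1)
    rw [Finset.mem_erase, List.mem_toFinset]
    exact ⟨by omega, hm⟩

theorem arith_e (hcop :
      (∀ t ∈ vertexList e, t ≠ Nat.sqrt (e / 2) →
          Nat.gcd (2 * Nat.sqrt (e / 2) + 1) (2 * t + 1) = 1) ∨
      (∀ t ∈ vertexList e, t ≠ Nat.sqrt e →
          Nat.gcd (2 * Nat.sqrt e + 1) (2 * t + 1) = 1)) :
    ∃ P : ℤ, Arith e (nextE e) (Nat.sqrt e) (2*Nat.sqrt e+1) (Nat.sqrt (e/2)) (2*Nat.sqrt (e/2)+1) P := by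
  rcases hcop with h | h
  · obtain ⟨P, h1, h2⟩ := prod_types e _ h
    exact ⟨P, Or.inr ⟨h1, h2, isT_v e⟩⟩
  · rcases (w_le_v e).lt_or_eq with hwv | hwv
    · obtain ⟨P, h1, h2⟩ := prod_types e _ h
      refine ⟨P, Or.inl ⟨by exact_mod_cast hwv, fun t ht hlt => h2 t ht (by omega), ?_, h1⟩⟩
      exact h2 _ (isT_w e) (by omega)
    · rw [← hwv] at h
      obtain ⟨P, h1, h2⟩ := prod_types e _ h
      exact ⟨P, Or.inr ⟨h1, h2, isT_v e⟩⟩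

end

/-! ### The limit -/

theorem interval_contains {I : Set ℝ} {a b eps : ℝ} (hab : eps < b - a) (hI : I ⊆ Set.Ioo a b) (ho : I.OrdConnected)
    (hv : b - a - eps < (MeasureTheory.volume I).toReal) : Set.Icc (a+eps) (b-eps) ⊆ I := by
  intro x hx
  by_contra hxI
  have key : I ⊆ Set.Ioo a x ∨ I ⊆ Set.Ioo x b := by
    by_contra h
    push Not at h
    obtain ⟨h1, h2⟩ := h
    rw [Set.not_subset] at h1 h2
    obtain ⟨y, hy, hy'⟩ := h1
    obtain ⟨z, hz, hz'⟩ := h2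
    have b1 := hI hy
    have b2 := hI hz
    have c1 : x ≤ y := by
      by_contra h; push Not at h; exact hy' ⟨b1.1, h⟩
    have c2 : z ≤ x := by
      by_contra h; push Not at h; exact hz' ⟨h, b2.2⟩
    exact hxI (ho.out hz hy ⟨c2, c1⟩)
  have aux : ∀ c d : ℝ, c ≤ d → I ⊆ Set.Ioo c d → (MeasureTheory.volume I).toReal ≤ d - c := by
    intro c d hcd h
    have h1 := MeasureTheory.measure_mono (μ := MeasureTheory.volume) h
    rw [Real.volume_Ioo] at h1
    have h2 := ENNReal.toReal_mono ENNReal.ofReal_ne_top h1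
    rwa [ENNReal.toReal_ofReal (by linarith)] at h2
  have e0 : 0 ≤ (MeasureTheory.volume I).toReal := ENNReal.toReal_nonneg
  obtain ⟨x1, x2⟩ := hx
  rcases key with h | h
  · by_cases hc : a ≤ x
    · have := aux a x hc h; linarith
    · have := aux a a le_rfl (h.trans (Set.Ioo_subset_Ioo le_rfl (by linarith))); linarith
  · by_cases hc : x ≤ b
    · have := aux x b hc h; linarith
    · have := aux b b le_rfl (h.trans (Set.Ioo_subset_Ioo (by linarith) le_rfl)); linarith

/-- Quantitative version of the density statement. -/
theorem density_bound (e : ℕ) {P : ℤ}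
    (hP : Arith e (nextE e) (Nat.sqrt e) (2*Nat.sqrt e+1) (Nat.sqrt (e/2)) (2*Nat.sqrt (e/2)+1) P) :
    ∃ M1 M2 : ℝ, 0 < M1 ∧ 0 < M2 ∧ ∀ eps, 0 < eps → eps ≤ 1/4 → ∃ l0 > 0, ∀ lam, 0 < lam → lam < l0 →
      ∀ I : Set ℝ, I ⊆ Ie e → Set.Icc ((e:ℝ)+eps) (nextE e - eps) ⊆ I →
      |symFixDensity lam I - 1 / ((2 * (Nat.sqrt e : ℝ) + 1) * (2 * (Nat.sqrt (e / 2) : ℝ) + 1))|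
        ≤ M1 * eps + M2 * lam := by
  have S := setup_e e
  have S1 := setup1_e e
  set v := Nat.sqrt e with hv
  set w := Nat.sqrt (e/2) with hw
  set f := nextE e with hf
  set K : ℝ := 2*(v:ℝ)+1 with hK
  set W : ℝ := 2*(w:ℝ)+1 with hW
  have K1 : 1 ≤ K := by have : (0:ℝ) ≤ v := by positivity
                        linarith
  have W1 : 1 ≤ W := by have : (0:ℝ) ≤ w := by positivity
                        linarith
  have v0 : (0:ℝ) ≤ v := by positivity
  have f1 : (1:ℤ) ≤ f := S1.facts.1
  have f1r : (1:ℝ) ≤ f := by exact_mod_cast f1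
  have hef : (e:ℝ) + 1 ≤ f := by exact_mod_cast S.hef
  have e0r : (0:ℝ) ≤ e := by positivity
  set C : ℝ := W*(P^2*K*K) + W + (K*(P^2*W*W) + K*(W+K*(8*v+1))) with hC
  have C0 : 0 ≤ C := by positivity
  set H : ℝ := 2*(4*f+10)+1 with hH
  have H0 : 0 < H := by positivity
  have KW1 : 1 ≤ K*W := by nlinarith
  refine ⟨4*((K*W+1)*(2*H)), 4*((K*W+1)*(2*H) + C + W), by positivity, by positivity, ?_⟩
  intro eps he he1
  refine ⟨min (eps/(400*((f:ℝ)+5)^2)) (min (1/(f+1)) (1/(4*W))), by positivity, ?_⟩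
  intro lam hl hl0 I hI1 hI2
  rw [lt_min_iff, lt_min_iff, lt_div_iff₀ (by positivity), lt_div_iff₀ (by positivity),
    lt_div_iff₀ (by positivity)] at hl0
  obtain ⟨l1, l2, l3⟩ := hl0
  have c : Ctx (e:ℤ) f v (2*v+1) w (2*w+1) lam eps :=
    ⟨S, S1, by exact_mod_cast w_le_v e, by positivity, ⟨hl, he, by linarith, by push_cast; linarith⟩⟩
  obtain ⟨zf, m1, m2⟩ := c.main (by linarith) hP
  push_cast at zf m1 m2
  rw [← hK, ← hW] at m2
  rw [← hW] at m1
  rw [← hC] at m2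
  set Z := ZoneSet lam ((e:ℝ)+eps) (f-eps) with hZ
  set Lr := ((f:ℝ)-e-2*eps)/lam with hLr
  -- the two thin strips
  have s1 := strip_bound (f := (f:ℤ)) (a := (e:ℝ)) (b := e+eps) hl f1 (by push_cast; linarith) (by linarith)
    (by push_cast; linarith)
  have s2 := strip_bound (f := (f:ℤ)) (a := (f:ℝ)-eps) (b := f) hl f1 (by push_cast; linarith) (by linarith)
    (by push_cast; linarith)
  push_cast at s1 s2
  rw [← hH] at s1 s2
  have q1 : (e:ℝ)+eps-e = eps := by ring
  have q2 : (f:ℝ)-(f-eps) = eps := by ring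
  rw [q1] at s1
  rw [q2] at s2
  set B1 := ZoneSet lam (e:ℝ) (e+eps) with hB1
  set B2 := ZoneSet lam ((f:ℝ)-eps) f with hB2
  have fB1 : B1.Finite := zone_finite hl _ _
  have fB2 : B2.Finite := zone_finite hl _ _
  set X := XeSet lam I with hX
  have ZX : Z ⊆ X := fun p hp => ⟨hp.1, hI2 hp.2⟩
  have XZ : X ⊆ Z ∪ (B1 ∪ B2) := by
    intro p hp
    have h1 : ham (pt lam p) ∈ Ie e := hI1 hp.2
    obtain ⟨h1, h2⟩ := h1
    by_cases a1 : ham (pt lam p) ≤ e + eps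
    · exact Or.inr (Or.inl ⟨hp.1, h1.le, a1⟩)
    · by_cases a2 : (f:ℝ) - eps ≤ ham (pt lam p)
      · exact Or.inr (Or.inr ⟨hp.1, a2, h2.le⟩)
      · push Not at a1 a2
        exact Or.inl ⟨hp.1, a1.le, a2.le⟩
  have fU : (Z ∪ (B1 ∪ B2)).Finite := zf.union (fB1.union fB2)
  have fX : X.Finite := fU.subset XZ
  set Y := SymFix lam with hY
  have dens : symFixDensity lam I = ((X ∩ Y).ncard : ℝ) / (X.ncard : ℝ) := rfl
  have n1 : (Z.ncard:ℝ) ≤ X.ncard := by exact_mod_cast Set.ncard_le_ncard ZX fX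
  have n2 : (X.ncard:ℝ) ≤ Z.ncard + (B1.ncard + B2.ncard) := by
    have h1 := Set.ncard_le_ncard XZ fU
    have h2 := Set.ncard_union_le Z (B1 ∪ B2)
    have h3 := Set.ncard_union_le B1 B2
    have : X.ncard ≤ Z.ncard + (B1.ncard + B2.ncard) := by omega
    exact_mod_cast this
  have n3 : ((Z ∩ Y).ncard:ℝ) ≤ (X ∩ Y).ncard := by
    exact_mod_cast Set.ncard_le_ncard (Set.inter_subset_inter_left Y ZX) (fX.inter_of_left Y)
  have n4 : ((X ∩ Y).ncard:ℝ) ≤ (Z ∩ Y).ncard + (B1.ncard + B2.ncard) := by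
    have h0 : X ∩ Y ⊆ (Z ∩ Y) ∪ (B1 ∪ B2) := by
      rintro p ⟨h1, h2⟩
      rcases XZ h1 with h | h
      · exact Or.inl ⟨h, h2⟩
      · exact Or.inr h
    have h1 := Set.ncard_le_ncard h0 ((zf.inter_of_left Y).union (fB1.union fB2))
    have h2 := Set.ncard_union_le (Z ∩ Y) (B1 ∪ B2)
    have h3 := Set.ncard_union_le B1 B2
    have : (X ∩ Y).ncard ≤ (Z ∩ Y).ncard + (B1.ncard + B2.ncard) := by omega
    exact_mod_cast this
  rw [dens]
  generalize ((X ∩ Y).ncard:ℝ) = xm at *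
  generalize (X.ncard:ℝ) = xn at *
  generalize ((Z ∩ Y).ncard:ℝ) = zm at *
  generalize (Z.ncard:ℝ) = zn at *
  generalize (B1.ncard:ℝ) = b1 at *
  generalize (B2.ncard:ℝ) = b2 at *
  rw [abs_le] at m1 m2
  set B := 2*H*(eps/lam+1) with hB
  have bb : b1 + b2 ≤ B := by rw [hB]; linarith
  have KW0 : 0 < K*W := by linarith
  -- lower bound for the number of points
  have xlow : 1/4 ≤ lam * xn := by
    have h1 : Lr - W ≤ xn := by linarith
    have h2 := mul_le_mul_of_nonneg_left h1 hl.le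
    have h3 : lam * Lr = (f:ℝ)-e-2*eps := by rw [hLr]; field_simp
    rw [mul_sub, h3] at h2
    linarith
  have xn0 : 0 < xn := by
    by_contra h; push Not at h
    have := mul_nonneg hl.le (neg_nonneg.2 h)
    linarith
  have big : |K*W*xm - xn| ≤ (K*W+1)*B + C + W := by
    have g1 := mul_le_mul_of_nonneg_left n3 KW0.le
    have g2 := mul_le_mul_of_nonneg_left (n4.trans (by linarith : zm + (b1+b2) ≤ zm + B)) KW0.le
    have B0 : 0 ≤ B := by rw [hB]; positivity
    have := mul_nonneg KW0.le B0
    rw [abs_le]; constructor <;> linarith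
  have eq1 : xm/xn - 1/(K*W) = (K*W*xm - xn)/(K*W*xn) := by field_simp
  rw [eq1, abs_div, abs_of_pos (by positivity : 0 < K*W*xn), div_le_iff₀ (by positivity)]
  refine big.trans ?_
  have hBl : lam * B = 2*H*(eps+lam) := by rw [hB]; field_simp
  have num : lam * ((K*W+1)*B + C + W) = (1/4) * (4*((K*W+1)*(2*H)) * eps + 4*((K*W+1)*(2*H) + C + W) * lam) := by
    linear_combination (K*W+1) * hBl
  set M := 4*((K*W+1)*(2*H)) * eps + 4*((K*W+1)*(2*H) + C + W) * lam with hM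
  have M0 : 0 ≤ M := by positivity
  have r1 := mul_le_mul_of_nonneg_right xlow M0
  have r2 : lam * xn ≤ (K*W) * (lam * xn) := le_mul_of_one_le_left (by positivity) KW1
  have r3 := mul_le_mul_of_nonneg_right r2 M0
  refine le_of_mul_le_mul_left ?_ hl
  rw [num]
  linarith

theorem limit_main (e : ℕ) (hcop :
      (∀ t ∈ vertexList e, t ≠ Nat.sqrt (e / 2) →
          Nat.gcd (2 * Nat.sqrt (e / 2) + 1) (2 * t + 1) = 1) ∨
      (∀ t ∈ vertexList e, t ≠ Nat.sqrt e →
          Nat.gcd (2 * Nat.sqrt e + 1) (2 * t + 1) = 1))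
    (I : ℝ → Set ℝ)
    (hIsub : ∀ lam : ℝ, 0 < lam → I lam ⊆ Ie e)
    (hIint : ∀ lam : ℝ, 0 < lam → (I lam).OrdConnected)
    (hIlen : Tendsto
      (fun lam => (MeasureTheory.volume (I lam)).toReal / ((nextE e : ℝ) - (e : ℝ)))
      (nhdsWithin 0 (Set.Ioi 0)) (nhds 1)) :
    Tendsto (fun lam => symFixDensity lam (I lam))
      (nhdsWithin 0 (Set.Ioi 0))
      (nhds (1 / ((2 * (Nat.sqrt e : ℝ) + 1) * (2 * (Nat.sqrt (e / 2) : ℝ) + 1)))) := by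
  obtain ⟨P, hP⟩ := arith_e e hcop
  obtain ⟨M1, M2, M10, M20, hb⟩ := density_bound e hP
  have hef : (e:ℝ) + 1 ≤ nextE e := by exact_mod_cast (setup_e e).hef
  rw [Metric.tendsto_nhds]
  intro δ hδ
  have heps : 0 < min (1/4) (δ/(2*M1)) := by positivity
  obtain ⟨l0, hl0, h⟩ := hb (min (1/4) (δ/(2*M1))) heps (min_le_left _ _)
  set eps := min (1/4) (δ/(2*M1)) with hE
  have e1 : eps ≤ 1/4 := min_le_left _ _
  have e2 : eps ≤ δ/(2*M1) := min_le_right _ _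
  have D0 : 0 < (nextE e:ℝ) - e := by linarith
  have hlt : 1 - eps/((nextE e:ℝ) - e) < 1 := by
    have : 0 < eps/((nextE e:ℝ) - e) := by positivity
    linarith
  have ev1 := hIlen.eventually (lt_mem_nhds hlt)
  have ev2 : ∀ᶠ lam in nhdsWithin (0:ℝ) (Set.Ioi 0), lam ∈ Set.Ioo 0 (min l0 (δ/(2*M2))) :=
    Ioo_mem_nhdsGT (by positivity)
  filter_upwards [ev1, ev2] with lam h1 h2
  obtain ⟨hl, h3⟩ := h2
  rw [lt_min_iff] at h3
  have hc : Set.Icc ((e:ℝ)+eps) (nextE e - eps) ⊆ I lam := by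
    apply interval_contains (by linarith) (hIsub lam hl) (hIint lam hl)
    rw [lt_div_iff₀ D0, sub_mul, div_mul_cancel₀ _ D0.ne'] at h1
    linarith
  have key := h lam hl h3.1 (I lam) (hIsub lam hl) hc
  rw [Real.dist_eq]
  refine lt_of_le_of_lt key ?_
  have k1 := h3.2
  rw [lt_div_iff₀ (by positivity)] at k1
  rw [le_div_iff₀ (by positivity)] at e2
  linarith

/-- **Density of symmetric minimal orbits** (`thm:minimal_densities`).
Let `e ∈ ℰ` with vertex list `V(e) = (v₁, …, v_k)`, and suppose that for
`i = 1` or `i = k`, `2v_i+1` is coprime to `2v_j+1` for every vertex type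
`v_j ≠ v_i`.  For each `λ > 0` let `I(λ) ⊆ ℐ^e` be an interval all of whose
`X`-points are regular, with `|I(λ)|/|ℐ^e| → 1` as `λ → 0⁺`.  Then the density
of symmetric fixed points of `Φ` in `X^e(λ) = {z ∈ X : 𝒫(z) ∈ I(λ)}` tends to
`1/((2⌊√e⌋+1)(2⌊√(e/2)⌋+1))` as `λ → 0⁺`. -/
theorem symmetric_fixed_point_density (e : ℕ) (he : sumTwoSq e)
    (hcop :
      (∀ t ∈ vertexList e, t ≠ Nat.sqrt (e / 2) →
          Nat.gcd (2 * Nat.sqrt (e / 2) + 1) (2 * t + 1) = 1) ∨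
      (∀ t ∈ vertexList e, t ≠ Nat.sqrt e →
          Nat.gcd (2 * Nat.sqrt e + 1) (2 * t + 1) = 1))
    (I : ℝ → Set ℝ)
    (hIsub : ∀ lam : ℝ, 0 < lam → I lam ⊆ Ie e)
    (hIint : ∀ lam : ℝ, 0 < lam → (I lam).OrdConnected)
    (hIreg : ∀ lam : ℝ, 0 < lam →
      ∀ p ∈ Xset lam, ham (pt lam p) ∈ I lam → RegularPt lam e p)
    (hIlen : Tendsto
      (fun lam => (MeasureTheory.volume (I lam)).toReal / ((nextE e : ℝ) - (e : ℝ)))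
      (nhdsWithin 0 (Set.Ioi 0)) (nhds 1)) :
    Tendsto (fun lam => symFixDensity lam (I lam))
      (nhdsWithin 0 (Set.Ioi 0))
      (nhds (1 / ((2 * (Nat.sqrt e : ℝ) + 1) * (2 * (Nat.sqrt (e / 2) : ℝ) + 1)))) := by
  exact limit_main e hcop I hIsub hIint hIlen
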